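/- For almost every a ∈ (1,4)^d (with respect to Lebesgue measure) there exists γ > 0 such that for all δ > 0, all r ≥ 3, all σ₁,…,σ_r ∈ {-1,1} and all j₁,…,j_r ∈ ℤ^d satisfying σ₁j₁ + ⋯ + σ_rj_r = 0 and |j₁| ≥ ⋯ ≥ |j_r|, at least one of the following holds: (i) the couple (σ,j) is resonant; (ii) σ₁σ₂ = 1 and |Σ_{k=1}^r σ_k √(1+|j_k|_a⁴)| ≳_r γ (⟨j₃⟩⋯⟨j_r⟩)^{-9dr²}; (iii) σ₁σ₂ = -1 and |Σ_{k=1}^r σ_k √(1+|j_k|_a⁴)| ≳_{r,δ} γ ⟨j₁⟩^{-(d-1+δ)} (⟨j₃⟩⋯⟨j_r⟩)^{-44dr⁴}. -/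

import Mathlib

open MeasureTheory
open scoped BigOperators

noncomputable section

namespace BeamPaper

abbrev Idx (d : ℕ) := Fin d → ℤ
def jnormSq (d : ℕ) (j : Idx d) : ℝ := ∑ i, ((j i : ℝ)) ^ 2
def enorm (d : ℕ) (j : Idx d) : ℝ := Real.sqrt (jnormSq d j)
def jap (d : ℕ) (j : Idx d) : ℝ := Real.sqrt (1 + jnormSq d j)
def anormSq (d : ℕ) (a : Fin d → ℝ) (j : Idx d) : ℝ := ∑ i, a i * (j i : ℝ) ^ 2
def omg (d : ℕ) (a : Fin d → ℝ) (j : Idx d) : ℝ := Real.sqrt (1 + anormSq d a j ^ 2)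
def prodTail (d : ℕ) {r : ℕ} (j : Fin r → Idx d) : ℝ :=
  ∏ i : Fin r, if 2 ≤ (i : ℕ) then jap d (j i) else 1
def box (d : ℕ) : Set (Fin d → ℝ) := Set.univ.pi fun _ => Set.Ioo (1 : ℝ) 4

def IsResonant {d r : ℕ} (σ : Fin r → ℤ) (j : Fin r → Idx d) : Prop :=
  Even r ∧ ∃ ρ : Equiv.Perm (Fin r),
    (∀ i, ρ (ρ i) = i) ∧ (∀ i, ρ i ≠ i) ∧
      ∀ i, (∀ l, |j (ρ i) l| = |j i l|) ∧ σ (ρ i) = - σ i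

/-- The non-resonance property of the parameter `a` established in Proposition 2.2
(`mainNR`) of the paper: lower bounds on the small divisors `Σ σ_k ω_{j_k}`,
outside resonant couples. -/
def GoodParam (d : ℕ) (a : Fin d → ℝ) : Prop :=
  ∃ γ : ℝ, 0 < γ ∧ ∃ c : ℕ → ℝ, ∃ C : ℕ → ℝ → ℝ,
    (∀ r, 0 < c r) ∧ (∀ r δ, 0 < C r δ) ∧
      ∀ (r : ℕ) (_hr : 3 ≤ r) (δ : ℝ), 0 < δ →
        ∀ (σ : Fin r → ℤ) (j : Fin r → Idx d),
          (∀ i, σ i = 1 ∨ σ i = -1) →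
          (∑ i, σ i • j i) = 0 →
          (∀ i i' : Fin r, i ≤ i' → enorm d (j i') ≤ enorm d (j i)) →
          ¬ IsResonant σ j →
          (σ ⟨0, by omega⟩ * σ ⟨1, by omega⟩ = 1 →
            c r * (γ * prodTail d j ^ (-(9 * (d : ℝ) * (r : ℝ) ^ 2))) ≤
              |∑ k, (σ k : ℝ) * omg d a (j k)|) ∧
          (σ ⟨0, by omega⟩ * σ ⟨1, by omega⟩ = -1 →
            C r δ * (γ * jap d (j ⟨0, by omega⟩) ^ (-((d : ℝ) - 1 + δ)) *
              prodTail d j ^ (-(44 * (d : ℝ) * (r : ℝ) ^ 4))) ≤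
              |∑ k, (σ k : ℝ) * omg d a (j k)|)

/-- `j_{≥3} = σ₃ j₃ + ⋯ + σ_r j_r` (0-based: indices `k ≥ 2`). -/
def jge3 (d r : ℕ) (σ : Fin r → ℤ) (jt : Fin r → Idx d) : Idx d :=
  fun l => ∑ k : Fin r, if 2 ≤ (k : ℕ) then σ k * jt k l else 0

/-- `j₂ := j₁ + σ₁ j_{≥3}`. -/
def j2of (d r : ℕ) (hr : 3 ≤ r) (σ : Fin r → ℤ) (jt : Fin r → Idx d) (j1 : Idx d) : Idx d :=
  fun l => j1 l + σ ⟨0, by omega⟩ * jge3 d r σ jt l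

/-- The family `(j₁, j₂, j₃, …, j_r)`. -/
def Jfam (d r : ℕ) (hr : 3 ≤ r) (σ : Fin r → ℤ) (jt : Fin r → Idx d) (j1 : Idx d) :
    Fin r → Idx d :=
  fun k => if (k : ℕ) = 0 then j1 else if (k : ℕ) = 1 then j2of d r hr σ jt j1 else jt k

/-- `g_{j₁}(a) = Σ_k σ_k √(1+|j_k|_a⁴)`. -/
def gfun (d r : ℕ) (hr : 3 ≤ r) (σ : Fin r → ℤ) (jt : Fin r → Idx d) (j1 : Idx d)
    (a : Fin d → ℝ) : ℝ :=
  ∑ k, (σ k : ℝ) * omg d a (Jfam d r hr σ jt j1 k)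

/-- `⟨j₃⟩⋯⟨j_r⟩` in terms of the tail data. -/
def tailProd (d r : ℕ) (jt : Fin r → Idx d) : ℝ :=
  ∏ k : Fin r, if 2 ≤ (k : ℕ) then jap d (jt k) else 1

/-- A quantitative form of the Borel–Cantelli lemma. -/
theorem ae_exists_forall_of_summable {α ι : Type*} [Countable ι] [MeasurableSpace α]
    {μ : Measure α} {p : ι → ℝ → α → Prop}
    (mono : ∀ i γ γ' a, 0 < γ' → γ' ≤ γ → p i γ a → p i γ' a)
    {w : ι → ℝ} (hw0 : ∀ i, 0 ≤ w i) (hw : Summable w)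
    (hsmall : ∀ i, μ {a | ¬ p i 1 a} ≤ ENNReal.ofReal (w i))
    (hpos : ∀ i, ∀ᵐ a ∂μ, ∃ γ : ℝ, 0 < γ ∧ p i γ a) :
    ∀ᵐ a ∂μ, ∃ γ : ℝ, 0 < γ ∧ γ ≤ 1 ∧ ∀ i, p i γ a := by
  have hsum : ∑' i, μ {a | ¬ p i 1 a} ≠ ⊤ := by
    refine ne_top_of_le_ne_top ?_ (ENNReal.tsum_le_tsum hsmall)
    rw [← ENNReal.ofReal_tsum_of_nonneg hw0 hw]
    exact ENNReal.ofReal_ne_top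
  filter_upwards [ae_finite_setOfPred_mem hsum, ae_all_iff.2 hpos] with a hfin hall
  choose g hg0 hg using hall
  have hfin' : Set.Finite {i | ¬ p i 1 a} := hfin
  obtain ⟨δ, hδ0, hδ1, hδ⟩ : ∃ δ : ℝ, 0 < δ ∧ δ ≤ 1 ∧ ∀ i, ¬ p i 1 a → δ ≤ g i := by
    have key : ∀ s : Finset ι, ∃ δ : ℝ, 0 < δ ∧ δ ≤ 1 ∧ ∀ i ∈ s, δ ≤ g i := by
      classical
      intro s
      induction s using Finset.induction_on with
      | empty => exact ⟨1, one_pos, le_rfl, by simp⟩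
      | insert i s _ ih =>
        obtain ⟨δ, h0, h1, h⟩ := ih
        refine ⟨min δ (g i), lt_min h0 (hg0 i), (min_le_left _ _).trans h1, ?_⟩
        intro k hk
        rcases Finset.mem_insert.1 hk with rfl | hk
        · exact min_le_right _ _
        · exact (min_le_left _ _).trans (h k hk)
    obtain ⟨δ, h0, h1, h⟩ := key hfin'.toFinset
    exact ⟨δ, h0, h1, fun i hi => h i (by simpa using hi)⟩
  refine ⟨δ, hδ0, hδ1, fun i => ?_⟩
  by_cases hi : p i 1 a
  · exact mono i 1 δ a hδ0 hδ1 hi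
  · exact mono i (g i) δ a hδ0 (hδ i hi) (hg i)

/-- Thresholds that hold almost everywhere up to a point-dependent factor can be chosen
independently of the point, up to one common point-dependent factor. -/
theorem exists_uniform_thresholds {α ι : Type*} [Countable ι] [MeasurableSpace α]
    {μ : Measure α} [IsFiniteMeasure μ] {p : ι → ℝ → α → Prop}
    (mono : ∀ i γ γ' a, 0 < γ' → γ' ≤ γ → p i γ a → p i γ' a)
    (hmeas : ∀ i γ, MeasurableSet {a | p i γ a})
    (hpos : ∀ i, ∀ᵐ a ∂μ, ∃ γ : ℝ, 0 < γ ∧ p i γ a) :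
    ∃ κ : ι → ℝ, (∀ i, 0 < κ i) ∧
      ∀ᵐ a ∂μ, ∃ γ : ℝ, 0 < γ ∧ ∀ i, p i (γ * κ i) a := by
  obtain ⟨ε, hε0, hε, -⟩ : ∃ ε : ι → NNReal, (∀ i, 0 < ε i) ∧ Summable ε ∧ True := by
    obtain ⟨ε, h0, c, hc, -⟩ := NNReal.exists_pos_sum_of_countable (ε := 1) one_ne_zero ι
    exact ⟨ε, h0, hc.summable, trivial⟩
  have hk : ∀ i, ∃ k : ℕ, μ {a | ¬ p i (1 / ((k : ℝ) + 1)) a} ≤ ENNReal.ofReal (ε i) := by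
    intro i
    have hanti : Antitone fun k : ℕ => {a | ¬ p i (1 / ((k : ℝ) + 1)) a} := by
      intro k l hkl a ha hp
      refine ha (mono i _ _ a (by positivity) ?_ hp)
      exact one_div_le_one_div_of_le (by positivity) (by exact_mod_cast Nat.succ_le_succ hkl)
    have hlim := tendsto_measure_iInter_atTop (μ := μ)
      (s := fun k : ℕ => {a | ¬ p i (1 / ((k : ℝ) + 1)) a})
      (fun k => (hmeas i _).compl.nullMeasurableSet) hanti ⟨0, measure_ne_top _ _⟩
    have hzero : μ (⋂ k : ℕ, {a | ¬ p i (1 / ((k : ℝ) + 1)) a}) = 0 := by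
      refine measure_mono_null ?_ (hpos i)
      rintro a ha ⟨γ, hγ, hp⟩
      obtain ⟨k, hk⟩ := exists_nat_one_div_lt hγ
      exact Set.mem_iInter.1 ha k (mono i _ _ a (by positivity) hk.le hp)
    rw [hzero] at hlim
    have hpos' : (0 : ENNReal) < ENNReal.ofReal (ε i) := by
      simpa using hε0 i
    obtain ⟨k, hk⟩ := (hlim.eventually (gt_mem_nhds hpos')).exists
    exact ⟨k, hk.le⟩
  choose k hk using hk
  refine ⟨fun i => 1 / ((k i : ℝ) + 1), fun i => by positivity, ?_⟩
  have := ae_exists_forall_of_summable (μ := μ)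
    (p := fun i γ a => p i (γ * (1 / ((k i : ℝ) + 1))) a) (w := fun i => (ε i : ℝ))
    (fun i γ γ' a h h' hp => mono i _ _ a (by positivity) (by gcongr) hp)
    (fun i => (ε i).2) (NNReal.summable_coe.2 hε) (fun i => by simpa using hk i)
    (fun i => by
      filter_upwards [hpos i] with a ⟨γ, hγ, hp⟩
      refine ⟨γ * ((k i : ℝ) + 1), by positivity, ?_⟩
      have : γ * ((k i : ℝ) + 1) * (1 / ((k i : ℝ) + 1)) = γ := by field_simp
      rwa [this])
  filter_upwards [this] with a ⟨γ, h0, _, h⟩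
  exact ⟨γ, h0, h⟩

/-- The enlarged cube `(1/2,4)^d`. -/
def cube (d : ℕ) : Set (Fin d → ℝ) := Set.univ.pi fun _ => Set.Ioo (1 / 2 : ℝ) 4

/-- A subset of the cube which never returns to itself under translation by `τ v`,
`τ ∈ [τ₀,1]`, has measure `O(τ₀)`. -/
theorem volume_le_of_translate_notMem {d : ℕ} {B : Set (Fin d → ℝ)} (hB : MeasurableSet B)
    (hsub : B ⊆ cube d) {v : Fin d → ℝ} (hv : ∀ i, |v i| ≤ 1) {τ₀ : ℝ} (h0 : 0 < τ₀)
    (h : ∀ a ∈ B, ∀ τ, τ₀ ≤ τ → τ ≤ 1 → a + τ • v ∉ B) :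
    volume B ≤ ENNReal.ofReal (6 ^ d * τ₀) := by
  set K := ⌊1 / τ₀⌋₊ with hK
  set Q : Set (Fin d → ℝ) := Set.univ.pi fun _ => Set.Ioo (-1 : ℝ) 5 with hQ
  have hvolQ : volume Q = ENNReal.ofReal (6 ^ d) := by
    rw [hQ, Real.volume_pi_Ioo]
    norm_num
  have hKτ : (K : ℝ) * τ₀ ≤ 1 := by
    have := Nat.floor_le (show 0 ≤ 1 / τ₀ by positivity)
    rw [le_div_iff₀ h0] at this
    exact this
  have hK1 : 1 ≤ τ₀ * ((K : ℝ) + 1) := by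
    have := (Nat.lt_floor_add_one (1 / τ₀)).le
    rw [div_le_iff₀ h0] at this
    linarith
  let T : ℕ → Set (Fin d → ℝ) := fun k => (fun a => ((k : ℝ) * τ₀) • v + a) ⁻¹' B
  have hTm : ∀ k, MeasurableSet (T k) := fun k => hB.preimage (measurable_const_add _)
  have hTv : ∀ k, volume (T k) = volume B := fun k => measure_preimage_add _ _ _
  have key : ∀ k l : ℕ, k < l → l ≤ K → Disjoint (T k) (T l) := by
    intro k l hkl hl
    rw [Set.disjoint_left]
    intro a hk hl'
    have hl1 : (l : ℝ) ≤ K := by exact_mod_cast hl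
    have hkl1 : (k : ℝ) + 1 ≤ l := by exact_mod_cast hkl
    have hk0 : (0 : ℝ) ≤ k := by positivity
    refine h _ hk (((l : ℝ) - k) * τ₀) (by nlinarith) (by nlinarith) ?_
    have : ((k : ℝ) * τ₀) • v + a + (((l : ℝ) - k) * τ₀) • v = ((l : ℝ) * τ₀) • v + a := by
      ext i; simp; ring
    rw [this]
    exact hl'
  have hdisj : ((Finset.range (K + 1) : Finset ℕ) : Set ℕ).PairwiseDisjoint T := by
    intro k hk l hl hne
    simp only [Finset.coe_range, Set.mem_Iio] at hk hl
    rcases lt_or_gt_of_ne hne with h1 | h1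
    · exact key k l h1 (by omega)
    · exact (key l k h1 (by omega)).symm
  have hsubQ : (⋃ k ∈ Finset.range (K + 1), T k) ⊆ Q := by
    intro a ha
    simp only [Set.mem_iUnion, Finset.mem_range] at ha
    obtain ⟨k, hk, hka⟩ := ha
    intro i _
    have h1 := hsub hka i (Set.mem_univ i)
    simp only [Pi.add_apply, Pi.smul_apply, smul_eq_mul, Set.mem_Ioo] at h1
    have hk1 : (k : ℝ) ≤ K := by exact_mod_cast Nat.lt_succ_iff.1 hk
    have hk2 : |(k : ℝ) * τ₀ * v i| ≤ 1 := by
      rw [abs_mul, abs_of_nonneg (by positivity : (0 : ℝ) ≤ k * τ₀)]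
      have : (k : ℝ) * τ₀ ≤ 1 := by nlinarith
      nlinarith [hv i, abs_nonneg (v i), (by positivity : (0 : ℝ) ≤ k * τ₀)]
    rw [abs_le] at hk2
    constructor <;> linarith [hk2.1, hk2.2, h1.1, h1.2]
  have h1 : ((K + 1 : ℕ) : ENNReal) * volume B ≤ ENNReal.ofReal (6 ^ d) := by
    calc ((K + 1 : ℕ) : ENNReal) * volume B = ∑ k ∈ Finset.range (K + 1), volume (T k) := by
          simp [hTv]
      _ = volume (⋃ k ∈ Finset.range (K + 1), T k) :=
          (measure_biUnion_finset hdisj fun k _ => hTm k).symm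
      _ ≤ volume Q := measure_mono hsubQ
      _ = _ := hvolQ
  calc volume B ≤ ENNReal.ofReal (τ₀ * ((K : ℝ) + 1)) * volume B := by
        conv_lhs => rw [← one_mul (volume B)]
        gcongr
        simpa using hK1
    _ = ENNReal.ofReal τ₀ * (((K + 1 : ℕ) : ENNReal) * volume B) := by
        rw [ENNReal.ofReal_mul h0.le, mul_assoc]
        congr 2
        rw [show (K : ℝ) + 1 = ((K + 1 : ℕ) : ℝ) by push_cast; ring, ENNReal.ofReal_natCast]
    _ ≤ ENNReal.ofReal τ₀ * ENNReal.ofReal (6 ^ d) := by gcongr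
    _ = _ := by rw [← ENNReal.ofReal_mul h0.le, mul_comm]

/-- A bounded set of reals without `M` points that are `lam`-separated has measure `O(M lam)`. -/
theorem volume_le_or_exists_separated {lam : ℝ} (hlam : 0 < lam) (M : ℕ) :
    ∀ E : Set ℝ, BddBelow E →
      (∃ t : ℕ → ℝ, (∀ i < M, t i ∈ E) ∧ ∀ i, i + 1 < M → t i + lam ≤ t (i + 1)) ∨
        volume E ≤ ENNReal.ofReal (2 * M * lam) := by
  induction M with
  | zero => intro E _; exact Or.inl ⟨fun _ => 0, by simp, by simp⟩
  | succ M ih =>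
    intro E hE
    rcases E.eq_empty_or_nonempty with rfl | hne
    · right; simp
    obtain ⟨t₀, ht₀, hlt⟩ := exists_lt_of_csInf_lt hne (lt_add_of_pos_right (sInf E) hlam)
    rcases ih (E ∩ Set.Ici (t₀ + lam)) (hE.mono Set.inter_subset_left) with ⟨t, ht, hsep⟩ | hvol
    · left
      refine ⟨fun i => if i = 0 then t₀ else t (i - 1), ?_, ?_⟩
      · intro i hi
        by_cases h : i = 0
        · simp [h, ht₀]
        · simpa [h] using (ht (i - 1) (by omega)).1
      · intro i hi
        by_cases h : i = 0
        · subst h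
          simpa using (ht 0 (by omega)).2
        · have := hsep (i - 1) (by omega)
          simpa [h, Nat.sub_add_cancel (Nat.one_le_iff_ne_zero.2 h)] using this
    · right
      have hcov : E ⊆ (E ∩ Set.Ici (t₀ + lam)) ∪ Set.Icc (sInf E) (sInf E + 2 * lam) := by
        intro x hx
        by_cases h : t₀ + lam ≤ x
        · exact Or.inl ⟨hx, h⟩
        · exact Or.inr ⟨csInf_le hE hx, by linarith⟩
      calc volume E ≤ _ := measure_mono hcov
        _ ≤ _ := measure_union_le _ _
        _ ≤ ENNReal.ofReal (2 * M * lam) + ENNReal.ofReal (2 * lam) := by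
            gcongr
            rw [Real.volume_Icc]
            simp
        _ = _ := by
            rw [← ENNReal.ofReal_add (by positivity) (by positivity)]
            congr 1
            push_cast
            ring

theorem exists_small_derivative_point {κ : Type*} [DecidableEq κ] {α : ℝ} (hα : 1 / 2 ≤ α)
    {s : Finset κ} {p : κ} (hp : p ∈ s) {c x : κ → ℝ} {lam X ε a b : ℝ}
    (hlam : 0 < lam) (hx : ∀ k ∈ s, 0 ≤ x k ∧ x k ≤ X) (hX : 1 ≤ X)
    (ha : a ∈ Set.Icc (1 / 4 : ℝ) 1) (hb : b ∈ Set.Icc (1 / 4 : ℝ) 1) (hab : a + lam ≤ b)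
    (hFa : |∑ k ∈ s, c k * (a + x k) ^ (-α)| ≤ ε) (hFb : |∑ k ∈ s, c k * (b + x k) ^ (-α)| ≤ ε) :
    ∃ ξ ∈ Set.Ioo a b,
      |∑ k ∈ s.erase p, c k * (x k - x p) * (ξ + x k) ^ (-(α + 1))| ≤
        8 * 4 ^ α * (X / lam) * ε := by
  have hε : 0 ≤ ε := (abs_nonneg _).trans hFa
  have hpos : ∀ k ∈ s, ∀ μ, a ≤ μ → 0 < μ + x k := by
    intro k hk μ hμ
    linarith [(hx k hk).1, ha.1]
  have hder : ∀ μ, a ≤ μ → HasDerivAt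
      (fun μ => (∑ k ∈ s, c k * (μ + x k) ^ (-α)) * (μ + x p) ^ α)
      (α * (μ + x p) ^ (α - 1) *
        ∑ k ∈ s.erase p, c k * (x k - x p) * (μ + x k) ^ (-(α + 1))) μ := by
    intro μ hμ
    have h1 : HasDerivAt (fun μ => ∑ k ∈ s, c k * (μ + x k) ^ (-α))
        (∑ k ∈ s, c k * (1 * (-α) * (μ + x k) ^ (-α - 1))) μ :=
      HasDerivAt.fun_sum fun k hk =>
        (((hasDerivAt_id' μ).add_const (x k)).rpow_const
          (Or.inl (hpos k hk μ hμ).ne')).const_mul (c k)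
    have h2 : HasDerivAt (fun μ => (μ + x p) ^ α) (1 * α * (μ + x p) ^ (α - 1)) μ :=
      ((hasDerivAt_id' μ).add_const (x p)).rpow_const (Or.inl (hpos p hp μ hμ).ne')
    refine (h1.mul h2).congr_deriv ?_
    have hup := hpos p hp μ hμ
    rw [Finset.sum_erase _ (by simp), Finset.sum_mul, Finset.mul_sum, Finset.sum_mul,
      ← Finset.sum_add_distrib]
    refine Finset.sum_congr rfl fun k hk => ?_
    have huk := hpos k hk μ hμ
    have e1 : (μ + x k) ^ (-α) = (μ + x k) ^ (-(α + 1)) * (μ + x k) := by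
      rw [← Real.rpow_add_one huk.ne']; congr 1; ring
    have e2 : (μ + x p) ^ α = (μ + x p) ^ (α - 1) * (μ + x p) := by
      rw [← Real.rpow_add_one hup.ne']; congr 1; ring
    have e3 : (-α - 1) = -(α + 1) := by ring
    rw [e1, e2, e3]
    ring
  have hlt : a < b := by linarith
  obtain ⟨ξ, hξ, hslope⟩ := exists_hasDerivAt_eq_slope
    (fun μ => (∑ k ∈ s, c k * (μ + x k) ^ (-α)) * (μ + x p) ^ α) _ hlt
    (fun μ hμ => (hder μ hμ.1).continuousAt.continuousWithinAt)
    (fun μ hμ => hder μ hμ.1.le)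
  refine ⟨ξ, hξ, ?_⟩
  set S := ∑ k ∈ s.erase p, c k * (x k - x p) * (ξ + x k) ^ (-(α + 1)) with hS
  have hu := hpos p hp ξ hξ.1.le
  set u := ξ + x p with hudef
  have hbound : ∀ y ∈ Set.Icc (1 / 4 : ℝ) 1, a ≤ y → (y + x p) ^ α ≤ 4 ^ α * u ^ α := by
    intro y hy hay
    rw [← Real.mul_rpow (by norm_num) hu.le]
    refine Real.rpow_le_rpow (hpos p hp y hay).le ?_ (by linarith)
    linarith [hy.2, (hx p hp).1, ha.1, hξ.1]
  have hnum : |(∑ k ∈ s, c k * (b + x k) ^ (-α)) * (b + x p) ^ α -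
      (∑ k ∈ s, c k * (a + x k) ^ (-α)) * (a + x p) ^ α| ≤ 2 * ε * (4 ^ α * u ^ α) := by
    refine (abs_sub _ _).trans ?_
    rw [abs_mul, abs_mul, abs_of_nonneg (Real.rpow_nonneg (hpos p hp b hlt.le).le _),
      abs_of_nonneg (Real.rpow_nonneg (hpos p hp a le_rfl).le _)]
    have h1 := mul_le_mul hFa (hbound a ha le_rfl) (Real.rpow_nonneg (hpos p hp a le_rfl).le _) hε
    have h2 := mul_le_mul hFb (hbound b hb hlt.le)
      (Real.rpow_nonneg (hpos p hp b hlt.le).le _) hε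
    linarith
  have hua : 0 < u ^ (α - 1) := Real.rpow_pos_of_pos hu _
  have hmul : |α * u ^ (α - 1) * S| * (b - a) ≤ 2 * ε * (4 ^ α * u ^ α) := by
    rw [hslope, abs_div, abs_of_pos (sub_pos.2 hlt), div_mul_cancel₀ _ (sub_pos.2 hlt).ne']
    exact hnum
  have e2 : u ^ α = u ^ (α - 1) * u := by
    rw [← Real.rpow_add_one hu.ne']; congr 1; ring
  rw [abs_mul, abs_mul, abs_of_pos (by linarith : 0 < α), abs_of_pos hua, e2] at hmul
  have hmul2 : α * |S| * (b - a) ≤ 2 * ε * 4 ^ α * u := by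
    refine le_of_mul_le_mul_left ?_ hua
    linarith
  have h4 : (0 : ℝ) < 4 ^ α := Real.rpow_pos_of_pos (by norm_num) _
  have hu2 : u ≤ 2 * X := by linarith [hξ.2, hb.2, (hx p hp).2]
  have h3 : 1 / 2 * |S| * lam ≤ α * |S| * (b - a) := by
    have hS0 := abs_nonneg S
    have : lam ≤ b - a := by linarith
    gcongr
  have h5 : 2 * ε * 4 ^ α * u ≤ 2 * ε * 4 ^ α * (2 * X) := by gcongr
  have h6 : |S| * lam ≤ 8 * 4 ^ α * X * ε := by linarith
  rw [show 8 * 4 ^ α * (X / lam) * ε = (8 * 4 ^ α * X * ε) / lam by ring, le_div_iff₀ hlam]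
  exact h6

/-- Smallness of a sum of powers at `2 ^ n` separated points forces small coefficients. -/
theorem coeff_le_of_small_at_separated {κ : Type*} [DecidableEq κ] (n : ℕ) :
    ∀ α : ℝ, 1 / 2 ≤ α → ∃ K : ℝ, 0 < K ∧
      ∀ (s : Finset κ) (c x : κ → ℝ) (lam Δ X ε η : ℝ), s.card = n + 1 →
        0 < lam → 0 < Δ → 1 ≤ X → 0 < η →
        (∀ k ∈ s, 0 ≤ x k ∧ x k ≤ X) → (∀ k ∈ s, ∀ l ∈ s, k ≠ l → Δ ≤ |x k - x l|) →
        (∀ k ∈ s, η ≤ |c k|) →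
        ∀ t : ℕ → ℝ, (∀ i < 2 ^ n, t i ∈ Set.Icc (1 / 4 : ℝ) 1) →
          (∀ i, i + 1 < 2 ^ n → t i + lam ≤ t (i + 1)) →
          (∀ i < 2 ^ n, |∑ k ∈ s, c k * (t i + x k) ^ (-α)| ≤ ε) →
          η ≤ ε * K * (X / (lam * Δ)) ^ n * X ^ (α + n) := by
  induction n with
  | zero =>
    intro α hα
    refine ⟨2 ^ α, Real.rpow_pos_of_pos (by norm_num) _, ?_⟩
    intro s c x lam Δ X ε η hs _ _ hX hη hx _ hc t ht _ hF
    obtain ⟨k, rfl⟩ := Finset.card_eq_one.1 hs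
    have h0 := hF 0 (by norm_num)
    have ht0 := ht 0 (by norm_num)
    have hxk := hx k (by simp)
    have hck := hc k (by simp)
    have hu : 0 < t 0 + x k := by linarith [ht0.1]
    simp only [Finset.sum_singleton, abs_mul] at h0
    rw [abs_of_pos (Real.rpow_pos_of_pos hu _), Real.rpow_neg hu.le] at h0
    have hua : 0 < (t 0 + x k) ^ α := Real.rpow_pos_of_pos hu _
    have hle : (t 0 + x k) ^ α ≤ 2 ^ α * X ^ α := by
      rw [← Real.mul_rpow (by norm_num) (by linarith)]
      exact Real.rpow_le_rpow hu.le (by linarith [ht0.2]) (by linarith)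
    rw [← div_eq_mul_inv, div_le_iff₀ hua] at h0
    have hε : 0 ≤ ε := by
      by_contra hneg
      nlinarith [abs_nonneg (c k)]
    simp only [pow_zero, mul_one, Nat.cast_zero, add_zero]
    calc η ≤ |c k| := hck
      _ ≤ ε * (t 0 + x k) ^ α := h0
      _ ≤ ε * (2 ^ α * X ^ α) := by gcongr
      _ = _ := by ring
  | succ n ih =>
    intro α hα
    obtain ⟨K, hK, hmain⟩ := ih (α + 1) (by linarith)
    have h4 : (0 : ℝ) < 4 ^ α := Real.rpow_pos_of_pos (by norm_num) _
    refine ⟨8 * 4 ^ α * K, by positivity, ?_⟩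
    intro s c x lam Δ X ε η hs hlam hΔ hX hη hx hsep hc t ht htsep hF
    obtain ⟨p, hp⟩ : s.Nonempty := Finset.card_pos.1 (by omega)
    have hpow : 2 ^ (n + 1) = 2 * 2 ^ n := by ring
    have hξ : ∀ i, ∃ ξ, i < 2 ^ n → ξ ∈ Set.Ioo (t (2 * i)) (t (2 * i + 1)) ∧
        |∑ k ∈ s.erase p, c k * (x k - x p) * (ξ + x k) ^ (-(α + 1))| ≤
          8 * 4 ^ α * (X / lam) * ε := by
      intro i
      by_cases hi : i < 2 ^ n
      · obtain ⟨ξ, h1, h2⟩ := exists_small_derivative_point hα hp hlam hx hX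
          (ht (2 * i) (by omega)) (ht (2 * i + 1) (by omega)) (htsep (2 * i) (by omega))
          (hF (2 * i) (by omega)) (hF (2 * i + 1) (by omega))
        exact ⟨ξ, fun _ => ⟨h1, h2⟩⟩
      · exact ⟨0, fun h => absurd h hi⟩
    choose ξ hξ using hξ
    have hfin := hmain (s.erase p) (fun k => c k * (x k - x p)) x lam Δ X
      (8 * 4 ^ α * (X / lam) * ε) (η * Δ) (by rw [Finset.card_erase_of_mem hp, hs]; rfl)
      hlam hΔ hX (by positivity) (fun k hk => hx k (Finset.mem_of_mem_erase hk))
      (fun k hk l hl => hsep k (Finset.mem_of_mem_erase hk) l (Finset.mem_of_mem_erase hl))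
      (fun k hk => by
        rw [abs_mul]
        have h1 := hc k (Finset.mem_of_mem_erase hk)
        have h2 := hsep k (Finset.mem_of_mem_erase hk) p hp (Finset.ne_of_mem_erase hk)
        exact mul_le_mul h1 h2 hΔ.le (abs_nonneg _))
      ξ
      (fun i hi => ⟨(ht (2 * i) (by omega)).1.trans (hξ i hi).1.1.le,
        (hξ i hi).1.2.le.trans (ht (2 * i + 1) (by omega)).2⟩)
      (fun i hi => by
        have h1 := (hξ i (by omega)).1.2
        have h2 := (hξ (i + 1) hi).1.1
        have h3 := htsep (2 * i + 1) (by omega)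
        have h4 : 2 * (i + 1) = 2 * i + 1 + 1 := by ring
        rw [h4] at h2
        linarith)
      (fun i hi => (hξ i hi).2)
    have hfin' : η ≤ (8 * 4 ^ α * (X / lam) * ε * K * (X / (lam * Δ)) ^ n *
        X ^ (α + 1 + n)) / Δ := by
      rw [le_div_iff₀ hΔ]; exact hfin
    refine hfin'.trans_eq ?_
    have : α + 1 + (n : ℝ) = α + ((n + 1 : ℕ) : ℝ) := by push_cast; ring
    rw [this, pow_succ]
    field_simp

/-- Sublevel estimate for `y + ∑ c_k √(μ + x_k)`, uniform in the constant `y`. -/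
theorem exists_sublevel_constant (κ : Type*) [DecidableEq κ] (r : ℕ) :
    ∃ c₀ : ℝ, 0 < c₀ ∧ c₀ ≤ 1 ∧
      ∀ (s : Finset κ) (c x : κ → ℝ) (lam Δ X y ε : ℝ), s.Nonempty → s.card ≤ r →
        0 < lam → lam ≤ 1 → 0 < Δ → Δ ≤ 1 → 1 ≤ X →
        (∀ k ∈ s, 0 ≤ x k ∧ x k ≤ X) → (∀ k ∈ s, ∀ l ∈ s, k ≠ l → Δ ≤ |x k - x l|) →
        (∀ k ∈ s, 1 ≤ |c k|) → ε ≤ c₀ * (lam ^ r * Δ ^ r * (X ^ (2 * r))⁻¹) →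
        volume {μ ∈ Set.Ioo (1 / 4 : ℝ) 1 | |y + ∑ k ∈ s, c k * √(μ + x k)| < ε} ≤
          ENNReal.ofReal (2 ^ (r + 1) * lam) := by
  have hK : ∀ n : ℕ, ∃ K : ℝ, 0 < K ∧
      ∀ (s : Finset κ) (c x : κ → ℝ) (lam Δ X ε η : ℝ), s.card = n + 1 →
        0 < lam → 0 < Δ → 1 ≤ X → 0 < η →
        (∀ k ∈ s, 0 ≤ x k ∧ x k ≤ X) → (∀ k ∈ s, ∀ l ∈ s, k ≠ l → Δ ≤ |x k - x l|) →
        (∀ k ∈ s, η ≤ |c k|) →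
        ∀ t : ℕ → ℝ, (∀ i < 2 ^ n, t i ∈ Set.Icc (1 / 4 : ℝ) 1) →
          (∀ i, i + 1 < 2 ^ n → t i + lam ≤ t (i + 1)) →
          (∀ i < 2 ^ n, |∑ k ∈ s, c k * (t i + x k) ^ (-(1 / 2 : ℝ))| ≤ ε) →
          η ≤ ε * K * (X / (lam * Δ)) ^ n * X ^ ((1 / 2 : ℝ) + n) :=
    fun n => coeff_le_of_small_at_separated n (1 / 2) le_rfl
  choose K hK0 hK using hK
  set Kmax := 1 + ∑ n ∈ Finset.range r, K n with hKmax
  have hKmax1 : 1 ≤ Kmax := by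
    have : 0 ≤ ∑ n ∈ Finset.range r, K n := Finset.sum_nonneg fun n _ => (hK0 n).le
    linarith
  refine ⟨1 / (8 * Kmax), by positivity, ?_, ?_⟩
  · rw [div_le_one (by positivity)]; linarith
  intro s c x lam Δ X y ε hne hcard hlam hlam1 hΔ hΔ1 hX hx hsep hc hε
  obtain ⟨n, hn⟩ : ∃ n, s.card = n + 1 :=
    ⟨s.card - 1, by have := Finset.card_pos.2 hne; omega⟩
  have hnr : n + 1 ≤ r := by omega
  rcases volume_le_or_exists_separated hlam (2 ^ (n + 1))
    {μ ∈ Set.Ioo (1 / 4 : ℝ) 1 | |y + ∑ k ∈ s, c k * √(μ + x k)| < ε}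
    ⟨1 / 4, fun μ hμ => hμ.1.1.le⟩ with ⟨t, ht, htsep⟩ | hvol
  · exfalso
    have hpow : 2 ^ (n + 1) = 2 * 2 ^ n := by ring
    have hξ : ∀ i, ∃ ξ, i < 2 ^ n → ξ ∈ Set.Ioo (t (2 * i)) (t (2 * i + 1)) ∧
        |∑ k ∈ s, c k * (ξ + x k) ^ (-(1 / 2 : ℝ))| ≤ 4 * ε / lam := by
      intro i
      by_cases hi : i < 2 ^ n
      swap
      · exact ⟨0, fun h => absurd h hi⟩
      have h1 := ht (2 * i) (by omega)
      have h2 := ht (2 * i + 1) (by omega)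
      have h12 := htsep (2 * i) (by omega)
      have hder : ∀ μ, t (2 * i) ≤ μ → HasDerivAt (fun μ => y + ∑ k ∈ s, c k * √(μ + x k))
          (1 / 2 * ∑ k ∈ s, c k * (μ + x k) ^ (-(1 / 2 : ℝ))) μ := by
        intro μ hμ
        rw [Finset.mul_sum]
        refine HasDerivAt.const_add _ (HasDerivAt.fun_sum fun k hk => ?_)
        have hu : 0 < μ + x k := by linarith [h1.1.1, (hx k hk).1]
        refine ((((hasDerivAt_id' μ).add_const (x k)).sqrt hu.ne').const_mul (c k)).congr_deriv ?_
        rw [Real.rpow_neg hu.le, ← Real.sqrt_eq_rpow]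
        have := Real.sqrt_pos.2 hu
        field_simp
      have hlt : t (2 * i) < t (2 * i + 1) := by linarith
      obtain ⟨ξ, hξ, hslope⟩ := exists_hasDerivAt_eq_slope _ _ hlt
        (fun μ hμ => (hder μ hμ.1).continuousAt.continuousWithinAt)
        (fun μ hμ => hder μ hμ.1.le)
      refine ⟨ξ, fun _ => ⟨hξ, ?_⟩⟩
      have hb : 0 < t (2 * i + 1) - t (2 * i) := sub_pos.2 hlt
      rw [eq_div_iff hb.ne'] at hslope
      have h3 := abs_lt.1 h1.2
      have h4 := abs_lt.1 h2.2
      set S := ∑ k ∈ s, c k * (ξ + x k) ^ (-(1 / 2 : ℝ))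
      have h5 : |1 / 2 * S * (t (2 * i + 1) - t (2 * i))| ≤ 2 * ε := by
        rw [hslope, abs_le]
        constructor <;> linarith [h3.1, h3.2, h4.1, h4.2]
      rw [abs_mul, abs_mul, abs_of_pos hb, abs_of_pos (by norm_num : (0 : ℝ) < 1 / 2)] at h5
      rw [le_div_iff₀ hlam]
      nlinarith [abs_nonneg S]
    choose ξ hξ using hξ
    have hfin := hK n s c x lam Δ X (4 * ε / lam) 1 hn hlam hΔ hX one_pos hx hsep hc ξ
      (fun i hi => ⟨(ht (2 * i) (by omega)).1.1.le.trans (hξ i hi).1.1.le,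
        (hξ i hi).1.2.le.trans (ht (2 * i + 1) (by omega)).1.2.le⟩)
      (fun i hi => by
        have h1 := (hξ i (by omega)).1.2
        have h2 := (hξ (i + 1) hi).1.1
        have h3 := htsep (2 * i + 1) (by omega)
        have h4 : 2 * (i + 1) = 2 * i + 1 + 1 := by ring
        rw [h4] at h2
        linarith)
      (fun i hi => (hξ i hi).2)
    have hKn : K n ≤ Kmax := by
      have := Finset.single_le_sum (f := K) (fun n _ => (hK0 n).le)
        (Finset.mem_range.2 (by omega : n < r))
      linarith
    have hε0 : 0 < ε := (abs_nonneg _).trans_lt (ht 0 (by positivity)).2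
    have hX0 : 0 < X := by linarith
    have e1 : X ^ ((1 / 2 : ℝ) + n) ≤ X ^ (n + 1) := by
      rw [← Real.rpow_natCast X (n + 1)]
      refine Real.rpow_le_rpow_of_exponent_le hX ?_
      push_cast; linarith
    have h1 : 1 ≤ 4 * ε / lam * Kmax * (X / (lam * Δ)) ^ n * X ^ (n + 1) := by
      refine hfin.trans ?_
      gcongr
    have h2 : 4 * ε / lam * Kmax * (X / (lam * Δ)) ^ n * X ^ (n + 1) =
        4 * Kmax * ε * (X ^ n * X ^ (n + 1)) / (lam ^ (n + 1) * Δ ^ n) := by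
      rw [div_pow, mul_pow]
      field_simp
      ring
    rw [h2, le_div_iff₀ (by positivity), one_mul] at h1
    have h3 : lam ^ r * Δ ^ r ≤ lam ^ (n + 1) * Δ ^ n := by
      have := pow_le_pow_of_le_one hlam.le hlam1 hnr
      have := pow_le_pow_of_le_one hΔ.le hΔ1 (show n ≤ r by omega)
      gcongr
    have h4 : X ^ n * X ^ (n + 1) ≤ X ^ (2 * r) := by
      rw [← pow_add]
      exact pow_le_pow_right₀ hX (by omega)
    have h5 : ε * (8 * Kmax * X ^ (2 * r)) ≤ lam ^ r * Δ ^ r := by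
      calc ε * (8 * Kmax * X ^ (2 * r)) ≤
          1 / (8 * Kmax) * (lam ^ r * Δ ^ r * (X ^ (2 * r))⁻¹) * (8 * Kmax * X ^ (2 * r)) := by
            gcongr
        _ = _ := by field_simp
    have h6 : 4 * Kmax * ε * (X ^ n * X ^ (n + 1)) ≤ 4 * Kmax * ε * X ^ (2 * r) := by gcongr
    have h7 : 0 < lam ^ r * Δ ^ r := by positivity
    linarith
  · refine hvol.trans (ENNReal.ofReal_le_ofReal ?_)
    push_cast
    rw [← pow_succ']
    gcongr
    · norm_num

/-- The linear form `a · m`. -/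
def ip {d : ℕ} (a : Fin d → ℝ) (m : Idx d) : ℝ := ∑ i, a i * (m i : ℝ)

theorem ip_add_smul {d : ℕ} (a v : Fin d → ℝ) (τ : ℝ) (m : Idx d) :
    ip (a + τ • v) m = ip a m + τ * ip v m := by
  simp only [ip, Pi.add_apply, Pi.smul_apply, smul_eq_mul, Finset.mul_sum]
  rw [← Finset.sum_add_distrib]
  exact Finset.sum_congr rfl fun i _ => by ring

theorem ip_single {d : ℕ} (i : Fin d) (m : Idx d) : ip (Pi.single i 1) m = m i := by
  simp [ip, Pi.single_apply]

theorem ip_smul {d : ℕ} (t : ℝ) (a : Fin d → ℝ) (m : Idx d) : ip (t • a) m = t * ip a m := by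
  simp only [ip, Pi.smul_apply, smul_eq_mul, Finset.mul_sum]
  exact Finset.sum_congr rfl fun i _ => by ring

theorem ip_sub {d : ℕ} (a : Fin d → ℝ) (m n : Idx d) : ip a (m - n) = ip a m - ip a n := by
  simp only [ip, Pi.sub_apply, ← Finset.sum_sub_distrib]
  exact Finset.sum_congr rfl fun i _ => by push_cast; ring

theorem ip_zero {d : ℕ} (a : Fin d → ℝ) : ip a (0 : Idx d) = 0 := by simp [ip]

@[fun_prop]
theorem continuous_ip {d : ℕ} (m : Idx d) : Continuous fun a : Fin d → ℝ => ip a m := by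
  unfold ip; fun_prop

/-- Lower bounds valid almost everywhere, with a point-dependent constant. -/
theorem ae_exists_lower_bound {α ι : Type*} [Countable ι] [MeasurableSpace α] {μ : Measure α}
    {F : ι → α → ℝ} {ε w : ι → ℝ} (hε : ∀ i, 0 ≤ ε i) (hw0 : ∀ i, 0 ≤ w i) (hw : Summable w)
    (hsmall : ∀ i, μ {a | F i a < ε i} ≤ ENNReal.ofReal (w i))
    (hpos : ∀ i, ∀ᵐ a ∂μ, 0 < F i a) :
    ∀ᵐ a ∂μ, ∃ γ : ℝ, 0 < γ ∧ γ ≤ 1 ∧ ∀ i, γ * ε i ≤ F i a := by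
  refine ae_exists_forall_of_summable (p := fun i γ a => γ * ε i ≤ F i a) ?_ hw0 hw ?_ ?_
  · intro i γ γ' a _ h h'
    exact (mul_le_mul_of_nonneg_right h (hε i)).trans h'
  · intro i
    simpa using hsmall i
  · intro i
    filter_upwards [hpos i] with a ha
    refine ⟨F i a / (ε i + 1), div_pos ha (by linarith [hε i]), ?_⟩
    rw [div_mul_eq_mul_div, div_le_iff₀ (by linarith [hε i])]
    nlinarith [hε i]

theorem volume_abs_ip_lt_le {d : ℕ} {n : Idx d} (hn : n ≠ 0) {ε : ℝ} (hε : 0 < ε) :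
    volume ({b | |ip b n| < ε} ∩ cube d) ≤ ENNReal.ofReal (6 ^ d * (2 * ε)) := by
  obtain ⟨i, hi⟩ : ∃ i, n i ≠ 0 := Function.ne_iff.1 hn
  have hi1 : (1 : ℝ) ≤ |(n i : ℝ)| := by exact_mod_cast Int.one_le_abs hi
  refine volume_le_of_translate_notMem (v := Pi.single i 1) ?_ Set.inter_subset_right ?_
    (by positivity) ?_
  · exact (measurableSet_lt (by fun_prop) measurable_const).inter
      (MeasurableSet.univ_pi fun _ => measurableSet_Ioo)
  · intro k
    by_cases h : k = i <;> simp [h]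
  · rintro a ⟨ha, -⟩ τ hτ - ⟨hb, -⟩
    simp only [Set.mem_ofPred_eq, ip_add_smul, ip_single] at ha hb
    have h1 : |τ * (n i : ℝ)| < 2 * ε := by
      calc |τ * (n i : ℝ)| = |(ip a n + τ * n i) - ip a n| := by ring_nf
        _ ≤ _ := abs_sub _ _
        _ < 2 * ε := by linarith
    rw [abs_mul, abs_of_pos (by linarith)] at h1
    nlinarith

theorem ae_ip_ne_zero {d : ℕ} {n : Idx d} (hn : n ≠ 0) :
    ∀ᵐ b ∂(volume.restrict (cube d)), ip b n ≠ 0 := by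
  have hms : MeasurableSet (cube d) := MeasurableSet.univ_pi fun _ => measurableSet_Ioo
  rw [ae_iff, Measure.restrict_apply' hms]
  refine le_antisymm (le_of_forall_pos_le_add fun ε hε => ?_) zero_le
  by_cases hε' : ε = ⊤
  · simp [hε']
  have hε0 : 0 < ε.toReal := ENNReal.toReal_pos hε.ne' hε'
  calc volume ({b | ¬ ip b n ≠ 0} ∩ cube d)
      ≤ volume ({b | |ip b n| < ε.toReal / (6 ^ d * 2)} ∩ cube d) := by
        refine measure_mono (Set.inter_subset_inter_left _ fun b hb => ?_)
        simp only [Set.mem_ofPred_eq, ne_eq, not_not] at hb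
        rw [Set.mem_ofPred_eq, hb, abs_zero]
        positivity
    _ ≤ ENNReal.ofReal (6 ^ d * (2 * (ε.toReal / (6 ^ d * 2)))) :=
        volume_abs_ip_lt_le hn (by positivity)
    _ = ε := by
        rw [show (6:ℝ) ^ d * (2 * (ε.toReal / (6 ^ d * 2))) = ε.toReal by field_simp,
          ENNReal.ofReal_toReal hε']
    _ ≤ 0 + ε := by simp

/-- Diophantine conditions on finitely many integer vectors for each index. -/
theorem ae_dioph {d : ℕ} {ι : Type*} [Countable ι] (Z : ι → Finset (Idx d)) (K : ℕ)
    (hK : ∀ i, (Z i).card ≤ K) (hZ : ∀ i, ∀ z ∈ Z i, z ≠ 0) {w : ι → ℝ} (hw0 : ∀ i, 0 < w i)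
    (hw : Summable w) :
    ∀ᵐ b ∂(volume.restrict (cube d)), ∃ γ : ℝ, 0 < γ ∧ γ ≤ 1 ∧
      ∀ i, ∀ z ∈ Z i, γ * w i ≤ |ip b z| := by
  have hms : MeasurableSet (cube d) := MeasurableSet.univ_pi fun _ => measurableSet_Ioo
  refine ae_exists_forall_of_summable
    (p := fun i γ b => ∀ z ∈ Z i, γ * w i ≤ |ip b z|) ?_
    (w := fun i => K * (6 ^ d * (2 * w i))) (fun i => by have := hw0 i; positivity)
    (((hw.mul_left 2).mul_left _).mul_left _) ?_ ?_
  · intro i γ γ' a _ h h' z hz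
    exact (mul_le_mul_of_nonneg_right h (hw0 i).le).trans (h' z hz)
  · intro i
    rw [Measure.restrict_apply' hms]
    calc _ ≤ volume (⋃ z ∈ Z i, {b | |ip b z| < w i} ∩ cube d) := by
          refine measure_mono ?_
          rintro b ⟨hb, hb'⟩
          simp only [one_mul, not_forall, not_le, Set.mem_ofPred_eq] at hb
          obtain ⟨z, hz, h⟩ := hb
          exact Set.mem_biUnion hz ⟨h, hb'⟩
      _ ≤ ∑ z ∈ Z i, volume ({b | |ip b z| < w i} ∩ cube d) := measure_biUnion_finset_le _ _
      _ ≤ ∑ z ∈ Z i, ENNReal.ofReal (6 ^ d * (2 * w i)) :=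
          Finset.sum_le_sum fun z hz => volume_abs_ip_lt_le (hZ i z hz) (hw0 i)
      _ = (Z i).card * ENNReal.ofReal (6 ^ d * (2 * w i)) := by simp
      _ ≤ K * ENNReal.ofReal (6 ^ d * (2 * w i)) := by gcongr; exact hK i
      _ = _ := by
          rw [ENNReal.ofReal_mul (by positivity) (q := 6 ^ d * (2 * w i)), ENNReal.ofReal_natCast]
  · intro i
    have h : ∀ᵐ b ∂(volume.restrict (cube d)), ∀ z ∈ Z i, ip b z ≠ 0 := by
      exact (ae_ball_iff (Z i).countable_toSet).2 fun z hz => ae_ip_ne_zero (hZ i z hz)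
    filter_upwards [h] with b hb
    have key : ∀ s : Finset (Idx d), (∀ z ∈ s, ip b z ≠ 0) →
        ∃ γ : ℝ, 0 < γ ∧ ∀ z ∈ s, γ ≤ |ip b z| := by
      intro s hs
      induction s using Finset.induction_on with
      | empty => exact ⟨1, one_pos, by simp⟩
      | insert z s _ ih =>
        obtain ⟨γ, h0, h⟩ := ih fun y hy => hs y (Finset.mem_insert_of_mem hy)
        refine ⟨min γ |ip b z|, lt_min h0 (abs_pos.2 (hs z (Finset.mem_insert_self _ _))), ?_⟩
        intro y hy
        rcases Finset.mem_insert.1 hy with rfl | hy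
        · exact min_le_right _ _
        · exact (min_le_left _ _).trans (h y hy)
    obtain ⟨γ, h0, h1⟩ := key (Z i) hb
    refine ⟨γ / w i, div_pos h0 (hw0 i), fun z hz => ?_⟩
    rw [div_mul_cancel₀ _ (hw0 i).ne']
    exact h1 z hz

open scoped Pointwise in
theorem ae_box_of_ae_cube {d : ℕ} {G : Set (Fin d → ℝ)} (hG : MeasurableSet G)
    (h : ∀ᵐ b ∂(volume.restrict (cube d)),
      ∀ᵐ μ ∂(volume.restrict (Set.Ioo (1 / 4 : ℝ) 1)), (Real.sqrt μ)⁻¹ • b ∈ G) :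
    ∀ᵐ a ∂(volume.restrict (box d)), a ∈ G := by
  have hmeas : MeasurableSet {x : (Fin d → ℝ) × ℝ | (Real.sqrt x.2)⁻¹ • x.1 ∈ G} := by
    have : Measurable fun x : (Fin d → ℝ) × ℝ => (Real.sqrt x.2)⁻¹ • x.1 := by fun_prop
    exact this hG
  rw [Measure.ae_ae_comm hmeas] at h
  have hne : (volume.restrict (Set.Ioo (1 / 4 : ℝ) 1)) ≠ 0 := by
    rw [Ne, Measure.restrict_eq_zero, Real.volume_Ioo]
    norm_num
  obtain ⟨μ, hμ, hμI⟩ : ∃ μ : ℝ, (∀ᵐ b ∂(volume.restrict (cube d)), (Real.sqrt μ)⁻¹ • b ∈ G) ∧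
      μ ∈ Set.Ioo (1 / 4 : ℝ) 1 := by
    have : (ae (volume.restrict (Set.Ioo (1 / 4 : ℝ) 1))).NeBot := ae_neBot.2 hne
    exact (h.and (ae_restrict_mem measurableSet_Ioo)).exists
  have hs0 : (1 / 2 : ℝ) < Real.sqrt μ := by
    rw [Real.lt_sqrt (by norm_num)]; linarith [hμI.1]
  have hs1 : Real.sqrt μ < 1 := by
    rw [Real.sqrt_lt' one_pos]; linarith [hμI.2]
  have hmb : MeasurableSet (box d) := MeasurableSet.univ_pi fun _ => measurableSet_Ioo
  have hmc : MeasurableSet (cube d) := MeasurableSet.univ_pi fun _ => measurableSet_Ioo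
  rw [ae_iff, Measure.restrict_apply' hmb]
  rw [ae_iff, Measure.restrict_apply' hmc] at hμ
  have hsub : Real.sqrt μ • ({a | a ∉ G} ∩ box d) ⊆
      {b | ¬ (Real.sqrt μ)⁻¹ • b ∈ G} ∩ cube d := by
    rintro _ ⟨a, ⟨haG, ha⟩, rfl⟩
    refine ⟨?_, fun i _ => ?_⟩
    · simpa [smul_smul, inv_mul_cancel₀ (show Real.sqrt μ ≠ 0 by linarith)] using haG
    · have := ha i trivial
      simp only [Pi.smul_apply, smul_eq_mul, Set.mem_Ioo] at this ⊢
      constructor <;> nlinarith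
  have h0 := measure_mono_null hsub hμ
  rw [Measure.addHaar_smul] at h0
  rcases mul_eq_zero.1 h0 with h0 | h0
  · rw [ENNReal.ofReal_eq_zero] at h0
    have : 0 < |Real.sqrt μ ^ Module.finrank ℝ (Fin d → ℝ)| := by positivity
    linarith
  · exact h0

/-- The function `s ↦ √(1 + s²)`. -/
def om (s : ℝ) : ℝ := √(1 + s ^ 2)

@[fun_prop]
theorem continuous_om : Continuous om := by unfold om; fun_prop

theorem om_inv_sqrt_mul {μ : ℝ} (hμ : 0 < μ) (s : ℝ) :
    om ((√μ)⁻¹ * s) = (√μ)⁻¹ * √(μ + s ^ 2) := by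
  have h : 1 + ((√μ)⁻¹ * s) ^ 2 = μ⁻¹ * (μ + s ^ 2) := by
    rw [mul_pow, inv_pow, Real.sq_sqrt hμ.le]
    field_simp
  rw [om, h, Real.sqrt_mul (by positivity), Real.sqrt_inv]

theorem measurableSet_exists_pos_forall_le {α ι : Type*} [Countable ι] [MeasurableSpace α]
    {F : ι → α → ℝ} {e : ι → ℝ} (hF : ∀ i, Measurable (F i)) (he : ∀ i, 0 ≤ e i) :
    MeasurableSet {a | ∃ γ : ℝ, 0 < γ ∧ ∀ i, γ * e i ≤ F i a} := by
  have : {a | ∃ γ : ℝ, 0 < γ ∧ ∀ i, γ * e i ≤ F i a} =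
      ⋃ k : ℕ, ⋂ i, {a | 1 / ((k : ℝ) + 1) * e i ≤ F i a} := by
    ext a
    simp only [Set.mem_ofPred_eq, Set.mem_iUnion, Set.mem_iInter]
    constructor
    · rintro ⟨γ, hγ, h⟩
      obtain ⟨k, hk⟩ := exists_nat_one_div_lt hγ
      exact ⟨k, fun i => (mul_le_mul_of_nonneg_right hk.le (he i)).trans (h i)⟩
    · rintro ⟨k, h⟩
      exact ⟨_, by positivity, h⟩
  rw [this]
  exact MeasurableSet.iUnion fun k => MeasurableSet.iInter fun i =>
    measurableSet_le measurable_const (hF i)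

theorem ip_nonneg {d : ℕ} {b : Fin d → ℝ} (hb : ∀ i, 0 ≤ b i) {m : Idx d} (hm : ∀ i, 0 ≤ m i) :
    0 ≤ ip b m :=
  Finset.sum_nonneg fun i _ => mul_nonneg (hb i) (by exact_mod_cast hm i)

theorem le_ip {d : ℕ} {b : Fin d → ℝ} {β : ℝ} (hβ : 0 ≤ β) (hb : ∀ i, β ≤ b i) {m : Idx d}
    (hm : ∀ i, 0 ≤ m i) (h0 : m ≠ 0) : β ≤ ip b m := by
  obtain ⟨i, hi⟩ : ∃ i, m i ≠ 0 := Function.ne_iff.1 h0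
  have h1 : (1 : ℝ) ≤ m i := by
    have := hm i
    exact_mod_cast (show 1 ≤ m i by omega)
  calc β ≤ b i * m i := by nlinarith [hb i]
    _ ≤ ip b m := Finset.single_le_sum (f := fun i => b i * (m i : ℝ))
        (fun l _ => mul_nonneg (hβ.trans (hb l)) (by exact_mod_cast hm l)) (Finset.mem_univ i)

theorem abs_ip_le {d : ℕ} {b : Fin d → ℝ} {β R : ℝ} (hb : ∀ i, |b i| ≤ β) {m : Idx d}
    (hm : ∀ i, |(m i : ℝ)| ≤ R) : |ip b m| ≤ d * (β * R) := by
  calc |ip b m| ≤ ∑ i, |b i * (m i : ℝ)| := Finset.abs_sum_le_sum_abs _ _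
    _ ≤ ∑ _i : Fin d, β * R := Finset.sum_le_sum fun i _ => by
        rw [abs_mul]
        exact mul_le_mul (hb i) (hm i) (abs_nonneg _) ((abs_nonneg _).trans (hb i))
    _ = _ := by simp

/-- Almost every `a` satisfies lower bounds for a countable family of combinations of the
functions `a ↦ √(1 + (a · m)²)` and of linear forms. -/
theorem ae_lower_bound {d : ℕ} {ι : Type*} [Countable ι] (n : ι → Idx d)
    (c : ι → (Idx d →₀ ℤ)) (lam R : ι → ℝ) {r : ℕ} (hr : 1 ≤ r) (hlam0 : ∀ i, 0 < lam i)
    (hlam1 : ∀ i, lam i ≤ 1) (hlam : Summable lam) (hR : ∀ i, 1 ≤ R i)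
    (hcard : ∀ i, (c i).support.card ≤ r)
    (hm : ∀ i, ∀ m ∈ (c i).support, ∀ l, 0 ≤ m l ∧ (m l : ℝ) ≤ R i)
    (hne : ∀ i, n i ≠ 0 ∨ c i ≠ 0) :
    ∀ᵐ a ∂(volume.restrict (box d)), ∃ γ : ℝ, 0 < γ ∧ ∀ i,
      γ * (lam i ^ (2 * r) * (R i ^ (4 * r))⁻¹) ≤
        |ip a (n i) + (c i).sum fun m x => (x : ℝ) * om (ip a m)| := by
  classical
  refine ae_box_of_ae_cube (G := {a | ∃ γ : ℝ, 0 < γ ∧ ∀ i,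
      γ * (lam i ^ (2 * r) * (R i ^ (4 * r))⁻¹) ≤
        |ip a (n i) + (c i).sum fun m x => (x : ℝ) * om (ip a m)|}) ?_ ?_
  · refine measurableSet_exists_pos_forall_le (fun i => ?_) fun i => ?_
    · refine Continuous.measurable ?_
      simp only [Finsupp.sum]
      fun_prop
    · have := hlam0 i
      have := hR i
      positivity
  obtain ⟨c₀, hc0, hc1, hsub⟩ := exists_sublevel_constant (Idx d) r
  have hdio := ae_dioph (d := d)
    (fun i => (insert (n i) (((c i).support ×ˢ (c i).support).image
      fun p => p.1 - p.2)).filter (· ≠ 0)) (r * r + 1) (fun i => by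
        refine (Finset.card_filter_le _ _).trans ((Finset.card_insert_le _ _).trans ?_)
        refine Nat.add_le_add_right (Finset.card_image_le.trans ?_) 1
        rw [Finset.card_product]
        exact Nat.mul_le_mul (hcard i) (hcard i))
    (fun i z hz => (Finset.mem_filter.1 hz).2) hlam0 hlam
  have hmc : MeasurableSet (cube d) := MeasurableSet.univ_pi fun _ => measurableSet_Ioo
  filter_upwards [hdio, ae_restrict_mem hmc] with b ⟨γ, hγ0, hγ1, hγ⟩ hb
  have hb1 : ∀ l, 1 / 2 ≤ b l := fun l => (hb l trivial).1.le
  have hb4 : ∀ l, |b l| ≤ 4 := fun l => abs_le.2 ⟨by linarith [hb1 l], (hb l trivial).2.le⟩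
  have hnγ : ∀ i, n i ≠ 0 → γ * lam i ≤ |ip b (n i)| := fun i h =>
    hγ i _ (Finset.mem_filter.2 ⟨Finset.mem_insert_self _ _, h⟩)
  set D : ℝ := 16 * ((d : ℝ) + 1) ^ 2 with hD
  have hD1 : 1 ≤ D := by rw [hD]; nlinarith [show (0 : ℝ) ≤ d by positivity]
  have hX1 : ∀ i, 1 ≤ D * R i ^ 2 := fun i => by
    have := hR i
    exact one_le_mul_of_one_le_of_one_le hD1 (one_le_pow₀ this)
  have hx : ∀ i, ∀ m ∈ (c i).support, 0 ≤ ip b m ^ 2 ∧ ip b m ^ 2 ≤ D * R i ^ 2 := by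
    intro i m hmi
    refine ⟨sq_nonneg _, ?_⟩
    have h1 := abs_ip_le (R := R i) hb4 (m := m) fun l => by
      rw [abs_of_nonneg (by exact_mod_cast (hm i m hmi l).1)]
      exact (hm i m hmi l).2
    rw [← sq_abs]
    calc |ip b m| ^ 2 ≤ (d * (4 * R i)) ^ 2 := by gcongr
      _ = 16 * (d : ℝ) ^ 2 * R i ^ 2 := by ring
      _ ≤ D * R i ^ 2 := by rw [hD]; gcongr; linarith
  have hΔ : ∀ i, ∀ k ∈ (c i).support, ∀ l ∈ (c i).support, k ≠ l →
      γ * lam i / 2 ≤ |ip b k ^ 2 - ip b l ^ 2| := by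
    intro i k hk l hl hkl
    have h1 : γ * lam i ≤ |ip b (k - l)| :=
      hγ i _ (Finset.mem_filter.2 ⟨Finset.mem_insert_of_mem
        (Finset.mem_image.2 ⟨(k, l), Finset.mem_product.2 ⟨hk, hl⟩, rfl⟩), sub_ne_zero.2 hkl⟩)
    have hb0 : ∀ i, 0 ≤ b i := fun i => by linarith [hb1 i]
    have h2 : 0 ≤ ip b k := ip_nonneg hb0 fun q => (hm i k hk q).1
    have h3 : 0 ≤ ip b l := ip_nonneg hb0 fun q => (hm i l hl q).1
    have h4 : 1 / 2 ≤ ip b k + ip b l := by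
      by_cases h : k = 0
      · have := le_ip (by norm_num) hb1 (fun q => (hm i l hl q).1) (fun h' => hkl (h.trans h'.symm))
        linarith
      · have := le_ip (by norm_num) hb1 (fun q => (hm i k hk q).1) h
        linarith
    rw [sq_sub_sq, abs_mul, abs_of_nonneg (by linarith : 0 ≤ ip b k + ip b l), ← ip_sub]
    nlinarith [abs_nonneg (ip b (k - l))]
  set ε : ι → ℝ := fun i =>
    c₀ * (lam i ^ r * (γ * lam i / 2) ^ r * ((D * R i ^ 2) ^ (2 * r))⁻¹) with hε
  have hε0 : ∀ i, 0 < ε i := fun i => by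
    have := hlam0 i
    have := hX1 i
    simp only [hε]
    positivity
  have hΔ1 : ∀ i, γ * lam i / 2 ≤ 1 := fun i => by nlinarith [hlam0 i, hlam1 i]
  have hc1' : ∀ i, ∀ k ∈ (c i).support, (1 : ℝ) ≤ |((c i k : ℤ) : ℝ)| := fun i k hk => by
    exact_mod_cast Int.one_le_abs (Finsupp.mem_support_iff.1 hk)
  have hεle : ∀ i, ε i ≤ γ * lam i := by
    intro i
    have h0 := hlam0 i
    have h1 : lam i ^ r ≤ 1 := pow_le_one₀ h0.le (hlam1 i)
    have h2 : (γ * lam i / 2) ^ r ≤ γ * lam i / 2 :=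
      pow_le_of_le_one (by positivity) (hΔ1 i) (by omega)
    have h3 : ((D * R i ^ 2) ^ (2 * r))⁻¹ ≤ 1 := inv_le_one_of_one_le₀ (one_le_pow₀ (hX1 i))
    have hX0 : 0 ≤ D * R i ^ 2 := by linarith [hX1 i]
    calc ε i ≤ 1 * (1 * (γ * lam i / 2) * 1) := by
          simp only [hε]; gcongr
      _ ≤ γ * lam i := by nlinarith [mul_pos hγ0 h0]
  have hbc : ∀ᵐ μ ∂(volume.restrict (Set.Ioo (1 / 4 : ℝ) 1)), ∃ γ' : ℝ, 0 < γ' ∧ γ' ≤ 1 ∧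
      ∀ i, γ' * ε i ≤
        |ip b (n i) + ∑ k ∈ (c i).support, ((c i k : ℤ) : ℝ) * √(μ + ip b k ^ 2)| := by
    refine ae_exists_lower_bound (fun i => (hε0 i).le)
      (fun i => mul_nonneg (by positivity) (hlam0 i).le) (hlam.mul_left (2 ^ (r + 1))) ?_ ?_
    · intro i
      rw [Measure.restrict_apply' measurableSet_Ioo]
      by_cases hci : c i = 0
      · have h := hnγ i ((hne i).resolve_right (not_not.2 hci))
        have h' : {μ : ℝ | |ip b (n i) + ∑ k ∈ (c i).support,
            ((c i k : ℤ) : ℝ) * √(μ + ip b k ^ 2)| < ε i} = ∅ := by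
          ext μ
          simp only [hci, Finsupp.support_zero, Finset.sum_empty, add_zero, Set.mem_ofPred_eq,
            Set.mem_empty_iff_false, iff_false, not_lt]
          exact (hεle i).trans h
        rw [h']
        simp
      · refine le_trans (measure_mono ?_) (hsub (c i).support (fun k => (c i k : ℝ))
          (fun k => ip b k ^ 2) (lam i) (γ * lam i / 2) (D * R i ^ 2) (ip b (n i)) (ε i)
          (Finsupp.support_nonempty_iff.2 hci) (hcard i) (hlam0 i) (hlam1 i)
          (by have := hlam0 i; positivity) (hΔ1 i) (hX1 i) (hx i) (hΔ i) (hc1' i) le_rfl)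
        rintro μ ⟨h1, h2⟩
        exact ⟨h2, h1⟩
    · intro i
      by_cases hci : c i = 0
      · have h := hnγ i ((hne i).resolve_right (not_not.2 hci))
        refine Filter.Eventually.of_forall fun μ => ?_
        simp only [hci, Finsupp.support_zero, Finset.sum_empty, add_zero]
        exact (mul_pos hγ0 (hlam0 i)).trans_le h
      · rw [ae_iff, Measure.restrict_apply' measurableSet_Ioo]
        refine le_antisymm (le_of_forall_pos_le_add fun e he => ?_) zero_le
        rw [zero_add]
        obtain ⟨l, hl0, hl1, hle⟩ : ∃ l : ℝ, 0 < l ∧ l ≤ 1 ∧ ENNReal.ofReal (2 ^ (r + 1) * l) ≤ e := by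
          by_cases hetop : e = ⊤
          · exact ⟨1, one_pos, le_rfl, by simp [hetop]⟩
          have he0 : 0 < e.toReal := ENNReal.toReal_pos he.ne' hetop
          refine ⟨min 1 (e.toReal / 2 ^ (r + 1)), lt_min one_pos (by positivity),
            min_le_left _ _, ?_⟩
          rw [ENNReal.ofReal_le_iff_le_toReal hetop]
          calc _ ≤ 2 ^ (r + 1) * (e.toReal / 2 ^ (r + 1)) := by gcongr; exact min_le_right _ _
            _ = e.toReal := by field_simp
        refine le_trans (measure_mono ?_) ((hsub (c i).support (fun k => (c i k : ℝ))
          (fun k => ip b k ^ 2) l (γ * lam i / 2) (D * R i ^ 2) (ip b (n i)) _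
          (Finsupp.support_nonempty_iff.2 hci) (hcard i) hl0 hl1
          (by have := hlam0 i; positivity) (hΔ1 i) (hX1 i) (hx i) (hΔ i) (hc1' i) le_rfl).trans hle)
        rintro μ ⟨h1, h2⟩
        refine ⟨h2, (not_lt.1 h1).trans_lt ?_⟩
        have := hlam0 i
        have := hX1 i
        positivity
  filter_upwards [hbc, ae_restrict_mem measurableSet_Ioo] with μ ⟨γ', h0, h1, h⟩ hμ
  have hμ0 : 0 < μ := by linarith [hμ.1]
  refine ⟨γ' * (c₀ * (γ / 2) ^ r * (D ^ (2 * r))⁻¹), by positivity, fun i => ?_⟩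
  have hR0 : 0 < R i := by linarith [hR i]
  have e1 : γ' * (c₀ * (γ / 2) ^ r * (D ^ (2 * r))⁻¹) * (lam i ^ (2 * r) * (R i ^ (4 * r))⁻¹) =
      γ' * ε i := by
    simp only [hε]
    rw [mul_pow D, ← pow_mul, show 2 * (2 * r) = 4 * r by ring, div_pow, div_pow, mul_pow,
      mul_inv, two_mul r, pow_add]
    ring
  rw [e1]
  refine (h i).trans ?_
  have e2 : ip ((√μ)⁻¹ • b) (n i) + (c i).sum (fun m x => (x : ℝ) * om (ip ((√μ)⁻¹ • b) m)) =
      (√μ)⁻¹ * (ip b (n i) + ∑ k ∈ (c i).support, ((c i k : ℤ) : ℝ) * √(μ + ip b k ^ 2)) := by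
    simp only [ip_smul, Finsupp.sum, om_inv_sqrt_mul hμ0, mul_add, Finset.mul_sum]
    congr 1
    exact Finset.sum_congr rfl fun k _ => by ring
  rw [e2, abs_mul]
  refine le_mul_of_one_le_left (abs_nonneg _) ?_
  rw [abs_of_pos (by positivity)]
  exact (one_le_inv₀ (by positivity)).2 (Real.sqrt_le_one.2 hμ.2.le)

theorem summable_prod_pi {α : Type*} : ∀ {n : ℕ} (g : Fin n → α → ℝ), (∀ i x, 0 ≤ g i x) →
    (∀ i, Summable (g i)) → Summable fun x : Fin n → α => ∏ i, g i (x i)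
  | 0, g, _, _ => by
    simp only [Finset.univ_eq_empty, Finset.prod_empty]
    exact Summable.of_finite
  | n + 1, g, h0, hg => by
    have ih := summable_prod_pi (fun i : Fin n => g i.succ) (fun i x => h0 _ x) fun i => hg _
    have h := (hg 0).mul_of_nonneg ih (fun x => h0 0 x)
      (fun x => Finset.prod_nonneg fun i _ => h0 _ _)
    rw [← (Fin.consEquiv fun _ : Fin (n + 1) => α).summable_iff]
    refine h.congr fun x => ?_
    simp [Fin.prod_univ_succ, Fin.consEquiv]

theorem summable_int_one_add_sq_rpow {s : ℝ} (hs : 1 / 2 < s) :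
    Summable fun n : ℤ => (1 + (n : ℝ) ^ 2) ^ (-s) := by
  have h := Real.summable_abs_int_rpow (b := 2 * s) (by linarith)
  have h2 : Summable fun n : ℤ => if n = 0 then (1 : ℝ) else 0 :=
    summable_of_ne_finset_zero (s := {0}) fun n hn => by simpa using hn
  refine Summable.of_nonneg_of_le (fun n => by positivity) (fun n => ?_) (h.add h2)
  by_cases hn : n = 0
  · subst hn
    have : (0 : ℝ) ≤ |((0 : ℤ) : ℝ)| ^ (-(2 * s)) := by positivity
    simp only [Int.cast_zero, if_true] at this ⊢
    norm_num at this ⊢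
    exact this
  · have hn' : (0 : ℝ) < |(n : ℝ)| := by positivity
    rw [if_neg hn, add_zero, show -(2 * s) = 2 * (-s) by ring, Real.rpow_mul (abs_nonneg _)]
    rw [show (2 : ℝ) = ((2 : ℕ) : ℝ) by norm_num, Real.rpow_natCast, sq_abs]
    have : (0 : ℝ) < (n : ℝ) ^ 2 := by positivity
    exact Real.rpow_le_rpow_of_nonpos this (by linarith) (by linarith)

theorem summable_prod_one_add_sq_rpow (d : ℕ) {s : ℝ} (hs : 1 / 2 < s) :
    Summable fun j : Idx d => ∏ l, (1 + (j l : ℝ) ^ 2) ^ (-s) :=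
  summable_prod_pi (fun _ (n : ℤ) => (1 + (n : ℝ) ^ 2) ^ (-s)) (fun _ _ => by positivity)
    fun _ => summable_int_one_add_sq_rpow hs

theorem jap_sq {d : ℕ} (j : Idx d) : jap d j ^ 2 = 1 + ∑ i, (j i : ℝ) ^ 2 :=
  Real.sq_sqrt (by unfold jnormSq; positivity)

theorem one_le_jap {d : ℕ} (j : Idx d) : 1 ≤ jap d j := by
  unfold jap jnormSq
  rw [Real.one_le_sqrt]
  have : 0 ≤ ∑ i, (j i : ℝ) ^ 2 := by positivity
  linarith

theorem jap_pos {d : ℕ} (j : Idx d) : 0 < jap d j := one_pos.trans_le (one_le_jap j)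

theorem jap_zero (d : ℕ) : jap d 0 = 1 := by simp [jap, jnormSq]

theorem one_add_sq_le_jap_sq {d : ℕ} (j : Idx d) (i : Fin d) :
    1 + (j i : ℝ) ^ 2 ≤ jap d j ^ 2 := by
  rw [jap_sq]
  have := Finset.single_le_sum (f := fun i => (j i : ℝ) ^ 2) (fun i _ => sq_nonneg _)
    (Finset.mem_univ i)
  linarith

theorem abs_le_jap {d : ℕ} (j : Idx d) (i : Fin d) : |(j i : ℝ)| ≤ jap d j := by
  refine abs_le_of_sq_le_sq ?_ (jap_pos j).le
  linarith [one_add_sq_le_jap_sq j i]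

theorem jap_le_of_abs_le {d : ℕ} {j : Idx d} {B : ℝ} (hB : 1 ≤ B) (h : ∀ i, |(j i : ℝ)| ≤ B) :
    jap d j ≤ (d + 1) * B := by
  refine (abs_le_of_sq_le_sq' ?_ (by positivity)).2
  rw [jap_sq]
  have h1 : ∑ i, (j i : ℝ) ^ 2 ≤ ∑ _i : Fin d, B ^ 2 := Finset.sum_le_sum fun i _ => by
    rw [← sq_abs]
    have := h i
    gcongr
  simp only [Finset.sum_const, Finset.card_univ, Fintype.card_fin, nsmul_eq_mul] at h1
  nlinarith [show (0 : ℝ) ≤ d by positivity, sq_nonneg (d : ℝ), mul_nonneg (show (0 : ℝ) ≤ d by positivity) (sq_nonneg B)]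

theorem jap_le_jap {d : ℕ} {j k : Idx d} (h : enorm d j ≤ enorm d k) : jap d j ≤ jap d k := by
  have h0 : jnormSq d j ≤ jnormSq d k := by
    unfold enorm at h
    exact (Real.sqrt_le_sqrt_iff (by unfold jnormSq; positivity)).1 h
  unfold jap
  gcongr

theorem summable_inv_jap_pow (d : ℕ) (hd : 0 < d) :
    Summable fun j : Idx d => (jap d j ^ (d + 1))⁻¹ := by
  have hd' : (0 : ℝ) < d := by exact_mod_cast hd
  set s : ℝ := (d + 1) / (2 * d) with hs
  have hs1 : 1 / 2 < s := by rw [hs, div_lt_div_iff₀ (by norm_num) (by positivity)]; linarith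
  refine Summable.of_nonneg_of_le (fun j => by have := jap_pos j; positivity) (fun j => ?_)
    (summable_prod_one_add_sq_rpow d hs1)
  have h0 := jap_pos j
  calc (jap d j ^ (d + 1))⁻¹ = ∏ _l : Fin d, (jap d j ^ 2) ^ (-s) := by
        rw [Finset.prod_const, Finset.card_univ, Fintype.card_fin, ← Real.rpow_natCast (_ ^ (-s)),
          ← Real.rpow_natCast (jap d j) 2, ← Real.rpow_mul h0.le, ← Real.rpow_mul h0.le,
          ← Real.rpow_natCast, ← Real.rpow_neg h0.le]
        congr 1
        rw [hs]; push_cast; field_simp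
    _ ≤ ∏ l, (1 + (j l : ℝ) ^ 2) ^ (-s) := by
        refine Finset.prod_le_prod (fun _ _ => by positivity) fun l _ => ?_
        exact Real.rpow_le_rpow_of_nonpos (by positivity) (one_add_sq_le_jap_sq j l)
          (by linarith)

/-- The product of the Japanese brackets of a family. -/
def japProd {d r : ℕ} (t : Fin r → Idx d) : ℝ := ∏ k, jap d (t k)

theorem one_le_japProd {d r : ℕ} (t : Fin r → Idx d) : 1 ≤ japProd t :=
  Finset.one_le_prod fun _ _ => one_le_jap _

theorem jap_le_japProd {d r : ℕ} (t : Fin r → Idx d) (k : Fin r) : jap d (t k) ≤ japProd t := by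
  classical
  rw [japProd, ← Finset.mul_prod_erase _ _ (Finset.mem_univ k)]
  exact le_mul_of_one_le_right (jap_pos _).le (Finset.one_le_prod fun _ _ => one_le_jap _)

theorem summable_inv_japProd_pow (d r : ℕ) (hd : 0 < d) :
    Summable fun t : Fin r → Idx d => (japProd t ^ (d + 1))⁻¹ := by
  refine (summable_prod_pi (fun _ : Fin r => fun j : Idx d => (jap d j ^ (d + 1))⁻¹)
    (fun _ j => by have := jap_pos j; positivity) fun _ => summable_inv_jap_pow d hd).congr ?_
  intro t
  rw [japProd, ← Finset.prod_pow, Finset.prod_inv_distrib]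

/-- The family in which the first two entries are replaced by zero. -/
def tl {d r : ℕ} (j : Fin r → Idx d) : Fin r → Idx d := fun k => if 2 ≤ (k : ℕ) then j k else 0

theorem japProd_tl {d r : ℕ} (j : Fin r → Idx d) : japProd (tl j) = prodTail d j := by
  refine Finset.prod_congr rfl fun k _ => ?_
  unfold tl
  split_ifs
  · rfl
  · exact jap_zero d

/-- The vector of squared entries. -/
def sqv {d : ℕ} (j : Idx d) : Idx d := fun i => j i ^ 2

theorem omg_eq {d : ℕ} (a : Fin d → ℝ) (j : Idx d) : omg d a j = om (ip a (sqv j)) := by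
  simp [omg, om, anormSq, ip, sqv]

/-- The formal combination `Σ τ_k [t_k²]`. -/
def cf {d r : ℕ} (τ : Fin r → ℤ) (t : Fin r → Idx d) : Idx d →₀ ℤ :=
  ∑ k, Finsupp.single (sqv (t k)) (τ k)

theorem cf_sum_om {d r : ℕ} (τ : Fin r → ℤ) (t : Fin r → Idx d) (a : Fin d → ℝ) :
    ((cf τ t).sum fun m x => (x : ℝ) * om (ip a m)) =
      ∑ k, (τ k : ℝ) * om (ip a (sqv (t k))) := by
  rw [cf, ← Finsupp.sum_finsetSum_index (by simp) (by intros; push_cast; ring)]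
  exact Finset.sum_congr rfl fun k _ => Finsupp.sum_single_index (by simp)

theorem cf_support_subset {d r : ℕ} (τ : Fin r → ℤ) (t : Fin r → Idx d) :
    (cf τ t).support ⊆ Finset.univ.image fun k => sqv (t k) := by
  classical
  intro m hm
  obtain ⟨k, hk, hmk⟩ := Finset.mem_biUnion.1 (Finsupp.support_finsetSum hm)
  have := Finset.mem_singleton.1 (Finsupp.support_single_subset hmk)
  exact Finset.mem_image.2 ⟨k, hk, this.symm⟩

theorem cf_support_card_le {d r : ℕ} (τ : Fin r → ℤ) (t : Fin r → Idx d) :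
    (cf τ t).support.card ≤ r :=
  (Finset.card_le_card (cf_support_subset τ t)).trans
    (Finset.card_image_le.trans (by simp))

theorem sqv_le {d : ℕ} (j : Idx d) (l : Fin d) : 0 ≤ sqv j l ∧ ((sqv j l : ℤ) : ℝ) ≤ jap d j ^ 2 := by
  refine ⟨sq_nonneg _, ?_⟩
  have := one_add_sq_le_jap_sq j l
  simp only [sqv]
  push_cast
  linarith

/-- A family whose formal combination vanishes is resonant. -/
theorem isResonant_of_cf_eq_zero {d r : ℕ} {σ : Fin r → ℤ} (hσ : ∀ i, σ i = 1 ∨ σ i = -1)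
    {j : Fin r → Idx d} (h : cf σ j = 0) : IsResonant σ j := by
  classical
  have hcard : ∀ m : Idx d, Fintype.card {x : {k // σ k = 1} // sqv (j x.1) = m} =
      Fintype.card {x : {k // ¬ σ k = 1} // sqv (j x.1) = m} := by
    intro m
    have h1 := DFunLike.congr_fun h m
    simp only [cf, Finsupp.finsetSum_apply, Finsupp.single_apply, Finsupp.coe_zero,
      Pi.zero_apply] at h1
    have h2 : ∀ k, (if sqv (j k) = m then σ k else 0) =
        (if σ k = 1 ∧ sqv (j k) = m then 1 else 0) -
          (if ¬ σ k = 1 ∧ sqv (j k) = m then (1 : ℤ) else 0) := by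
      intro k
      rcases hσ k with h | h <;> by_cases h' : sqv (j k) = m <;> simp [h, h']
    simp only [h2, Finset.sum_sub_distrib, Finset.sum_boole] at h1
    have e1 : ∀ (p : Fin r → Prop) [DecidablePred p],
        Fintype.card {x : {k // p k} // sqv (j x.1) = m} =
          (Finset.univ.filter fun k => p k ∧ sqv (j k) = m).card := by
      intro p _
      rw [Fintype.card_congr (Equiv.subtypeSubtypeEquivSubtypeInter p fun k => sqv (j k) = m),
        Fintype.card_subtype]
    rw [e1, e1]
    omega
  let e : {k // σ k = 1} ≃ {k // ¬ σ k = 1} :=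
    Equiv.ofFiberEquiv (f := fun x : {k // σ k = 1} => sqv (j x.1))
      (g := fun x : {k // ¬ σ k = 1} => sqv (j x.1))
      fun m => Fintype.equivOfCardEq (hcard m)
  have he : ∀ x, sqv (j (e x).1) = sqv (j x.1) := fun x =>
    Equiv.ofFiberEquiv_map (g := fun x : {k // ¬ σ k = 1} => sqv (j x.1)) _ x
  have hne : ∀ k, ¬ σ k = 1 → σ k = -1 := fun k hk => (hσ k).resolve_left hk
  let ρ : Fin r → Fin r := fun k =>
    if hk : σ k = 1 then (e ⟨k, hk⟩).1 else (e.symm ⟨k, hk⟩).1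
  have hρ1 : ∀ k (hk : σ k = 1), ρ k = (e ⟨k, hk⟩).1 := fun k hk => dif_pos hk
  have hρ2 : ∀ k (hk : ¬ σ k = 1), ρ k = (e.symm ⟨k, hk⟩).1 := fun k hk => dif_neg hk
  have hinv : ∀ k, ρ (ρ k) = k := by
    intro k
    by_cases hk : σ k = 1
    · rw [hρ1 k hk, hρ2 _ (e ⟨k, hk⟩).2]
      simp
    · rw [hρ2 k hk, hρ1 _ (e.symm ⟨k, hk⟩).2]
      simp
  have hsgn : ∀ k, σ (ρ k) = -σ k := by
    intro k
    by_cases hk : σ k = 1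
    · rw [hρ1 k hk, hne _ (e ⟨k, hk⟩).2, hk]
    · rw [hρ2 k hk, (e.symm ⟨k, hk⟩).2, hne k hk]
      rfl
  have hsq : ∀ k, sqv (j (ρ k)) = sqv (j k) := by
    intro k
    by_cases hk : σ k = 1
    · rw [hρ1 k hk, he]
    · rw [hρ2 k hk]
      have := he (e.symm ⟨k, hk⟩)
      rw [Equiv.apply_symm_apply] at this
      exact this.symm
  refine ⟨?_, ⟨ρ, ρ, hinv, hinv⟩, hinv, fun k hk => ?_, fun k => ⟨fun l => ?_, hsgn k⟩⟩
  · have h1 := Fintype.card_congr e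
    have h2 := Fintype.card_subtype_compl fun k => σ k = 1
    have h3 := Fintype.card_subtype_le fun k => σ k = 1
    simp only [Fintype.card_fin] at h2 h3
    exact ⟨Fintype.card {k // σ k = 1}, by omega⟩
  · have h1 := hsgn k
    have h2 : ρ k = k := hk
    rw [h2] at h1
    rcases hσ k with h | h <;> omega
  · have := congrFun (hsq k) l
    exact (sq_eq_sq_iff_abs_eq_abs _ _).1 this

theorem ae_family_bound {d r : ℕ} (hd : 0 < d) (hr : 1 ≤ r) (τ : Fin r → ℤ) :
    ∀ᵐ a ∂(volume.restrict (box d)), ∃ γ : ℝ, 0 < γ ∧ ∀ (n : Idx d) (t : Fin r → Idx d),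
      (n ≠ 0 ∨ cf τ t ≠ 0) →
      γ * ((jap d n * japProd t) ^ (2 * r * (d + 1)) * japProd t ^ (8 * r))⁻¹ ≤
        |ip a n + ∑ k, (τ k : ℝ) * om (ip a (sqv (t k)))| := by
  have h := ae_lower_bound (d := d)
    (ι := {p : Idx d × (Fin r → Idx d) // p.1 ≠ 0 ∨ cf τ p.2 ≠ 0})
    (fun p => p.1.1) (fun p => cf τ p.1.2)
    (fun p => (jap d p.1.1 ^ (d + 1))⁻¹ * (japProd p.1.2 ^ (d + 1))⁻¹)
    (fun p => japProd p.1.2 ^ 2) hr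
    (fun p => by
      have := jap_pos p.1.1
      have := one_le_japProd p.1.2
      positivity)
    (fun p => by
      have h1 := inv_le_one_of_one_le₀ (one_le_pow₀ (one_le_jap p.1.1) (n := d + 1))
      have h2 := inv_le_one_of_one_le₀ (one_le_pow₀ (one_le_japProd p.1.2) (n := d + 1))
      have := one_le_japProd p.1.2
      exact mul_le_one₀ h1 (by positivity) h2)
    (((summable_inv_jap_pow d hd).mul_of_nonneg (summable_inv_japProd_pow d r hd)
      (fun j => by have := jap_pos j; positivity)
      (fun t => by have := one_le_japProd t; positivity)).comp_injective Subtype.val_injective)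
    (fun p => one_le_pow₀ (one_le_japProd _))
    (fun p => cf_support_card_le _ _)
    (fun p m hm l => by
      obtain ⟨k, -, rfl⟩ := Finset.mem_image.1 (cf_support_subset _ _ hm)
      refine ⟨(sqv_le _ l).1, (sqv_le _ l).2.trans ?_⟩
      have := jap_pos (p.1.2 k)
      have := jap_le_japProd p.1.2 k
      gcongr)
    (fun p => p.2)
  filter_upwards [h] with a ⟨γ, hγ, ha⟩
  refine ⟨γ, hγ, fun n t hnt => ?_⟩
  have := ha ⟨(n, t), hnt⟩
  simp only [cf_sum_om] at this
  refine le_trans (le_of_eq ?_) this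
  congr 1
  rw [← mul_inv, ← mul_pow, inv_pow, ← pow_mul, ← pow_mul, ← mul_inv,
    show (d + 1) * (2 * r) = 2 * r * (d + 1) by ring, show 2 * (4 * r) = 8 * r by ring]

theorem sum_eq_add_add_tail {M : Type*} [AddCommMonoid M] {r : ℕ} {i₀ i₁ : Fin r}
    (h₀ : (i₀ : ℕ) = 0) (h₁ : (i₁ : ℕ) = 1) (g : Fin r → M) :
    ∑ k, g k = g i₀ + g i₁ + ∑ k : Fin r, if 2 ≤ (k : ℕ) then g k else 0 := by
  have h : ∀ k : Fin r, g k = (if k = i₀ then g k else 0) + (if k = i₁ then g k else 0) +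
      (if 2 ≤ (k : ℕ) then g k else 0) := by
    intro k
    have e0 : k = i₀ ↔ (k : ℕ) = 0 := by rw [Fin.ext_iff, h₀]
    have e1 : k = i₁ ↔ (k : ℕ) = 1 := by rw [Fin.ext_iff, h₁]
    rw [if_congr e0 rfl rfl, if_congr e1 rfl rfl]
    rcases (show (k : ℕ) = 0 ∨ (k : ℕ) = 1 ∨ 2 ≤ (k : ℕ) by omega) with h | h | h
    · simp [h]
    · simp [h]
    · simp [h, show (k : ℕ) ≠ 0 by omega, show (k : ℕ) ≠ 1 by omega]
  rw [Finset.sum_congr rfl fun k _ => h k, Finset.sum_add_distrib, Finset.sum_add_distrib,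
    Finset.sum_ite_eq' Finset.univ i₀, Finset.sum_ite_eq' Finset.univ i₁]
  simp

theorem prod_eq_mul_mul_tail {r d : ℕ} {i₀ i₁ : Fin r} (h₀ : (i₀ : ℕ) = 0) (h₁ : (i₁ : ℕ) = 1)
    (j : Fin r → Idx d) : japProd j = jap d (j i₀) * jap d (j i₁) * prodTail d j :=
  sum_eq_add_add_tail (M := Additive ℝ) h₀ h₁ fun k => Additive.ofMul (jap d (j k))

theorem one_le_prodTail {d r : ℕ} (j : Fin r → Idx d) : 1 ≤ prodTail d j := by
  rw [← japProd_tl]; exact one_le_japProd _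

theorem jap_le_prodTail {d r : ℕ} (j : Fin r → Idx d) {k : Fin r} (hk : 2 ≤ (k : ℕ)) :
    jap d (j k) ≤ prodTail d j := by
  rw [← japProd_tl]
  simpa [tl, hk] using jap_le_japProd (tl j) k

theorem om_nonneg (s : ℝ) : 0 ≤ om s := Real.sqrt_nonneg _

theorem om_le {s : ℝ} (hs : 0 ≤ s) : om s ≤ 1 + s := by
  rw [om, Real.sqrt_le_left (by linarith)]
  nlinarith

theorem le_om (s : ℝ) : (1 + s) / 2 ≤ om s :=
  Real.le_sqrt_of_sq_le (by nlinarith [sq_nonneg (s - 1)])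

theorem ip_sqv_bounds {d : ℕ} {a : Fin d → ℝ} (ha : a ∈ box d) (j : Idx d) :
    jap d j ^ 2 - 1 ≤ ip a (sqv j) ∧ ip a (sqv j) ≤ 4 * (jap d j ^ 2 - 1) := by
  rw [jap_sq, add_sub_cancel_left, Finset.mul_sum]
  unfold ip sqv
  constructor
  · refine Finset.sum_le_sum fun i _ => ?_
    have := (ha i trivial).1
    push_cast
    nlinarith [sq_nonneg (j i : ℝ)]
  · refine Finset.sum_le_sum fun i _ => ?_
    have := (ha i trivial).2
    push_cast
    nlinarith [sq_nonneg (j i : ℝ)]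

theorem om_sqv_bounds {d : ℕ} {a : Fin d → ℝ} (ha : a ∈ box d) (j : Idx d) :
    jap d j ^ 2 / 2 ≤ om (ip a (sqv j)) ∧ om (ip a (sqv j)) ≤ 4 * jap d j ^ 2 := by
  obtain ⟨h1, h2⟩ := ip_sqv_bounds ha j
  have h3 := one_le_pow₀ (one_le_jap j) (n := 2)
  exact ⟨by linarith [le_om (ip a (sqv j))], by linarith [om_le (by linarith : 0 ≤ ip a (sqv j))]⟩

theorem abs_tail_le {d r : ℕ} {σ : Fin r → ℤ} (hσ : ∀ i, σ i = 1 ∨ σ i = -1) {a : Fin d → ℝ}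
    (ha : a ∈ box d) (j : Fin r → Idx d) :
    |∑ k : Fin r, if 2 ≤ (k : ℕ) then (σ k : ℝ) * om (ip a (sqv (j k))) else 0| ≤
      r * (4 * prodTail d j ^ 2) := by
  refine (Finset.abs_sum_le_sum_abs _ _).trans ?_
  calc _ ≤ ∑ _k : Fin r, 4 * prodTail d j ^ 2 := by
        refine Finset.sum_le_sum fun k _ => ?_
        split_ifs with hk
        · have h1 : |(σ k : ℝ)| = 1 := by rcases hσ k with h | h <;> simp [h]
          rw [abs_mul, h1, one_mul, abs_of_nonneg (om_nonneg _)]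
          refine (om_sqv_bounds ha _).2.trans ?_
          have := jap_le_prodTail j hk
          have := jap_pos (j k)
          gcongr
        · have := one_le_prodTail j
          simp only [abs_zero]
          positivity
    _ = _ := by simp

/-- The lower bound when the two largest modes carry the same sign. -/
theorem ae_bound_of_same_sign {d r : ℕ} (hd : 2 ≤ d) (hr : 3 ≤ r) {i₀ i₁ : Fin r}
    (h₀ : (i₀ : ℕ) = 0) (h₁ : (i₁ : ℕ) = 1) {σ : Fin r → ℤ} (hσ : ∀ i, σ i = 1 ∨ σ i = -1)
    (hσ01 : σ i₀ * σ i₁ = 1) :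
    ∀ᵐ a ∂(volume.restrict (box d)), ∃ γ : ℝ, 0 < γ ∧ ∀ j : Fin r → Idx d,
      (∀ i i' : Fin r, i ≤ i' → enorm d (j i') ≤ enorm d (j i)) → ¬ IsResonant σ j →
      γ * (prodTail d j ^ (9 * d * r ^ 2))⁻¹ ≤
        |∑ k, (σ k : ℝ) * om (ip a (sqv (j k)))| := by
  have hmb : MeasurableSet (box d) := MeasurableSet.univ_pi fun _ => measurableSet_Ioo
  filter_upwards [ae_family_bound (by omega : 0 < d) (by omega : 1 ≤ r) σ,
    ae_restrict_mem hmb] with a ⟨γ, hγ, hfam⟩ ha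
  set E := 2 * r * (d + 1) + 8 * r with hE
  set K : ℝ := 2 * (4 * r + 1) with hK
  have hK0 : 0 < K := by positivity
  refine ⟨min 1 (γ * (K ^ E)⁻¹), by positivity, fun j hsort hres => ?_⟩
  set P := prodTail d j with hP
  have hP1 : 1 ≤ P := one_le_prodTail j
  set f := ∑ k, (σ k : ℝ) * om (ip a (sqv (j k))) with hf
  by_cases hbig : 1 ≤ |f|
  · refine le_trans ?_ hbig
    exact mul_le_one₀ (min_le_left _ _) (by positivity)
      (inv_le_one_of_one_le₀ (one_le_pow₀ hP1))
  push Not at hbig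
  have htail := abs_tail_le hσ ha j
  rw [sum_eq_add_add_tail h₀ h₁] at hf
  set h := ∑ k : Fin r, if 2 ≤ (k : ℕ) then (σ k : ℝ) * om (ip a (sqv (j k))) else 0
  have hN : jap d (j i₁) ≤ jap d (j i₀) := jap_le_jap (hsort _ _ (by rw [Fin.le_def]; omega))
  have hN2 : jap d (j i₀) ^ 2 ≤ K * P ^ 2 := by
    have b0 := (om_sqv_bounds ha (j i₀)).1
    have b1 := om_nonneg (ip a (sqv (j i₁)))
    have hP2 : 1 ≤ P ^ 2 := one_le_pow₀ hP1
    rw [abs_lt] at hbig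
    rw [abs_le] at htail
    rcases hσ i₀ with s0 | s0
    · have s1 : σ i₁ = 1 := by rw [s0] at hσ01; omega
      rw [s0, s1] at hf
      push_cast at hf
      rw [hK]
      nlinarith
    · have s1 : σ i₁ = -1 := by rw [s0] at hσ01; omega
      rw [s0, s1] at hf
      push_cast at hf
      rw [hK]
      nlinarith
  have hPP : japProd j ≤ K * P ^ 3 := by
    rw [prod_eq_mul_mul_tail h₀ h₁]
    have := jap_pos (j i₀)
    calc _ ≤ jap d (j i₀) * jap d (j i₀) * P := by gcongr
      _ = jap d (j i₀) ^ 2 * P := by ring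
      _ ≤ K * P ^ 2 * P := by gcongr
      _ = _ := by ring
  have hcf : cf σ j ≠ 0 := fun h => hres (isResonant_of_cf_eq_zero hσ h)
  have hmain := hfam 0 j (Or.inr hcf)
  rw [jap_zero, one_mul, ip_zero, zero_add, ← pow_add] at hmain
  refine le_trans ?_ hmain
  have hJ0 : 0 < japProd j := one_pos.trans_le (one_le_japProd j)
  have hexp : P ^ (3 * E) ≤ P ^ (9 * d * r ^ 2) := by
    refine pow_le_pow_right₀ hP1 ?_
    rw [hE]
    nlinarith [Nat.mul_le_mul hd hr, Nat.mul_le_mul_left (d * r) hr]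
  calc min 1 (γ * (K ^ E)⁻¹) * (P ^ (9 * d * r ^ 2))⁻¹
      ≤ γ * (K ^ E)⁻¹ * (P ^ (3 * E))⁻¹ := by
        gcongr
        exact min_le_right _ _
    _ = γ * ((K * P ^ 3) ^ E)⁻¹ := by
        rw [mul_pow K (P ^ 3), mul_inv, ← pow_mul, mul_assoc]
    _ ≤ γ * (japProd j ^ E)⁻¹ := by gcongr

/-- The small divisor attached to the couple `(σ, j)`. -/
def ff {d r : ℕ} (σ : Fin r → ℤ) (a : Fin d → ℝ) (j : Fin r → Idx d) : ℝ :=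
  ∑ k, (σ k : ℝ) * om (ip a (sqv (j k)))

theorem continuous_ff {d r : ℕ} (σ : Fin r → ℤ) (j : Fin r → Idx d) :
    Continuous fun a => ff σ a j := by
  unfold ff; fun_prop

/-- Zero momentum, nonresonant couples. -/
def Adm {d r : ℕ} (σ : Fin r → ℤ) (j : Fin r → Idx d) : Prop :=
  (∑ k, σ k • j k) = 0 ∧ ¬ IsResonant σ j

theorem ae_ff_pos {d r : ℕ} (hd : 0 < d) (hr : 1 ≤ r) {σ : Fin r → ℤ}
    (hσ : ∀ i, σ i = 1 ∨ σ i = -1) :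
    ∀ᵐ a ∂(volume.restrict (box d)), ∀ j, Adm σ j → 0 < |ff σ a j| := by
  filter_upwards [ae_family_bound hd hr σ] with a ⟨γ, hγ, h⟩ j hj
  have := h 0 j (Or.inr fun h => hj.2 (isResonant_of_cf_eq_zero hσ h))
  rw [ip_zero, zero_add] at this
  refine lt_of_lt_of_le ?_ this
  have := one_le_japProd j
  have := jap_pos (0 : Idx d)
  positivity

theorem eq_of_tl_eq {d r : ℕ} {i₀ i₁ : Fin r} (h₀ : (i₀ : ℕ) = 0) (h₁ : (i₁ : ℕ) = 1)
    {σ : Fin r → ℤ} (hσ1 : σ i₁ ≠ 0) {j j' : Fin r → Idx d} (hj : (∑ k, σ k • j k) = 0)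
    (hj' : (∑ k, σ k • j' k) = 0) (e₀ : j i₀ = j' i₀) (ht : tl j = tl j') : j = j' := by
  have htl : ∀ k : Fin r, 2 ≤ (k : ℕ) → j k = j' k := fun k hk => by
    simpa [tl, hk] using congrFun ht k
  rw [sum_eq_add_add_tail h₀ h₁] at hj hj'
  have e : (∑ k : Fin r, if 2 ≤ (k : ℕ) then σ k • j k else 0) =
      ∑ k : Fin r, if 2 ≤ (k : ℕ) then σ k • j' k else 0 := by
    refine Finset.sum_congr rfl fun k _ => ?_
    split_ifs with hk
    · rw [htl k hk]
    · rfl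
  rw [e, e₀] at hj
  have e₁ : j i₁ = j' i₁ := by
    have h : σ i₁ • j i₁ = σ i₁ • j' i₁ :=
      add_left_cancel (add_right_cancel (hj.trans hj'.symm))
    exact smul_right_injective _ hσ1 h
  funext k
  rcases (show (k : ℕ) = 0 ∨ (k : ℕ) = 1 ∨ 2 ≤ (k : ℕ) by omega) with h | h | h
  · rw [show k = i₀ from Fin.ext (by omega), e₀]
  · rw [show k = i₁ from Fin.ext (by omega), e₁]
  · exact htl k h

theorem ff_eq_of_opposite {d r : ℕ} {i₀ i₁ : Fin r} (h₀ : (i₀ : ℕ) = 0) (h₁ : (i₁ : ℕ) = 1)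
    {σ : Fin r → ℤ} (hσ : ∀ i, σ i = 1 ∨ σ i = -1) (hσ01 : σ i₀ * σ i₁ = -1) (a : Fin d → ℝ)
    (j : Fin r → Idx d) :
    ff σ a j = (σ i₀ : ℝ) * (om (ip a (sqv (j i₀))) - om (ip a (sqv (j i₁)))) +
      ∑ k : Fin r, if 2 ≤ (k : ℕ) then (σ k : ℝ) * om (ip a (sqv (j k))) else 0 := by
  have : σ i₁ = -σ i₀ := by rcases hσ i₀ with h | h <;> rw [h] at hσ01 ⊢ <;> omega
  rw [ff, sum_eq_add_add_tail h₀ h₁, this]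
  push_cast
  ring

theorem abs_sub_le_of_momentum {d r : ℕ} {i₀ i₁ : Fin r} (h₀ : (i₀ : ℕ) = 0)
    (h₁ : (i₁ : ℕ) = 1) {σ : Fin r → ℤ} (hσ : ∀ i, σ i = 1 ∨ σ i = -1)
    (hσ01 : σ i₀ * σ i₁ = -1) {j : Fin r → Idx d} (hj : (∑ k, σ k • j k) = 0) (l : Fin d) :
    |((j i₀ l : ℤ) : ℝ) - j i₁ l| ≤ r * prodTail d j := by
  have hs : σ i₁ = -σ i₀ := by rcases hσ i₀ with h | h <;> rw [h] at hσ01 ⊢ <;> omega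
  rw [sum_eq_add_add_tail h₀ h₁, hs] at hj
  have h := congrFun hj l
  simp only [Pi.add_apply, Pi.smul_apply, smul_eq_mul, Finset.sum_apply, Pi.zero_apply] at h
  have h2 : (σ i₀ : ℝ) * ((j i₀ l : ℝ) - j i₁ l) =
      -∑ k : Fin r, if 2 ≤ (k : ℕ) then (σ k : ℝ) * (j k l : ℝ) else 0 := by
    have h3 : σ i₀ * (j i₀ l - j i₁ l) =
        -∑ k : Fin r, if 2 ≤ (k : ℕ) then σ k * j k l else 0 := by
      have e : (∑ k : Fin r, (if 2 ≤ (k : ℕ) then σ k • j k else 0 : Idx d) l) =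
          ∑ k : Fin r, if 2 ≤ (k : ℕ) then σ k * j k l else 0 := by
        refine Finset.sum_congr rfl fun k _ => ?_
        split_ifs <;> simp
      rw [e] at h
      linarith
    have := congrArg (Int.cast : ℤ → ℝ) h3
    push_cast at this
    exact this
  have habs : ∀ k, |(σ k : ℝ)| = 1 := fun k => by rcases hσ k with h | h <;> simp [h]
  calc |((j i₀ l : ℤ) : ℝ) - j i₁ l| = |(σ i₀ : ℝ) * ((j i₀ l : ℝ) - j i₁ l)| := by
        rw [abs_mul, habs, one_mul]
    _ ≤ ∑ k : Fin r, |if 2 ≤ (k : ℕ) then (σ k : ℝ) * (j k l : ℝ) else 0| := by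
        rw [h2, abs_neg]; exact Finset.abs_sum_le_sum_abs _ _
    _ ≤ ∑ _k : Fin r, prodTail d j := by
        refine Finset.sum_le_sum fun k _ => ?_
        split_ifs with hk
        · rw [abs_mul, habs, one_mul]
          exact (abs_le_jap _ _).trans (jap_le_prodTail j hk)
        · rw [abs_zero]; linarith [one_le_prodTail j]
    _ = _ := by simp

theorem om_sq (s : ℝ) : om s ^ 2 = 1 + s ^ 2 := Real.sq_sqrt (by positivity)

theorem abs_le_om (s : ℝ) : |s| ≤ om s := by
  rw [← Real.sqrt_sq_eq_abs, om]
  exact Real.sqrt_le_sqrt (by linarith)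

theorem one_le_om (s : ℝ) : 1 ≤ om s := by
  rw [om, Real.one_le_sqrt]; nlinarith [sq_nonneg s]

theorem abs_om_sub_om_le (s t : ℝ) : |om t - om s| ≤ |t - s| := by
  have h1 := one_le_om s
  have h2 := one_le_om t
  have h3 : |om t - om s| * (om t + om s) = |t - s| * |t + s| := by
    rw [← abs_of_pos (by linarith : 0 < om t + om s), ← abs_mul, ← abs_mul]
    congr 1
    rw [← sub_eq_zero]
    ring_nf
    rw [om_sq, om_sq]
    ring
  have h4 : |t + s| ≤ om t + om s :=
    (abs_add_le _ _).trans (add_le_add (abs_le_om t) (abs_le_om s))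
  have h5 : |om t - om s| * (om t + om s) ≤ |t - s| * (om t + om s) := by
    rw [h3]; gcongr
  exact le_of_mul_le_mul_right h5 (by linarith)

theorem abs_om_add_sub_le {s m τ : ℝ} (hm : 0 ≤ m) (hms : m ≤ s) (hτ : 0 ≤ τ) :
    |om (s + τ * m) - om s - τ * m| ≤ 2 * τ := by
  set A := om s with hA
  set B := om (s + τ * m) with hB
  have hA1 : 1 ≤ A := one_le_om _
  have hB1 : 1 ≤ B := one_le_om _
  have hAs : s ≤ A := (le_abs_self _).trans (abs_le_om s)
  have hBs : s + τ * m ≤ B := (le_abs_self _).trans (abs_le_om _)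
  have hτm : 0 ≤ τ * m := mul_nonneg hτ hm
  have hA' : A ≤ s + 1 := by linarith [om_le (hm.trans hms)]
  have hB' : B ≤ s + τ * m + 1 := by linarith [om_le (by linarith : 0 ≤ s + τ * m)]
  have h : (B - A - τ * m) * (A + B) = -(τ * m * ((A - s) + (B - (s + τ * m)))) := by
    have h1 := om_sq s
    have h2 := om_sq (s + τ * m)
    rw [← hA] at h1
    rw [← hB] at h2
    linear_combination h2 - h1
  have h2 : |B - A - τ * m| * (A + B) = τ * m * ((A - s) + (B - (s + τ * m))) := by
    rw [← abs_of_pos (by linarith : 0 < A + B), ← abs_mul, h, abs_neg,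
      abs_of_nonneg (mul_nonneg hτm (by linarith))]
  have h3 : τ * m * ((A - s) + (B - (s + τ * m))) ≤ 2 * τ * (A + B) := by
    calc _ ≤ τ * m * 2 := by gcongr; linarith
      _ = 2 * τ * m := by ring
      _ ≤ _ := by gcongr; linarith
  exact le_of_mul_le_mul_right (h2.trans_le h3) (by linarith)

theorem le_ip_of_mem_box {d : ℕ} {a : Fin d → ℝ} (ha : a ∈ box d) {m : Idx d} (hm : ∀ l, 0 ≤ m l)
    (i : Fin d) : (m i : ℝ) ≤ ip a m := by
  have h0 : ∀ l, (0 : ℝ) ≤ m l := fun l => by exact_mod_cast hm l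
  calc (m i : ℝ) ≤ a i * m i := by nlinarith [(ha i trivial).1, h0 i]
    _ ≤ ip a m := Finset.single_le_sum (f := fun i => a i * (m i : ℝ))
        (fun l _ => mul_nonneg (by linarith [(ha l trivial).1]) (h0 l)) (Finset.mem_univ i)

theorem box_subset_cube (d : ℕ) : box d ⊆ cube d := fun _ ha i _ =>
  ⟨by linarith [(ha i trivial).1], (ha i trivial).2⟩

theorem abs_ff_translate_sub_ge {d r : ℕ} {i₀ i₁ : Fin r} (h₀ : (i₀ : ℕ) = 0)
    (h₁ : (i₁ : ℕ) = 1) {σ : Fin r → ℤ} (hσ : ∀ i, σ i = 1 ∨ σ i = -1)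
    (hσ01 : σ i₀ * σ i₁ = -1) {j : Fin r → Idx d} (hj : (∑ k, σ k • j k) = 0) {i : Fin d}
    (hne : j i₀ i ≠ j i₁ i) (hbig : (2 * r + 4) * prodTail d j ^ 2 ≤ |(j i₀ i : ℝ)|)
    {a : Fin d → ℝ} (ha : a ∈ box d) {τ : ℝ} (hτ : 0 ≤ τ) :
    τ * |(j i₀ i : ℝ)| ≤ |ff σ (a + τ • Pi.single i 1) j - ff σ a j| := by
  have habs : ∀ k, |(σ k : ℝ)| = 1 := fun k => by rcases hσ k with h | h <;> simp [h]
  set P := prodTail d j with hP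
  have hP1 : 1 ≤ P := one_le_prodTail j
  rw [ff_eq_of_opposite h₀ h₁ hσ hσ01, ff_eq_of_opposite h₀ h₁ hσ hσ01]
  simp only [ip_add_smul, ip_single]
  have key : ∀ k, |om (ip a (sqv (j k)) + τ * ((sqv (j k) i : ℤ) : ℝ)) - om (ip a (sqv (j k))) -
      τ * ((sqv (j k) i : ℤ) : ℝ)| ≤ 2 * τ := fun k =>
    abs_om_add_sub_le (by exact_mod_cast (sqv_le (j k) i).1)
      (le_ip_of_mem_box ha (fun l => (sqv_le (j k) l).1) i) hτ
  have htail : |(∑ k : Fin r, if 2 ≤ (k : ℕ) then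
        (σ k : ℝ) * om (ip a (sqv (j k)) + τ * ((sqv (j k) i : ℤ) : ℝ)) else 0) -
      ∑ k : Fin r, if 2 ≤ (k : ℕ) then (σ k : ℝ) * om (ip a (sqv (j k))) else 0| ≤
      r * (τ * P ^ 2) := by
    rw [← Finset.sum_sub_distrib]
    refine (Finset.abs_sum_le_sum_abs _ _).trans ?_
    calc _ ≤ ∑ _k : Fin r, τ * P ^ 2 := by
          refine Finset.sum_le_sum fun k _ => ?_
          split_ifs with hk
          · rw [← mul_sub, abs_mul, habs, one_mul]
            refine (abs_om_sub_om_le _ _).trans ?_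
            rw [add_sub_cancel_left, abs_mul, abs_of_nonneg hτ,
              abs_of_nonneg (by exact_mod_cast (sqv_le (j k) i).1)]
            refine mul_le_mul_of_nonneg_left ((sqv_le _ i).2.trans ?_) hτ
            have := jap_le_prodTail j hk
            have := jap_pos (j k)
            gcongr
          · simp only [sub_zero, abs_zero]; positivity
      _ = _ := by simp
  have hJ := abs_sub_le_of_momentum h₀ h₁ hσ hσ01 hj i
  have hJ1 : (1 : ℝ) ≤ |(j i₀ i : ℝ) - j i₁ i| := by
    exact_mod_cast Int.one_le_abs (sub_ne_zero.2 hne)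
  have hn : 2 * |(j i₀ i : ℝ)| - r * P ≤ |((sqv (j i₀) i : ℤ) : ℝ) - ((sqv (j i₁) i : ℤ) : ℝ)| := by
    simp only [sqv]
    push_cast
    rw [sq_sub_sq, abs_mul, mul_comm |(j i₀ i : ℝ) + j i₁ i|]
    have h1 : 2 * |(j i₀ i : ℝ)| - r * P ≤ |(j i₀ i : ℝ) + j i₁ i| := by
      have : |2 * (j i₀ i : ℝ)| ≤ |(j i₀ i : ℝ) + j i₁ i| + |(j i₀ i : ℝ) - j i₁ i| := by
        refine le_trans (le_of_eq ?_) (abs_add_le _ _)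
        ring_nf
      rw [abs_mul, abs_two] at this
      linarith
    refine h1.trans (le_mul_of_one_le_left (abs_nonneg _) hJ1)
  have k0 := key i₀
  have k1 := key i₁
  set T' := ∑ k : Fin r, if 2 ≤ (k : ℕ) then
    (σ k : ℝ) * om (ip a (sqv (j k)) + τ * ((sqv (j k) i : ℤ) : ℝ)) else 0
  set T := ∑ k : Fin r, if 2 ≤ (k : ℕ) then (σ k : ℝ) * om (ip a (sqv (j k))) else 0
  set A0 := om (ip a (sqv (j i₀)))
  set A1 := om (ip a (sqv (j i₁)))
  set B0 := om (ip a (sqv (j i₀)) + τ * ((sqv (j i₀) i : ℤ) : ℝ))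
  set B1 := om (ip a (sqv (j i₁)) + τ * ((sqv (j i₁) i : ℤ) : ℝ))
  set n0 := ((sqv (j i₀) i : ℤ) : ℝ)
  set n1 := ((sqv (j i₁) i : ℤ) : ℝ)
  have e1 : |(σ i₀ : ℝ) * (τ * (n0 - n1))| = τ * |n0 - n1| := by
    rw [abs_mul, habs, one_mul, abs_mul, abs_of_nonneg hτ]
  have e2 : (σ i₀ : ℝ) * (τ * (n0 - n1)) =
      ((σ i₀ : ℝ) * (B0 - B1) + T' - ((σ i₀ : ℝ) * (A0 - A1) + T)) -
        (σ i₀ : ℝ) * (B0 - A0 - τ * n0) + (σ i₀ : ℝ) * (B1 - A1 - τ * n1) - (T' - T) := by ring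
  have e3 : |(σ i₀ : ℝ) * (B0 - A0 - τ * n0)| ≤ 2 * τ := by rwa [abs_mul, habs, one_mul]
  have e4 : |(σ i₀ : ℝ) * (B1 - A1 - τ * n1)| ≤ 2 * τ := by rwa [abs_mul, habs, one_mul]
  have e5 : τ * |n0 - n1| ≤ |(σ i₀ : ℝ) * (B0 - B1) + T' - ((σ i₀ : ℝ) * (A0 - A1) + T)| +
      2 * τ + 2 * τ + r * (τ * P ^ 2) := by
    rw [← e1, e2]
    refine (abs_sub _ _).trans (add_le_add ((abs_add_le _ _).trans (add_le_add
      ((abs_sub _ _).trans (add_le_add le_rfl e3)) e4)) htail)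
  have hP2 : P ≤ P ^ 2 := by nlinarith
  have e6 : |(j i₀ i : ℝ)| + 4 + r * P ^ 2 ≤ |n0 - n1| := by
    have : (r : ℝ) * P ≤ r * P ^ 2 := by gcongr
    nlinarith
  nlinarith

theorem jap_rpow_div_le {d : ℕ} {δ : ℝ} (hδ : 0 < δ) (x : Idx d) {i : Fin d}
    (hi : 1 ≤ |(x i : ℝ)|) :
    jap d x ^ (-((d : ℝ) - 1 + δ)) / |(x i : ℝ)| ≤
      2 * ∏ l, (1 + (x l : ℝ) ^ 2) ^ (-((1 + δ / d) / 2)) := by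
  classical
  have hd0 : 0 < d := i.pos
  have hd : (0 : ℝ) < d := by exact_mod_cast hd0
  set N := jap d x with hN
  have hN0 : 0 < N := jap_pos x
  have hle : ∀ l, ∀ s : ℝ, 0 ≤ s → (1 + (x l : ℝ) ^ 2) ^ s ≤ N ^ (2 * s) := fun l s hs => by
    rw [Real.rpow_mul hN0.le, show (2 : ℝ) = ((2 : ℕ) : ℝ) by norm_num, Real.rpow_natCast]
    exact Real.rpow_le_rpow (by positivity) (one_add_sq_le_jap_sq x l) hs
  have h1 : (1 + (x i : ℝ) ^ 2) ^ ((1 + δ / d) / 2) ≤ 2 * |(x i : ℝ)| * N ^ (δ / d) := by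
    rw [add_div, Real.rpow_add (by positivity)]
    refine mul_le_mul ?_ ?_ (by positivity) (by positivity)
    · rw [← Real.sqrt_eq_rpow, Real.sqrt_le_left (by positivity), mul_pow, sq_abs, ← sq_abs]
      nlinarith
    · refine (hle i _ (by positivity)).trans (le_of_eq ?_)
      congr 1; ring
  have h2 : ∏ l ∈ Finset.univ.erase i, (1 + (x l : ℝ) ^ 2) ^ ((1 + δ / d) / 2) ≤
      N ^ ((1 + δ / d) * (d - 1)) := by
    calc _ ≤ ∏ _l ∈ Finset.univ.erase i, N ^ (1 + δ / d) := by
          refine Finset.prod_le_prod (fun _ _ => by positivity) fun l _ => ?_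
          refine (hle l _ (by positivity)).trans (le_of_eq ?_)
          congr 1; ring
      _ = _ := by
          rw [Finset.prod_const, Finset.card_erase_of_mem (Finset.mem_univ i), Finset.card_univ,
            Fintype.card_fin, ← Real.rpow_natCast, ← Real.rpow_mul hN0.le,
            Nat.cast_sub (by omega), Nat.cast_one]
  have h3 : ∏ l, (1 + (x l : ℝ) ^ 2) ^ ((1 + δ / d) / 2) ≤
      2 * (|(x i : ℝ)| * N ^ ((d : ℝ) - 1 + δ)) := by
    rw [← Finset.mul_prod_erase _ _ (Finset.mem_univ i)]
    calc _ ≤ 2 * |(x i : ℝ)| * N ^ (δ / d) * N ^ ((1 + δ / d) * (d - 1)) :=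
          mul_le_mul h1 h2 (Finset.prod_nonneg fun _ _ => by positivity) (by positivity)
      _ = 2 * (|(x i : ℝ)| * (N ^ (δ / d) * N ^ ((1 + δ / d) * (d - 1)))) := by ring
      _ = _ := by
          rw [← Real.rpow_add hN0]
          congr 3
          field_simp
          ring
  have hpos : 0 < ∏ l, (1 + (x l : ℝ) ^ 2) ^ ((1 + δ / d) / 2) :=
    Finset.prod_pos fun _ _ => by positivity
  have e : ∏ l, (1 + (x l : ℝ) ^ 2) ^ (-((1 + δ / d) / 2)) =
      (∏ l, (1 + (x l : ℝ) ^ 2) ^ ((1 + δ / d) / 2))⁻¹ := by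
    rw [← Finset.prod_inv_distrib]
    exact Finset.prod_congr rfl fun l _ => Real.rpow_neg (by positivity) _
  rw [e, Real.rpow_neg hN0.le, div_eq_mul_inv, ← mul_inv, ← div_eq_mul_inv, inv_eq_one_div,
    div_le_div_iff₀ (by positivity) hpos]
  linarith

theorem ae_bound_of_large_coordinate {d r : ℕ} (hd : 0 < d) (hr : 1 ≤ r) {i₀ i₁ : Fin r}
    (h₀ : (i₀ : ℕ) = 0) (h₁ : (i₁ : ℕ) = 1) {σ : Fin r → ℤ} (hσ : ∀ i, σ i = 1 ∨ σ i = -1)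
    (hσ01 : σ i₀ * σ i₁ = -1) {δ : ℝ} (hδ : 0 < δ) :
    ∀ᵐ a ∂(volume.restrict (box d)), ∃ γ : ℝ, 0 < γ ∧ γ ≤ 1 ∧ ∀ (j : Fin r → Idx d) (i : Fin d),
      Adm σ j → j i₀ i ≠ j i₁ i → (2 * r + 4) * prodTail d j ^ 2 ≤ |(j i₀ i : ℝ)| →
      γ * (jap d (j i₀) ^ (-((d : ℝ) - 1 + δ)) * (prodTail d j ^ (d + 1))⁻¹) ≤ |ff σ a j| := by
  have hmb : MeasurableSet (box d) := MeasurableSet.univ_pi fun _ => measurableSet_Ioo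
  have hσ1 : σ i₁ ≠ 0 := by rcases hσ i₁ with h | h <;> rw [h] <;> decide
  have hdr : (0 : ℝ) < d := by exact_mod_cast hd
  let ι := {p : Fin d × (Fin r → Idx d) // Adm σ p.2 ∧ p.2 i₀ p.1 ≠ p.2 i₁ p.1 ∧
    (2 * r + 4) * prodTail d p.2 ^ 2 ≤ |(p.2 i₀ p.1 : ℝ)|}
  have h := ae_exists_lower_bound (ι := ι) (μ := volume.restrict (box d))
    (F := fun p a => |ff σ a p.1.2|)
    (ε := fun p => jap d (p.1.2 i₀) ^ (-((d : ℝ) - 1 + δ)) * (prodTail d p.1.2 ^ (d + 1))⁻¹)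
    (w := fun p => 6 ^ d * 4 * ((∏ l, (1 + (p.1.2 i₀ l : ℝ) ^ 2) ^ (-((1 + δ / d) / 2))) *
      (japProd (tl p.1.2) ^ (d + 1))⁻¹))
    (fun p => by
      have := jap_pos (p.1.2 i₀)
      have := one_le_prodTail p.1.2
      positivity)
    (fun p => by
      have := one_le_japProd (tl p.1.2)
      positivity) ?_ ?_ ?_
  · filter_upwards [h] with a ⟨γ, h0, h1, ha⟩
    exact ⟨γ, h0, h1, fun j i hj hne hbig => ha ⟨(i, j), hj, hne, hbig⟩⟩
  · refine Summable.mul_left _ ?_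
    have hs : (1 / 2 : ℝ) < (1 + δ / d) / 2 := by
      have : 0 < δ / d := by positivity
      linarith
    have h1 : Summable fun q : Fin d × (Idx d × (Fin r → Idx d)) =>
        (1 : ℝ) * ((∏ l, (1 + (q.2.1 l : ℝ) ^ 2) ^ (-((1 + δ / d) / 2))) *
          (japProd q.2.2 ^ (d + 1))⁻¹) :=
      (Summable.of_finite (f := fun _ : Fin d => (1 : ℝ))).mul_of_nonneg
        ((summable_prod_one_add_sq_rpow d hs).mul_of_nonneg (summable_inv_japProd_pow d r hd)
          (fun _ => by positivity) (fun t => by have := one_le_japProd t; positivity))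
        (fun _ => by simp) (fun q => by have := one_le_japProd q.2; positivity)
    have hinj : Function.Injective fun p : ι => (p.1.1, (p.1.2 i₀, tl p.1.2)) := by
      rintro ⟨⟨i, j⟩, hj, _⟩ ⟨⟨i', j'⟩, hj', _⟩ h
      simp only [Prod.mk.injEq] at h
      exact Subtype.ext (Prod.ext h.1 (eq_of_tl_eq h₀ h₁ hσ1 hj.1 hj'.1 h.2.1 h.2.2))
    refine (h1.comp_injective hinj).congr fun p => ?_
    simp
  · rintro ⟨⟨i, j⟩, hj, hne, hbig⟩
    simp only at hne hbig ⊢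
    set P := prodTail d j with hP
    have hP1 : 1 ≤ P := one_le_prodTail j
    have hx1 : 1 ≤ |(j i₀ i : ℝ)| := by
      refine le_trans ?_ hbig
      have : 1 ≤ P ^ 2 := one_le_pow₀ hP1
      nlinarith [show (0 : ℝ) ≤ r by positivity]
    set ε := jap d (j i₀) ^ (-((d : ℝ) - 1 + δ)) * (P ^ (d + 1))⁻¹ with hε
    have hε0 : 0 < ε := by have := jap_pos (j i₀); positivity
    rw [Measure.restrict_apply' hmb]
    refine (volume_le_of_translate_notMem (v := Pi.single i 1) (τ₀ := 2 * ε / |(j i₀ i : ℝ)|) ?_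
      (Set.inter_subset_right.trans (box_subset_cube d)) ?_ (by positivity) ?_).trans
      (ENNReal.ofReal_le_ofReal ?_)
    · refine MeasurableSet.inter ?_ hmb
      exact measurableSet_lt (continuous_ff σ j).abs.measurable measurable_const
    · intro k
      by_cases h : k = i <;> simp [h]
    · rintro a ⟨ha, hab⟩ τ hτ - ⟨hb, -⟩
      have h3 := abs_ff_translate_sub_ge h₀ h₁ hσ hσ01 hj.1 hne hbig hab
        (τ := τ) (le_trans (by positivity) hτ)
      simp only [Set.mem_ofPred_eq] at ha hb
      have h4 := abs_sub (ff σ (a + τ • Pi.single i 1) j) (ff σ a j)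
      rw [div_le_iff₀ (by linarith)] at hτ
      linarith
    · rw [japProd_tl, ← hP]
      have h5 := jap_rpow_div_le hδ (j i₀) hx1
      calc 6 ^ d * (2 * ε / |(j i₀ i : ℝ)|) = 6 ^ d * 2 *
            (jap d (j i₀) ^ (-((d : ℝ) - 1 + δ)) / |(j i₀ i : ℝ)|) * (P ^ (d + 1))⁻¹ := by
              rw [hε]; ring
        _ ≤ 6 ^ d * 2 * (2 * ∏ l, (1 + (j i₀ l : ℝ) ^ 2) ^ (-((1 + δ / d) / 2))) *
            (P ^ (d + 1))⁻¹ := by gcongr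
        _ = _ := by ring
  · intro p
    filter_upwards [ae_ff_pos hd hr hσ] with a ha
    exact ha _ p.2.1

theorem cf_eq_of_sqv_eq {d r : ℕ} {i₀ i₁ : Fin r} (h₀ : (i₀ : ℕ) = 0) (h₁ : (i₁ : ℕ) = 1)
    {σ : Fin r → ℤ} (hs : σ i₁ = -σ i₀) {j : Fin r → Idx d} (he : sqv (j i₀) = sqv (j i₁)) :
    cf σ j = cf (fun k => if 2 ≤ (k : ℕ) then σ k else 0) (tl j) := by
  rw [cf, sum_eq_add_add_tail h₀ h₁, he, hs, ← Finsupp.single_add, add_neg_cancel,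
    Finsupp.single_zero, zero_add, cf]
  refine Finset.sum_congr rfl fun k _ => ?_
  split_ifs with hk
  · simp [tl, hk]
  · simp

theorem om_sub_self_bounds {s : ℝ} (hs : 0 ≤ s) : 0 ≤ om s - s ∧ om s - s ≤ 1 / om s := by
  have h1 := one_le_om s
  have h2 := (le_abs_self s).trans (abs_le_om s)
  refine ⟨by linarith, ?_⟩
  rw [le_div_iff₀ (by linarith)]
  nlinarith [om_sq s]

theorem abs_sqv_sub_sqv_le {d r : ℕ} {x y : Idx d} {P : ℝ} (hP : 1 ≤ P)
    (hJ : ∀ l, |(x l : ℝ) - y l| ≤ r * P)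
    (hsmall : ∀ l, x l ≠ y l → |(x l : ℝ)| < (2 * r + 4) * P ^ 2) (l : Fin d) :
    |(((sqv x - sqv y) l : ℤ) : ℝ)| ≤ 8 * (r + 1) ^ 2 * P ^ 3 := by
  have hr : (0 : ℝ) ≤ r := by positivity
  simp only [Pi.sub_apply, sqv]
  push_cast
  rw [sq_sub_sq, abs_mul]
  by_cases h : x l = y l
  · rw [h]; simp only [sub_self, abs_zero, mul_zero]; positivity
  · have h1 := hsmall l h
    have h2 := hJ l
    have h3 : |(x l : ℝ) + y l| ≤ (5 * r + 8) * P ^ 2 := by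
      have : |(x l : ℝ) + y l| ≤ |2 * (x l : ℝ)| + |(x l : ℝ) - y l| := by
        refine le_trans (le_of_eq ?_) (abs_sub _ _)
        ring_nf
      rw [abs_mul, abs_two] at this
      have : (r : ℝ) * P ≤ r * P ^ 2 := by
        have : P ≤ P ^ 2 := by nlinarith
        gcongr
      linarith
    calc _ ≤ (5 * r + 8) * P ^ 2 * (r * P) := by gcongr
      _ = (5 * r + 8) * r * P ^ 3 := by ring
      _ ≤ _ := by
        have : (5 * r + 8) * (r : ℝ) ≤ 8 * (r + 1) ^ 2 := by nlinarith
        gcongr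

theorem jap_le_mul_jap {d r : ℕ} {x y : Idx d} {P : ℝ} (hP : 1 ≤ P)
    (hJ : ∀ l, |(x l : ℝ) - y l| ≤ r * P) : jap d x ≤ (d + 1) * ((r + 1) * (P * jap d y)) := by
  have hy := one_le_jap y
  have hPy : 1 ≤ P * jap d y := one_le_mul_of_one_le_of_one_le hP hy
  have hr : (0 : ℝ) ≤ r := by positivity
  refine jap_le_of_abs_le (by nlinarith) fun l => ?_
  have h1 : |(x l : ℝ)| ≤ |(x l : ℝ) - y l| + |(y l : ℝ)| := by
    simpa using abs_add_le ((x l : ℝ) - y l) (y l)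
  have h2 := abs_le_jap y l
  have h3 := hJ l
  have h4 : (r : ℝ) * P ≤ r * (P * jap d y) := by
    gcongr; exact le_mul_of_one_le_right (by linarith) hy
  have h5 : jap d y ≤ P * jap d y := le_mul_of_one_le_left (by linarith) hP
  linarith

theorem ae_bound_or_jap_le {d r : ℕ} (hd : 2 ≤ d) (hr : 3 ≤ r) {i₀ i₁ : Fin r}
    (h₀ : (i₀ : ℕ) = 0) (h₁ : (i₁ : ℕ) = 1) {σ : Fin r → ℤ} (hσ : ∀ i, σ i = 1 ∨ σ i = -1)
    (hσ01 : σ i₀ * σ i₁ = -1) :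
    ∀ᵐ a ∂(volume.restrict (box d)), ∃ γ C : ℝ, 0 < γ ∧ 1 ≤ C ∧ ∀ j : Fin r → Idx d,
      Adm σ j → jap d (j i₁) ≤ jap d (j i₀) →
      (∀ l, j i₀ l ≠ j i₁ l → |(j i₀ l : ℝ)| < (2 * r + 4) * prodTail d j ^ 2) →
      γ * (prodTail d j ^ (44 * d * r ^ 4))⁻¹ ≤ |ff σ a j| ∨
        (sqv (j i₀) - sqv (j i₁) ≠ 0 ∧ jap d (j i₀) ≤ C * prodTail d j ^ (10 * d * r)) := by
  have hmb : MeasurableSet (box d) := MeasurableSet.univ_pi fun _ => measurableSet_Ioo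
  have hs : σ i₁ = -σ i₀ := by rcases hσ i₀ with h | h <;> rw [h] at hσ01 ⊢ <;> omega
  have habs : ∀ k, |(σ k : ℝ)| = 1 := fun k => by rcases hσ k with h | h <;> simp [h]
  filter_upwards [ae_family_bound (by omega : 0 < d) (by omega : 1 ≤ r)
    (fun k : Fin r => if 2 ≤ (k : ℕ) then σ k else 0), ae_restrict_mem hmb] with a ⟨γ, hγ, hfam⟩ ha
  set E := 2 * r * (d + 1) with hE
  set K : ℝ := (d + 1) * (8 * (r + 1) ^ 2) with hK
  have hK1 : 1 ≤ K := by
    rw [hK]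
    refine one_le_mul_of_one_le_of_one_le (by linarith [show (0 : ℝ) ≤ d by positivity]) ?_
    nlinarith [show (0 : ℝ) ≤ r by positivity]
  set g := γ * (K ^ E)⁻¹ with hg
  have hg0 : 0 < g := by positivity
  set C2 : ℝ := (d + 1) * (r + 1) with hC2
  have hC20 : 0 < C2 := by positivity
  refine ⟨g / 2, 1 + 8 * C2 ^ 2 / g, by positivity, by simp only [le_add_iff_nonneg_right]; positivity,
    fun j hj hle hsmall => ?_⟩
  set P := prodTail d j with hP
  have hP1 : 1 ≤ P := one_le_prodTail j
  set N := jap d (j i₀) with hN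
  have hN1 : 1 ≤ N := one_le_jap _
  have hJ := abs_sub_le_of_momentum h₀ h₁ hσ hσ01 hj.1
  rw [← hP] at hJ
  set n := sqv (j i₀) - sqv (j i₁) with hn
  set h := ∑ k : Fin r, if 2 ≤ (k : ℕ) then (σ k : ℝ) * om (ip a (sqv (j k))) else 0 with hh
  set s₀ := ip a (sqv (j i₀)) with hs0
  set s₁ := ip a (sqv (j i₁)) with hs1
  have hff : ff σ a j = (σ i₀ : ℝ) * (om s₀ - om s₁) + h := ff_eq_of_opposite h₀ h₁ hσ hσ01 a j
  set κ := 4 * E + 8 * r with hκ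
  have hjn : jap d (σ i₀ • n) ≤ K * P ^ 3 := by
    have : jap d (σ i₀ • n) ≤ (d + 1) * (8 * (r + 1) ^ 2 * P ^ 3) := by
      refine jap_le_of_abs_le ?_ fun l => ?_
      · refine one_le_mul_of_one_le_of_one_le ?_ (one_le_pow₀ hP1)
        nlinarith [show (0 : ℝ) ≤ r by positivity]
      · rw [Pi.smul_apply, smul_eq_mul, Int.cast_mul, abs_mul, habs, one_mul]
        exact abs_sqv_sub_sqv_le hP1 hJ hsmall l
    rw [hK]; linarith
  have hβ : g * (P ^ κ)⁻¹ ≤ |ip a (σ i₀ • n) + h| := by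
    have hne : σ i₀ • n ≠ 0 ∨ cf (fun k => if 2 ≤ (k : ℕ) then σ k else 0) (tl j) ≠ 0 := by
      by_cases hn0 : n = 0
      · right
        rw [← cf_eq_of_sqv_eq h₀ h₁ hs (sub_eq_zero.1 hn0)]
        exact fun h => hj.2 (isResonant_of_cf_eq_zero hσ h)
      · left
        refine smul_ne_zero ?_ hn0
        rcases hσ i₀ with h | h <;> rw [h] <;> decide
    have h1 := hfam (σ i₀ • n) (tl j) hne
    have h2 : (∑ k : Fin r, (((if 2 ≤ (k : ℕ) then σ k else 0 : ℤ)) : ℝ) *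
        om (ip a (sqv (tl j k)))) = h := by
      refine Finset.sum_congr rfl fun k _ => ?_
      by_cases hk : 2 ≤ (k : ℕ)
      · simp [tl, hk]
      · simp [hk]
    rw [h2, japProd_tl] at h1
    refine le_trans ?_ h1
    have hjp := jap_pos (σ i₀ • n)
    calc g * (P ^ κ)⁻¹ = γ * ((K * P ^ 3 * P) ^ E * P ^ (8 * r))⁻¹ := by
          rw [hg, hκ, show K * P ^ 3 * P = K * P ^ 4 by ring, mul_pow K, ← pow_mul, mul_assoc (K ^ E),
            ← pow_add, mul_inv, mul_assoc]
      _ ≤ _ := by gcongr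
  have hκle : κ + 2 ≤ 20 * d * r := by rw [hκ, hE]; nlinarith [Nat.mul_le_mul hd hr]
  have hκle2 : κ ≤ 44 * d * r ^ 4 := by
    have : d * r * 1 ≤ d * r * r ^ 3 := Nat.mul_le_mul_left _ (Nat.one_le_pow _ _ (by omega))
    nlinarith
  have hstep : g / 2 * (P ^ (44 * d * r ^ 4))⁻¹ ≤ g * (P ^ κ)⁻¹ / 2 := by
    rw [div_mul_eq_mul_div]
    gcongr
  by_cases hn0 : n = 0
  · left
    have hs' : s₀ = s₁ := by rw [hs0, hs1, sub_eq_zero.1 hn0]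
    rw [hff, hs', sub_self, mul_zero, zero_add]
    rw [hn0, smul_zero, ip_zero, zero_add] at hβ
    refine hstep.trans (le_trans ?_ hβ)
    have : 0 ≤ g * (P ^ κ)⁻¹ := by positivity
    linarith
  · have hs00 : 0 ≤ s₀ := ip_nonneg (fun i => by linarith [(ha i trivial).1]) fun l => (sqv_le _ l).1
    have hs10 : 0 ≤ s₁ := ip_nonneg (fun i => by linarith [(ha i trivial).1]) fun l => (sqv_le _ l).1
    obtain ⟨p0, p0'⟩ := om_sub_self_bounds hs00
    obtain ⟨p1, p1'⟩ := om_sub_self_bounds hs10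
    set M := jap d (j i₁) with hM
    have hM1 : 1 ≤ M := one_le_jap _
    have q0 : 1 / om s₀ ≤ 2 / M ^ 2 := by
      rw [div_le_div_iff₀ (by linarith [one_le_om s₀]) (by positivity)]
      have := (om_sqv_bounds ha (j i₀)).1
      have : M ^ 2 ≤ N ^ 2 := by gcongr
      linarith
    have q1 : 1 / om s₁ ≤ 2 / M ^ 2 := by
      rw [div_le_div_iff₀ (by linarith [one_le_om s₁]) (by positivity)]
      have := (om_sqv_bounds ha (j i₁)).1
      linarith
    have hip : ip a (σ i₀ • n) = (σ i₀ : ℝ) * (s₀ - s₁) := by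
      rw [hs0, hs1, ← ip_sub, ip, ip, Finset.mul_sum]
      refine Finset.sum_congr rfl fun l _ => ?_
      rw [Pi.smul_apply, smul_eq_mul, Int.cast_mul]
      ring
    have herr : |ip a (σ i₀ • n) + h| ≤ |ff σ a j| + 2 / M ^ 2 := by
      have e1 : ip a (σ i₀ • n) + h =
          ff σ a j - (σ i₀ : ℝ) * ((om s₀ - s₀) - (om s₁ - s₁)) := by
        rw [hff, hip]; ring
      rw [e1]
      refine (abs_sub _ _).trans (add_le_add le_rfl ?_)
      rw [abs_mul, habs, one_mul, abs_le]
      constructor <;> linarith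
    by_cases hcase : 2 / M ^ 2 ≤ g * (P ^ κ)⁻¹ / 2
    · left
      linarith
    · right
      refine ⟨hn0, ?_⟩
      push Not at hcase
      have hNM : N ≤ C2 * (P * M) := by
        rw [hC2, mul_assoc]; exact jap_le_mul_jap hP1 hJ
      have h1 : g * M ^ 2 < 4 * P ^ κ := by
        rw [← div_eq_mul_inv, div_div, div_lt_div_iff₀ (by positivity) (by positivity)] at hcase
        linarith
      have h2 : N ^ 2 ≤ C2 ^ 2 * (P ^ 2 * M ^ 2) := by
        calc N ^ 2 ≤ (C2 * (P * M)) ^ 2 := by gcongr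
          _ = _ := by ring
      have h3 : g * N ^ 2 ≤ 4 * C2 ^ 2 * P ^ (20 * d * r) := by
        calc g * N ^ 2 ≤ g * (C2 ^ 2 * (P ^ 2 * M ^ 2)) := by gcongr
          _ = C2 ^ 2 * P ^ 2 * (g * M ^ 2) := by ring
          _ ≤ C2 ^ 2 * P ^ 2 * (4 * P ^ κ) := by gcongr
          _ = 4 * C2 ^ 2 * P ^ (κ + 2) := by ring
          _ ≤ _ := by gcongr
      refine (abs_le_of_sq_le_sq' ?_ (by positivity)).2
      rw [mul_pow, ← pow_mul, show 10 * d * r * 2 = 20 * d * r by ring]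
      set c := 8 * C2 ^ 2 / g with hc
      have hc0 : 0 ≤ c := by positivity
      have h4 : 4 * C2 ^ 2 ≤ g * c := by
        rw [hc, mul_div_cancel₀ _ hg0.ne']; linarith [sq_nonneg C2]
      have h5 : g * N ^ 2 ≤ g * (c * P ^ (20 * d * r)) := by
        calc _ ≤ 4 * C2 ^ 2 * P ^ (20 * d * r) := h3
          _ ≤ g * c * P ^ (20 * d * r) := by gcongr
          _ = _ := by ring
      have h6 : c ≤ (1 + c) ^ 2 := by linarith [sq_nonneg c, show (1 + c) ^ 2 = 1 + 2 * c + c ^ 2 by ring]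
      refine (le_of_mul_le_mul_left h5 hg0).trans ?_
      gcongr

/-- The real vector underlying an integer vector. -/
def rv {d : ℕ} (m : Idx d) : Fin d → ℝ := fun l => (m l : ℝ)

theorem ip_eq_dotProduct {d : ℕ} (a : Fin d → ℝ) (m : Idx d) : ip a m = a ⬝ᵥ rv m := rfl

theorem det_mul_transpose_ne_zero {n : Type*} [Fintype n] [DecidableEq n] {d : ℕ}
    {w : n → Fin d → ℝ} (hw : LinearIndependent ℝ w) :
    (Matrix.of fun k l => w k ⬝ᵥ w l).det ≠ 0 := by
  intro h
  obtain ⟨x, hx, hx0⟩ := Matrix.exists_vecMul_eq_zero_iff.2 h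
  set u : Fin d → ℝ := ∑ k, x k • w k with hu
  have h1 : ∀ l, u ⬝ᵥ w l = 0 := fun l => by
    have := congrFun hx0 l
    simp only [Matrix.vecMul, dotProduct, Matrix.of_apply, Pi.zero_apply] at this
    rw [hu, sum_dotProduct]
    simp only [smul_dotProduct, smul_eq_mul]
    exact this
  have h2 : u ⬝ᵥ u = 0 := by
    nth_rewrite 2 [hu]
    rw [dotProduct_sum]
    exact Finset.sum_eq_zero fun l _ => by rw [dotProduct_smul, h1, smul_zero]
  exact hx (funext (Fintype.linearIndependent_iff.1 hw x (dotProduct_self_eq_zero.1 h2)))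

theorem exists_orthogonal_of_linearIndependent {n : Type*} [Fintype n] [DecidableEq n] {d : ℕ}
    {w : n → Idx d} (hw : LinearIndependent ℝ fun k => rv (w k)) {B : ℝ} (hB : 1 ≤ B)
    (hwB : ∀ k l, |(w k l : ℝ)| ≤ B) (o : n) :
    ∃ v : Fin d → ℝ, (∀ k, k ≠ o → ip v (w k) = 0) ∧ 1 ≤ ip v (w o) ∧
      ∀ i, |v i| ≤ Fintype.card n * (((Fintype.card n).factorial *
        ((d + 1) * B ^ 2) ^ Fintype.card n) * B) := by
  set G : Matrix n n ℝ := Matrix.of fun k l => rv (w k) ⬝ᵥ rv (w l) with hG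
  have hdet : G.det ≠ 0 := det_mul_transpose_ne_zero hw
  have hdet1 : 1 ≤ |G.det| := by
    set GZ : Matrix n n ℤ := Matrix.of fun k l => w k ⬝ᵥ w l with hGZ
    have h : G = GZ.map (Int.castRingHom ℝ) := by
      ext k l
      simp [hG, hGZ, dotProduct, rv]
    have h2 : G.det = ((GZ.det : ℤ) : ℝ) := by
      rw [h, ← RingHom.mapMatrix_apply, ← RingHom.map_det]
      rfl
    rw [h2] at hdet ⊢
    exact_mod_cast Int.one_le_abs (by exact_mod_cast hdet)
  have hGB : ∀ k l, |G k l| ≤ (d + 1) * B ^ 2 := by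
    intro k l
    calc |G k l| = |∑ i, (w k i : ℝ) * w l i| := rfl
      _ ≤ ∑ i, |(w k i : ℝ) * w l i| := Finset.abs_sum_le_sum_abs _ _
      _ ≤ ∑ _i : Fin d, B ^ 2 := Finset.sum_le_sum fun i _ => by
          rw [abs_mul, sq]
          exact mul_le_mul (hwB k i) (hwB l i) (abs_nonneg _) (by linarith)
      _ = d * B ^ 2 := by simp
      _ ≤ _ := by gcongr; linarith
  have hadj : ∀ k l, |G.adjugate k l| ≤
      (Fintype.card n).factorial * ((d + 1) * B ^ 2) ^ Fintype.card n := by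
    intro k l
    rw [Matrix.adjugate_apply]
    have := Matrix.det_le (A := G.updateRow l (Pi.single k 1)) (abv := AbsoluteValue.abs)
      (x := (d + 1) * B ^ 2) fun p q => by
        by_cases hp : p = l
        · subst hp
          rw [Matrix.updateRow_self]
          have h1 : (1 : ℝ) ≤ (d + 1) * B ^ 2 :=
            one_le_mul_of_one_le_of_one_le (by linarith [show (0 : ℝ) ≤ d by positivity])
              (one_le_pow₀ hB)
          by_cases hq : q = k
          · subst hq; simpa using h1
          · simp only [Pi.single_apply, hq, if_false, map_zero]; positivity
        · rw [Matrix.updateRow_ne hp]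
          exact hGB p q
    simpa [nsmul_eq_mul] using this
  set u : Fin d → ℝ := ∑ k, G.adjugate o k • rv (w k) with hu
  have hul : ∀ l, ip u (w l) = if o = l then G.det else 0 := by
    intro l
    have h := congrFun (congrFun (Matrix.adjugate_mul G) o) l
    rw [Matrix.mul_apply, Matrix.smul_apply, Matrix.one_apply, smul_eq_mul, mul_ite, mul_one,
      mul_zero] at h
    rw [ip_eq_dotProduct, hu, sum_dotProduct, ← h]
    exact Finset.sum_congr rfl fun k _ => by rw [smul_dotProduct]; rfl
  have hub : ∀ i, |u i| ≤ Fintype.card n * (((Fintype.card n).factorial *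
      ((d + 1) * B ^ 2) ^ Fintype.card n) * B) := by
    intro i
    rw [hu, Finset.sum_apply]
    refine (Finset.abs_sum_le_sum_abs _ _).trans ?_
    calc _ ≤ ∑ _k : n, ((Fintype.card n).factorial *
          ((d + 1) * B ^ 2) ^ Fintype.card n) * B := by
          refine Finset.sum_le_sum fun k _ => ?_
          rw [Pi.smul_apply, smul_eq_mul, abs_mul]
          exact mul_le_mul (hadj _ _) (hwB k i) (abs_nonneg _) (by positivity)
      _ = _ := by simp
  set ε : ℝ := ((SignType.sign G.det : SignType) : ℝ) with hε
  have hε1 : |ε| = 1 := by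
    rcases lt_or_gt_of_ne hdet with h | h <;> simp [hε, h]
  refine ⟨ε • u, fun k hk => ?_, ?_, fun i => ?_⟩
  · rw [ip_smul, hul, if_neg (Ne.symm hk), mul_zero]
  · rw [ip_smul, hul, if_pos rfl, hε, sign_mul_self]
    exact hdet1
  · rw [Pi.smul_apply, smul_eq_mul, abs_mul, hε1, one_mul]
    exact hub i

/-- A vector outside the span of finitely many integer vectors is detected by a vector
orthogonal to them, of polynomially bounded size. -/
theorem exists_orthogonal_vector (d r : ℕ) : ∃ C : ℝ, 1 ≤ C ∧
    ∀ (B : ℝ) (g : Fin r → Idx d) (m : Idx d), 1 ≤ B → (∀ k l, |(g k l : ℝ)| ≤ B) →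
      (∀ l, |(m l : ℝ)| ≤ B) → rv m ∉ Submodule.span ℝ (Set.range fun k => rv (g k)) →
      ∃ v : Fin d → ℝ, (∀ k, ip v (g k) = 0) ∧ 1 ≤ ip v m ∧ ∀ i, |v i| ≤ C * B ^ (2 * r + 3) := by
  classical
  refine ⟨(r + 1) * ((r + 1).factorial * (d + 1) ^ (r + 1)), ?_, ?_⟩
  · have h1 : (1 : ℝ) ≤ (r + 1).factorial := by exact_mod_cast Nat.one_le_iff_ne_zero.2 (Nat.factorial_ne_zero _)
    have h2 : (1 : ℝ) ≤ (d + 1) ^ (r + 1) := one_le_pow₀ (by linarith [show (0 : ℝ) ≤ d by positivity])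
    exact one_le_mul_of_one_le_of_one_le (by linarith [show (0 : ℝ) ≤ r by positivity])
      (one_le_mul_of_one_le_of_one_le h1 h2)
  intro B g m hB hg hm hspan
  obtain ⟨κ, e, he, hsp, hli⟩ := exists_linearIndependent' ℝ fun k => rv (g k)
  have : Finite κ := Finite.of_injective e he
  have : Fintype κ := Fintype.ofFinite κ
  have hcard : Fintype.card (Option κ) ≤ r + 1 := by
    rw [Fintype.card_option]
    have := Fintype.card_le_of_injective e he
    rw [Fintype.card_fin] at this
    omega
  let w : Option κ → Idx d := fun o => o.elim m fun k => g (e k)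
  have hw : LinearIndependent ℝ fun o => rv (w o) := by
    rw [← hsp] at hspan
    have h := hli.option hspan
    have hwo : (fun o => rv (w o)) =
        fun o => Option.casesOn' o (rv m) ((fun k => rv (g k)) ∘ e) := by
      funext o
      cases o <;> rfl
    rw [hwo]
    exact h
  obtain ⟨v, h1, h2, h3⟩ := exists_orthogonal_of_linearIndependent hw hB
    (fun o l => by cases o with
      | none => exact hm l
      | some k => exact hg _ l) none
  refine ⟨v, fun k => ?_, h2, fun i => (h3 i).trans ?_⟩
  · have hk : rv (g k) ∈ Submodule.span ℝ (Set.range ((fun k => rv (g k)) ∘ e)) := by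
      rw [hsp]
      exact Submodule.subset_span ⟨k, rfl⟩
    rw [ip_eq_dotProduct]
    generalize rv (g k) = x at hk ⊢
    induction hk using Submodule.span_induction with
    | mem x hx =>
      obtain ⟨q, rfl⟩ := hx
      exact h1 (some q) (by simp)
    | zero => exact dotProduct_zero _
    | add x y _ _ hx hy => rw [dotProduct_add, hx, hy, add_zero]
    | smul c x _ hx => rw [dotProduct_smul, hx, smul_zero]
  · have hB2 : 1 ≤ B ^ 2 := one_le_pow₀ hB
    have hd1 : (1 : ℝ) ≤ (d + 1) * B ^ 2 :=
      one_le_mul_of_one_le_of_one_le (by linarith [show (0 : ℝ) ≤ d by positivity]) hB2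
    have hc : (Fintype.card (Option κ) : ℝ) ≤ r + 1 := by exact_mod_cast hcard
    have hf : ((Fintype.card (Option κ)).factorial : ℝ) ≤ (r + 1).factorial := by
      exact_mod_cast Nat.factorial_le hcard
    calc _ ≤ ((r : ℝ) + 1) * (((r + 1).factorial * ((d + 1) * B ^ 2) ^ (r + 1)) * B) := by
          gcongr
      _ = _ := by rw [mul_pow, ← pow_mul]; ring

theorem hasDerivAt_om (s : ℝ) : HasDerivAt om (s / om s) s := by
  have h : HasDerivAt (fun s : ℝ => 1 + s ^ 2) (2 * s) s := by
    simpa using (hasDerivAt_pow 2 s).const_add 1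
  refine (h.sqrt (by positivity)).congr_deriv ?_
  change 2 * s / (2 * om s) = s / om s
  rw [mul_div_mul_left _ _ two_ne_zero]

theorem sub_le_div_om_sub_div_om {a b M : ℝ} (ha : 0 ≤ a) (hab : a ≤ b) (hM : 1 ≤ M)
    (hb : b ≤ M) : (b - a) / (8 * M ^ 3) ≤ b / om b - a / om a := by
  rcases hab.eq_or_lt with rfl | hab
  · simp
  have ha1 := one_le_om a
  have hb1 := one_le_om b
  have ha2 := om_le ha
  have hb2 := om_le (ha.trans hab.le)
  have hpos : 0 < b * om a + a * om b := by nlinarith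
  have e : b / om b - a / om a = (b - a) * (a + b) / (om a * om b * (b * om a + a * om b)) := by
    have h1 := om_sq a
    have h2 := om_sq b
    rw [div_sub_div _ _ (by linarith) (by linarith), div_eq_div_iff (by positivity) (by positivity)]
    linear_combination (om a * om b) * (b ^ 2 * h1 - a ^ 2 * h2)
  rw [e, div_le_div_iff₀ (by positivity) (by positivity)]
  have h3 : om a * om b * (b * om a + a * om b) ≤ (2 * M) * (2 * M) * (b * (2 * M) + a * (2 * M)) := by
    have h4 : om a ≤ 2 * M := by linarith
    have h5 : om b ≤ 2 * M := by linarith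
    have : 0 ≤ b := ha.trans hab.le
    gcongr
  calc _ ≤ (b - a) * ((2 * M) * (2 * M) * (b * (2 * M) + a * (2 * M))) := by
        have : 0 ≤ b - a := by linarith
        gcongr
    _ = _ := by ring

/-- Quantitative convexity of `om`. -/
theorem le_second_difference {x y h M : ℝ} (hx : 0 ≤ x) (hxy : x ≤ y) (hh : 0 ≤ h) (hM : 1 ≤ M)
    (hy : y + h ≤ M) :
    h * (y - x) / (8 * M ^ 3) ≤ (om (y + h) - om y) - (om (x + h) - om x) := by
  have hd : ∀ t, HasDerivAt (fun t => om (t + h) - om t) ((t + h) / om (t + h) - t / om t) t :=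
    fun t => ((hasDerivAt_om (t + h)).comp_add_const t h).sub (hasDerivAt_om t)
  have key := (convex_Icc x y).mul_sub_le_image_sub_of_le_deriv (f := fun t => om (t + h) - om t)
    (C := h / (8 * M ^ 3)) (fun t _ => (hd t).continuousAt.continuousWithinAt)
    (fun t _ => (hd t).differentiableAt.differentiableWithinAt) (fun t ht => by
      rw [interior_Icc] at ht
      rw [(hd t).deriv]
      have := sub_le_div_om_sub_div_om (a := t) (b := t + h) (hx.trans ht.1.le) (by linarith) hM
        (by linarith [ht.2])
      rwa [add_sub_cancel_left] at this) x (Set.left_mem_Icc.2 hxy) y (Set.right_mem_Icc.2 hxy) hxy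
  refine le_trans (le_of_eq ?_) key
  ring

/-- The integer vectors `sqv (j i₀) - sqv (j i₁)` and `sqv (j k)`, `k ≥ 2`. -/
def gen {d r : ℕ} (i₀ i₁ : Fin r) (j : Fin r → Idx d) (k : Fin r) : Idx d :=
  if k = i₀ then sqv (j i₀) - sqv (j i₁) else if 2 ≤ (k : ℕ) then sqv (j k) else 0

theorem gen_self {d r : ℕ} (i₀ i₁ : Fin r) (j : Fin r → Idx d) :
    gen i₀ i₁ j i₀ = sqv (j i₀) - sqv (j i₁) := if_pos rfl

theorem gen_of_two_le {d r : ℕ} {i₀ : Fin r} (h₀ : (i₀ : ℕ) = 0) (i₁ : Fin r) (j : Fin r → Idx d)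
    {k : Fin r} (hk : 2 ≤ (k : ℕ)) : gen i₀ i₁ j k = sqv (j k) := by
  rw [gen, if_neg (fun h => by rw [h] at hk; omega), if_pos hk]

theorem abs_sqv_le {d : ℕ} {x : Idx d} {N : ℝ} (h : jap d x ≤ N) (l : Fin d) :
    |(sqv x l : ℝ)| ≤ N ^ 2 := by
  rw [abs_of_nonneg (by exact_mod_cast (sqv_le x l).1)]
  have := jap_pos x
  exact (sqv_le x l).2.trans (by gcongr)

theorem abs_gen_le {d r : ℕ} {i₀ i₁ : Fin r} {j : Fin r → Idx d}
    (hj : ∀ k, jap d (j k) ≤ jap d (j i₀)) (k : Fin r) (l : Fin d) :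
    |(gen i₀ i₁ j k l : ℝ)| ≤ jap d (j i₀) ^ 2 := by
  unfold gen
  split_ifs
  · rw [Pi.sub_apply, Int.cast_sub]
    have h0 := abs_sqv_le (le_refl (jap d (j i₀))) l
    have h1 := abs_sqv_le (hj i₁) l
    have h2 : (0 : ℝ) ≤ (sqv (j i₀) l : ℝ) := by exact_mod_cast (sqv_le (j i₀) l).1
    have h3 : (0 : ℝ) ≤ (sqv (j i₁) l : ℝ) := by exact_mod_cast (sqv_le (j i₁) l).1
    rw [abs_of_nonneg h2] at h0
    rw [abs_of_nonneg h3] at h1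
    rw [abs_le]
    constructor <;> linarith
  · exact abs_sqv_le (hj k) l
  · simp only [Pi.zero_apply, Int.cast_zero, abs_zero]
    positivity

theorem le_abs_second_difference {x y h M : ℝ} (hx : 0 ≤ x) (hy : 0 ≤ y) (hh : 0 ≤ h) (hM : 1 ≤ M)
    (hx' : x + h ≤ M) (hy' : y + h ≤ M) :
    h * |x - y| / (8 * M ^ 3) ≤ |(om (x + h) - om (y + h)) - (om x - om y)| := by
  rcases le_total x y with hxy | hxy
  · rw [abs_sub_comm x y, abs_of_nonneg (sub_nonneg.2 hxy), abs_sub_comm]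
    refine (le_second_difference hx hxy hh hM hy').trans ((le_of_eq ?_).trans (le_abs_self _))
    ring
  · rw [abs_of_nonneg (sub_nonneg.2 hxy)]
    refine (le_second_difference hy hxy hh hM hx').trans ((le_of_eq ?_).trans (le_abs_self _))
    ring

theorem le_abs_ff_translate_sub {d r : ℕ} {i₀ i₁ : Fin r} (h₀ : (i₀ : ℕ) = 0)
    (h₁ : (i₁ : ℕ) = 1) {σ : Fin r → ℤ} (hσ : ∀ i, σ i = 1 ∨ σ i = -1)
    (hσ01 : σ i₀ * σ i₁ = -1) {j : Fin r → Idx d} (hj : jap d (j i₁) ≤ jap d (j i₀))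
    {a v : Fin d → ℝ} {τ : ℝ} (hτ : 0 ≤ τ) (ha : a ∈ box d) (ha' : a + τ • v ∈ box d)
    (hv0 : 0 ≤ ip v (sqv (j i₀))) (hv : ∀ k, ip v (gen i₀ i₁ j k) = 0) :
    τ * ip v (sqv (j i₀)) * |ip a (sqv (j i₀) - sqv (j i₁))| / (512 * jap d (j i₀) ^ 6) ≤
      |ff σ (a + τ • v) j - ff σ a j| := by
  have hv1 : ip v (sqv (j i₁)) = ip v (sqv (j i₀)) := by
    have := hv i₀
    rw [gen_self, ip_sub] at this
    linarith
  have htail : (∑ k : Fin r, if 2 ≤ (k : ℕ) then (σ k : ℝ) * om (ip (a + τ • v) (sqv (j k))) else 0) =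
      ∑ k : Fin r, if 2 ≤ (k : ℕ) then (σ k : ℝ) * om (ip a (sqv (j k))) else 0 := by
    refine Finset.sum_congr rfl fun k _ => ?_
    split_ifs with hk
    · have := hv k
      rw [gen_of_two_le h₀ i₁ j hk] at this
      rw [ip_add_smul, this, mul_zero, add_zero]
    · rfl
  rw [ff_eq_of_opposite h₀ h₁ hσ hσ01, ff_eq_of_opposite h₀ h₁ hσ hσ01, htail, add_sub_add_right_eq_sub,
    ← mul_sub, abs_mul, show |(σ i₀ : ℝ)| = 1 by rcases hσ i₀ with h | h <;> simp [h], one_mul]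
  have hN := one_le_jap (j i₀)
  have hup : ∀ k, jap d (j k) ≤ jap d (j i₀) → ∀ b ∈ box d,
      0 ≤ ip b (sqv (j k)) ∧ ip b (sqv (j k)) ≤ 4 * jap d (j i₀) ^ 2 := by
    intro k hk b hb
    have h := ip_sqv_bounds hb (j k)
    have h1 := one_le_jap (j k)
    constructor
    · nlinarith
    · have : jap d (j k) ^ 2 ≤ jap d (j i₀) ^ 2 := by gcongr
      linarith
  have e0 := (hup i₀ le_rfl _ ha').2
  have e1 := (hup i₁ hj _ ha').2
  rw [ip_add_smul] at e0 e1
  rw [hv1] at e1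
  rw [ip_add_smul, ip_add_smul, hv1, ip_sub]
  refine le_trans (le_of_eq ?_) (le_abs_second_difference (hup i₀ le_rfl _ ha).1 (hup i₁ hj _ ha).1
    (mul_nonneg hτ hv0) (M := 4 * jap d (j i₀) ^ 2) (by nlinarith) e0 e1)
  congr 1
  ring

theorem ae_bound_of_notMem_span {d r : ℕ} (hd : 0 < d) (hr : 1 ≤ r) {i₀ i₁ : Fin r}
    (h₀ : (i₀ : ℕ) = 0) (h₁ : (i₁ : ℕ) = 1) {σ : Fin r → ℤ} (hσ : ∀ i, σ i = 1 ∨ σ i = -1)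
    (hσ01 : σ i₀ * σ i₁ = -1) :
    ∀ᵐ a ∂(volume.restrict (box d)), ∃ γ : ℝ, 0 < γ ∧ ∀ j : Fin r → Idx d,
      Adm σ j → (∀ k, jap d (j k) ≤ jap d (j i₀)) → sqv (j i₀) - sqv (j i₁) ≠ 0 →
      rv (sqv (j i₀)) ∉ Submodule.span ℝ (Set.range fun k => rv (gen i₀ i₁ j k)) →
      γ * ((jap d (sqv (j i₀) - sqv (j i₁)) * jap d (j i₀) * prodTail d j) ^ (d + 1) *
        jap d (j i₀) ^ (4 * r + 12))⁻¹ ≤ |ff σ a j| := by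
  have hmb : MeasurableSet (box d) := MeasurableSet.univ_pi fun _ => measurableSet_Ioo
  have hσ1 : σ i₁ ≠ 0 := by rcases hσ i₁ with h | h <;> rw [h] <;> decide
  obtain ⟨C, hC1, hC⟩ := exists_orthogonal_vector d r
  let ι := {j : Fin r → Idx d // Adm σ j ∧ (∀ k, jap d (j k) ≤ jap d (j i₀)) ∧
    sqv (j i₀) - sqv (j i₁) ≠ 0 ∧
    rv (sqv (j i₀)) ∉ Submodule.span ℝ (Set.range fun k => rv (gen i₀ i₁ j k))}
  let T : ℕ → Set (Fin d → ℝ) := fun q =>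
    {a | ∀ n : Idx d, n ≠ 0 → (jap d n ^ (d + 1))⁻¹ ≤ (q + 1) * |ip a n|}
  have hT : ∀ q, MeasurableSet (T q) := fun q => by
    have : T q = ⋂ n : Idx d, ⋂ _ : n ≠ 0,
        {a | (jap d n ^ (d + 1))⁻¹ ≤ (q + 1) * |ip a n|} := by
      ext a; simp [T]
    rw [this]
    refine MeasurableSet.iInter fun n => MeasurableSet.iInter fun _ => ?_
    exact measurableSet_le measurable_const (by fun_prop)
  have key : ∀ q : ℕ, ∀ᵐ a ∂(volume.restrict (box d ∩ T q)), ∃ γ : ℝ, 0 < γ ∧ γ ≤ 1 ∧ ∀ p : ι,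
      γ * ((jap d (sqv (p.1 i₀) - sqv (p.1 i₁)) * jap d (p.1 i₀) * prodTail d p.1) ^ (d + 1) *
        jap d (p.1 i₀) ^ (4 * r + 12))⁻¹ ≤ |ff σ a p.1| := by
    intro q
    refine ae_exists_lower_bound (w := fun p : ι => 6 ^ d * (1024 * (q + 1) * C) *
      ((jap d (p.1 i₀) ^ (d + 1))⁻¹ * (japProd (tl p.1) ^ (d + 1))⁻¹)) ?_ ?_ ?_ ?_ ?_
    · intro p
      have := one_le_prodTail p.1
      have := jap_pos (p.1 i₀)
      have := jap_pos (sqv (p.1 i₀) - sqv (p.1 i₁))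
      positivity
    · intro p
      have := one_le_japProd (tl p.1)
      have := jap_pos (p.1 i₀)
      positivity
    · refine Summable.mul_left _ (((summable_inv_jap_pow d hd).mul_of_nonneg
        (summable_inv_japProd_pow d r hd) (fun j => by have := jap_pos j; positivity)
        (fun t => by have := one_le_japProd t; positivity)).comp_injective
          (i := fun p : ι => (p.1 i₀, tl p.1)) ?_)
      rintro ⟨j, hj, _⟩ ⟨j', hj', _⟩ h
      simp only [Prod.mk.injEq] at h
      exact Subtype.ext (eq_of_tl_eq h₀ h₁ hσ1 hj.1 hj'.1 h.1 h.2)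
    · rintro ⟨j, hj, hmax, hn, hspan⟩
      simp only
      set N := jap d (j i₀) with hN
      set P := prodTail d j with hP
      set n := sqv (j i₀) - sqv (j i₁) with hndef
      have hN1 : 1 ≤ N := one_le_jap _
      have hP1 : 1 ≤ P := one_le_prodTail j
      have hn0 : 0 < jap d n := jap_pos n
      obtain ⟨v, hv, hv1, hvC⟩ := hC (N ^ 2) (gen i₀ i₁ j) (sqv (j i₀)) (one_le_pow₀ hN1)
        (abs_gen_le hmax) (abs_sqv_le le_rfl) hspan
      set L := C * (N ^ 2) ^ (2 * r + 3) with hL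
      have hL0 : 0 < L := by positivity
      set ε := ((jap d n * N * P) ^ (d + 1) * N ^ (4 * r + 12))⁻¹ with hε
      have hε0 : 0 < ε := by positivity
      set τ₀ := 2 * ε * (512 * (q + 1) * L * N ^ 6 * jap d n ^ (d + 1)) with hτ₀
      have hτ₀0 : 0 < τ₀ := by positivity
      rw [Measure.restrict_apply' (hmb.inter (hT q))]
      refine (volume_le_of_translate_notMem (v := L⁻¹ • v) (τ₀ := τ₀) ?_
        (fun a ha => box_subset_cube d ha.2.1) ?_ hτ₀0 ?_).trans
        (ENNReal.ofReal_le_ofReal ?_)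
      · exact (measurableSet_lt (continuous_ff σ j).abs.measurable measurable_const).inter
          (hmb.inter (hT q))
      · intro i
        rw [Pi.smul_apply, smul_eq_mul, abs_mul, abs_of_pos (inv_pos.2 hL0), inv_mul_le_iff₀ hL0,
          mul_one]
        exact hvC i
      · rintro a ⟨ha, hab, haT⟩ τ hτ - ⟨hb, hbb, -⟩
        simp only [Set.mem_ofPred_eq] at ha hb
        have hη : L⁻¹ ≤ ip (L⁻¹ • v) (sqv (j i₀)) := by
          rw [ip_smul]
          exact le_mul_of_one_le_right (inv_pos.2 hL0).le hv1
        have hη0 := (inv_pos.2 hL0).trans_le hη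
        have hτ0 := hτ₀0.le.trans hτ
        have h3 := le_abs_ff_translate_sub h₀ h₁ hσ hσ01 (hmax i₁) hτ0 hab hbb
          hη0.le (fun k => by rw [ip_smul, hv, mul_zero])
        have h4 := abs_sub (ff σ (a + τ • L⁻¹ • v) j) (ff σ a j)
        have h5 : (jap d n ^ (d + 1))⁻¹ / (q + 1) ≤ |ip a n| := by
          rw [div_le_iff₀ (by positivity), mul_comm]
          exact haT n hn
        have h6 : 2 * ε ≤ τ * ip (L⁻¹ • v) (sqv (j i₀)) * |ip a n| / (512 * N ^ 6) := by
          calc 2 * ε = τ₀ * L⁻¹ * ((jap d n ^ (d + 1))⁻¹ / (q + 1)) / (512 * N ^ 6) := by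
                rw [hτ₀]; field_simp
            _ ≤ _ := by have := mul_nonneg hτ0 hη0.le; gcongr
        linarith
      · rw [japProd_tl, ← hP, mul_assoc]
        refine mul_le_mul_of_nonneg_left (le_of_eq ?_) (by positivity)
        have e1 : (N ^ 2) ^ (2 * r + 3) * N ^ 6 = N ^ (4 * r + 12) := by ring
        have e2 : τ₀ = ε * (1024 * (q + 1) * C * ((N ^ 2) ^ (2 * r + 3) * N ^ 6) *
            jap d n ^ (d + 1)) := by
          rw [hτ₀, hL]; ring
        rw [e2, e1, hε, mul_pow, mul_pow]
        field_simp
    · intro p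
      have h : ∀ᵐ a ∂(volume.restrict (box d ∩ T q)), ∀ j, Adm σ j → 0 < |ff σ a j| :=
        ae_restrict_of_ae_restrict_of_subset Set.inter_subset_left (ae_ff_pos hd hr hσ)
      filter_upwards [h] with a ha
      exact ha _ p.2.1
  have hdioph := ae_dioph (d := d) (ι := {n : Idx d // n ≠ 0}) (fun n => {n.1}) 1
    (fun n => by simp) (fun n z hz => by rw [Finset.mem_singleton.1 hz]; exact n.2)
    (w := fun n => (jap d n.1 ^ (d + 1))⁻¹) (fun n => by have := jap_pos n.1; positivity)
    ((summable_inv_jap_pow d hd).comp_injective Subtype.val_injective)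
  have hdioph' := ae_restrict_of_ae_restrict_of_subset (box_subset_cube d) hdioph
  rw [ae_restrict_iff' hmb] at hdioph' ⊢
  have key' : ∀ᵐ a, ∀ q : ℕ, a ∈ box d ∩ T q → ∃ γ : ℝ, 0 < γ ∧ γ ≤ 1 ∧ ∀ p : ι,
      γ * ((jap d (sqv (p.1 i₀) - sqv (p.1 i₁)) * jap d (p.1 i₀) * prodTail d p.1) ^ (d + 1) *
        jap d (p.1 i₀) ^ (4 * r + 12))⁻¹ ≤ |ff σ a p.1| :=
    ae_all_iff.2 fun q => (ae_restrict_iff' (hmb.inter (hT q))).1 (key q)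
  filter_upwards [hdioph', key'] with a h1 h2 hab
  obtain ⟨γ, hγ, -, h⟩ := h1 hab
  obtain ⟨q, hq⟩ := exists_nat_gt γ⁻¹
  have haT : a ∈ T q := fun n hn => by
    have h3 := h ⟨n, hn⟩ n (Finset.mem_singleton_self n)
    have h4 : γ⁻¹ * (γ * (jap d n ^ (d + 1))⁻¹) ≤ (q + 1) * |ip a n| :=
      mul_le_mul (by linarith) h3 (by have := jap_pos n; positivity) (by positivity)
    rwa [inv_mul_cancel_left₀ hγ.ne'] at h4
  obtain ⟨γ', hγ', -, h'⟩ := h2 q ⟨hab, haT⟩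
  exact ⟨γ', hγ', fun j hj hmax hn hspan => h' ⟨j, hj, hmax, hn, hspan⟩⟩

theorem rv_sub {d : ℕ} (x y : Idx d) : rv (x - y) = rv x - rv y := by
  funext l
  simp [rv]

/-- Vectors of the real span of a family are determined by their inner products with the
family. -/
theorem eq_of_dotProduct_eq_of_mem_span {d : ℕ} {ι : Type*} {g : ι → Idx d} {x x' : Idx d}
    (hx : rv x ∈ Submodule.span ℝ (Set.range fun k => rv (g k)))
    (hx' : rv x' ∈ Submodule.span ℝ (Set.range fun k => rv (g k)))
    (h : ∀ k, x ⬝ᵥ g k = x' ⬝ᵥ g k) : x = x' := by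
  have hz : rv (x - x') ∈ Submodule.span ℝ (Set.range fun k => rv (g k)) := by
    rw [rv_sub]
    exact Submodule.sub_mem _ hx hx'
  have h0 : ∀ u ∈ Submodule.span ℝ (Set.range fun k => rv (g k)), rv (x - x') ⬝ᵥ u = 0 := by
    intro u hu
    induction hu using Submodule.span_induction with
    | mem u hu =>
      obtain ⟨k, rfl⟩ := hu
      have h1 : (x - x') ⬝ᵥ g k = 0 := by rw [sub_dotProduct, h k, sub_self]
      have h2 : (((x - x') ⬝ᵥ g k : ℤ) : ℝ) = rv (x - x') ⬝ᵥ rv (g k) := by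
        simp [dotProduct, rv]
      rw [← h2, h1, Int.cast_zero]
    | zero => exact dotProduct_zero _
    | add u w _ _ hu hw => rw [dotProduct_add, hu, hw, add_zero]
    | smul c u _ hu => rw [dotProduct_smul, hu, smul_zero]
  have h1 := dotProduct_self_eq_zero.1 (h0 _ hz)
  funext l
  have h2 := congrFun h1 l
  simp only [rv, Pi.sub_apply, Pi.zero_apply] at h2
  exact sub_eq_zero.1 (by exact_mod_cast h2)

theorem eq_of_sqv_eq_of_sign_eq {d : ℕ} {x y : Idx d} (h : sqv x = sqv y)
    (hs : ∀ l, SignType.sign (x l) = SignType.sign (y l)) : x = y := by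
  funext l
  have h1 : |x l| = |y l| := by
    have := congrFun h l
    exact (sq_eq_sq_iff_abs_eq_abs _ _).1 this
  rw [← sign_mul_abs (x l), ← sign_mul_abs (y l), h1, hs l]

theorem ae_bound_of_mem_span {d r : ℕ} (hd : 0 < d) (hr : 1 ≤ r) {i₀ i₁ : Fin r}
    (h₀ : (i₀ : ℕ) = 0) (h₁ : (i₁ : ℕ) = 1) {σ : Fin r → ℤ} (hσ : ∀ i, σ i = 1 ∨ σ i = -1) :
    ∀ᵐ a ∂(volume.restrict (box d)), ∃ γ : ℝ, 0 < γ ∧ ∀ j : Fin r → Idx d,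
      Adm σ j → (∀ k, jap d (j k) ≤ jap d (j i₀)) →
      rv (sqv (j i₀)) ∈ Submodule.span ℝ (Set.range fun k => rv (gen i₀ i₁ j k)) →
      γ * (((jap d (sqv (j i₀) - sqv (j i₁)) * prodTail d j) ^ (d + 1) *
        ∏ k, (1 + ((sqv (j i₀) ⬝ᵥ gen i₀ i₁ j k : ℤ) : ℝ) ^ 2)) ^ (2 * r) *
        jap d (j i₀) ^ (8 * r))⁻¹ ≤ |ff σ a j| := by
  have hσ1 : σ i₁ ≠ 0 := by rcases hσ i₁ with h | h <;> rw [h] <;> decide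
  let ι := {j : Fin r → Idx d // Adm σ j ∧ (∀ k, jap d (j k) ≤ jap d (j i₀)) ∧
    rv (sqv (j i₀)) ∈ Submodule.span ℝ (Set.range fun k => rv (gen i₀ i₁ j k))}
  let F : Idx d × (Fin r → Idx d) × Idx r × (Fin d → SignType) → ℝ := fun q =>
    (jap d q.1 ^ (d + 1))⁻¹ * ((japProd q.2.1 ^ (d + 1))⁻¹ *
      ((∏ k, (1 + (q.2.2.1 k : ℝ) ^ 2) ^ (-1 : ℝ)) * 1))
  have hF : Summable F :=
    (summable_inv_jap_pow d hd).mul_of_nonneg ((summable_inv_japProd_pow d r hd).mul_of_nonneg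
      ((summable_prod_one_add_sq_rpow r (by norm_num)).mul_of_nonneg
        (Summable.of_finite (f := fun _ : Fin d → SignType => (1 : ℝ)))
        (fun y => by positivity) (fun _ => by simp))
      (fun t => by have := one_le_japProd t; positivity) (fun q => by positivity))
      (fun n => by have := jap_pos n; positivity)
      (fun q => by have := one_le_japProd q.1; positivity)
  let θ : ι → Idx d × (Fin r → Idx d) × Idx r × (Fin d → SignType) := fun p =>
    (sqv (p.1 i₀) - sqv (p.1 i₁), tl p.1, fun k => sqv (p.1 i₀) ⬝ᵥ gen i₀ i₁ p.1 k,
      fun l => SignType.sign (p.1 i₀ l))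
  have hθ : Function.Injective θ := by
    rintro ⟨j, hj, _, hs⟩ ⟨j', hj', _, hs'⟩ h
    simp only [θ, Prod.mk.injEq] at h
    obtain ⟨e1, e2, e3, e4⟩ := h
    have hgen : gen i₀ i₁ j = gen i₀ i₁ j' := by
      funext k
      unfold gen
      split_ifs with _ hk
      · exact e1
      · have := congrFun e2 k
        simp only [tl, hk, if_true] at this
        rw [this]
      · rfl
    rw [hgen] at hs e3
    have hsq := eq_of_dotProduct_eq_of_mem_span hs hs' fun k => congrFun e3 k
    exact Subtype.ext (eq_of_tl_eq h₀ h₁ hσ1 hj.1 hj'.1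
      (eq_of_sqv_eq_of_sign_eq hsq fun l => congrFun e4 l) e2)
  have hFe : ∀ p : ι, F (θ p) = ((jap d (sqv (p.1 i₀) - sqv (p.1 i₁)) * prodTail d p.1) ^ (d + 1) *
        ∏ k, (1 + ((sqv (p.1 i₀) ⬝ᵥ gen i₀ i₁ p.1 k : ℤ) : ℝ) ^ 2))⁻¹ := fun p => by
    simp only [F, θ, Real.rpow_neg_one, Finset.prod_inv_distrib, mul_one, japProd_tl, mul_pow,
      mul_inv, mul_assoc]
  have hG : ∀ p : ι, 1 ≤ (jap d (sqv (p.1 i₀) - sqv (p.1 i₁)) * prodTail d p.1) ^ (d + 1) *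
        ∏ k, (1 + ((sqv (p.1 i₀) ⬝ᵥ gen i₀ i₁ p.1 k : ℤ) : ℝ) ^ 2) := fun p =>
    one_le_mul_of_one_le_of_one_le
      (one_le_pow₀ (one_le_mul_of_one_le_of_one_le (one_le_jap _) (one_le_prodTail _)))
      (Finset.one_le_prod fun k _ => by simp only [le_add_iff_nonneg_right]; positivity)
  have h := ae_lower_bound (d := d) (ι := ι) (fun _ => 0) (fun p => cf σ p.1)
    (fun p => F (θ p)) (fun p => jap d (p.1 i₀) ^ 2) hr
    (fun p => by rw [hFe]; exact inv_pos.2 (one_pos.trans_le (hG p)))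
    (fun p => by rw [hFe]; exact inv_le_one_of_one_le₀ (hG p))
    (hF.comp_injective hθ)
    (fun p => one_le_pow₀ (one_le_jap _))
    (fun p => cf_support_card_le _ _)
    (fun p m hm l => by
      obtain ⟨k, -, rfl⟩ := Finset.mem_image.1 (cf_support_subset _ _ hm)
      exact ⟨(sqv_le _ l).1, (le_abs_self _).trans (abs_sqv_le (p.2.2.1 k) l)⟩)
    (fun p => Or.inr fun h => p.2.1.2 (isResonant_of_cf_eq_zero hσ h))
  filter_upwards [h] with a ⟨γ, hγ, ha⟩
  refine ⟨γ, hγ, fun j hj hmax hs => ?_⟩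
  have := ha ⟨j, hj, hmax, hs⟩
  rw [cf_sum_om, ip_zero, zero_add, hFe] at this
  refine le_trans (le_of_eq ?_) this
  rw [mul_inv, inv_pow, ← pow_mul, show 2 * (4 * r) = 8 * r by ring]

theorem exponent_bounds {d r : ℕ} (hd : 2 ≤ d) (hr : 3 ≤ r) :
    d + 1 ≤ 44 * d * r ^ 4 ∧ 4 * (d + 1) + 10 * d * r * (4 * r + 14) ≤ 44 * d * r ^ 4 ∧
      2 * r * (4 * (d + 1) + 6 * r) + 10 * d * r * (8 * r ^ 2 + 8 * r) ≤ 44 * d * r ^ 4 := by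
  have h1 : 3 * d ≤ d * r := by rw [mul_comm]; exact Nat.mul_le_mul_left _ hr
  have h2 : 3 * (d * r) ≤ d * r ^ 2 := by nlinarith
  have h3 : 3 * (d * r ^ 2) ≤ d * r ^ 3 := by
    calc 3 * (d * r ^ 2) ≤ r * (d * r ^ 2) := Nat.mul_le_mul_right _ hr
      _ = _ := by ring
  have h4 : 3 * (d * r ^ 3) ≤ d * r ^ 4 := by
    calc 3 * (d * r ^ 3) ≤ r * (d * r ^ 3) := Nat.mul_le_mul_right _ hr
      _ = _ := by ring
  have h5 : 2 * r ≤ d * r := Nat.mul_le_mul_right _ hd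
  have h6 : 2 * r ^ 2 ≤ d * r ^ 2 := Nat.mul_le_mul_right _ hd
  refine ⟨by linarith, by ring_nf at *; omega, by ring_nf at *; omega⟩

theorem mul_inv_le_of_le {N P c D γ x y : ℝ} {m e E : ℕ} (hN : 1 ≤ N) (hP : 1 ≤ P) (hc : 0 < c)
    (hD : 0 < D) (hγ : 0 ≤ γ) (hy : y ≤ (N ^ m)⁻¹) (hDle : D ≤ c * (N ^ m * P ^ e)) (heE : e ≤ E)
    (h : γ * D⁻¹ ≤ x) : γ / c * (y * (P ^ E)⁻¹) ≤ x := by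
  refine le_trans ?_ h
  calc γ / c * (y * (P ^ E)⁻¹) ≤ γ / c * ((N ^ m)⁻¹ * (P ^ e)⁻¹) := by gcongr
    _ = γ * (c * (N ^ m * P ^ e))⁻¹ := by rw [mul_inv, mul_inv]; ring
    _ ≤ _ := by gcongr

theorem abs_dotProduct_le {d : ℕ} {x y : Idx d} {A B : ℝ} (hA : 0 ≤ A)
    (hx : ∀ l, |(x l : ℝ)| ≤ A) (hy : ∀ l, |(y l : ℝ)| ≤ B) :
    |((x ⬝ᵥ y : ℤ) : ℝ)| ≤ d * (A * B) := by
  simp only [dotProduct]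
  push_cast
  refine (Finset.abs_sum_le_sum_abs _ _).trans ?_
  calc _ ≤ ∑ _l : Fin d, A * B := Finset.sum_le_sum fun l _ => by
        rw [abs_mul]
        exact mul_le_mul (hx l) (hy l) (abs_nonneg _) hA
    _ = _ := by simp

theorem ae_bound_of_opposite_sign {d r : ℕ} (hd : 2 ≤ d) (hr : 3 ≤ r) {i₀ i₁ : Fin r}
    (h₀ : (i₀ : ℕ) = 0) (h₁ : (i₁ : ℕ) = 1) {σ : Fin r → ℤ} (hσ : ∀ i, σ i = 1 ∨ σ i = -1)
    (hσ01 : σ i₀ * σ i₁ = -1) {δ : ℝ} (hδ : 0 < δ) :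
    ∀ᵐ a ∂(volume.restrict (box d)), ∃ γ : ℝ, 0 < γ ∧ ∀ j : Fin r → Idx d,
      (∀ i i' : Fin r, i ≤ i' → enorm d (j i') ≤ enorm d (j i)) → (∑ k, σ k • j k) = 0 →
      ¬ IsResonant σ j →
      γ * (jap d (j i₀) ^ (-((d : ℝ) - 1 + δ)) * (prodTail d j ^ (44 * d * r ^ 4))⁻¹) ≤
        |ff σ a j| := by
  have hd0 : 0 < d := by omega
  have hr1 : 1 ≤ r := by omega
  obtain ⟨x1, x3, x4⟩ := exponent_bounds hd hr
  filter_upwards [ae_bound_of_large_coordinate hd0 hr1 h₀ h₁ hσ hσ01 hδ,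
    ae_bound_or_jap_le hd hr h₀ h₁ hσ hσ01, ae_bound_of_notMem_span hd0 hr1 h₀ h₁ hσ hσ01,
    ae_bound_of_mem_span hd0 hr1 h₀ h₁ hσ] with a ⟨γ₁, hγ₁, _, b1⟩ ⟨γ₂, C, hγ₂, hC, b2⟩ ⟨γ₃, hγ₃, b3⟩
    ⟨γ₄, hγ₄, b4⟩
  set K : ℝ := (d + 1) * (8 * (r + 1) ^ 2) with hK
  have hrr : (0 : ℝ) ≤ r := by positivity
  have hdr : (2 : ℝ) ≤ d := by exact_mod_cast hd
  have hK8 : 8 * ((r : ℝ) + 1) ^ 2 ≤ K := by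
    rw [hK]
    exact le_mul_of_one_le_left (by positivity) (by linarith)
  have hK1 : 1 ≤ K := by nlinarith
  have hK0 : 0 < K := by linarith
  have hC0 : 0 < C := by linarith
  set c₃ := K ^ (d + 1) * C ^ (4 * r + 14) with hc₃
  set c₄ := (K ^ (d + 1) * (4 * d ^ 2 * K ^ 2) ^ r) ^ (2 * r) * C ^ (8 * r ^ 2 + 8 * r) with hc₄
  have hc₃0 : 0 < c₃ := by positivity
  have hc₄0 : 0 < c₄ := by positivity
  refine ⟨min (min γ₁ γ₂) (min (γ₃ / c₃) (γ₄ / c₄)), by positivity, fun j hsort hj hres => ?_⟩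
  have hmax : ∀ k, jap d (j k) ≤ jap d (j i₀) := fun k =>
    jap_le_jap (hsort i₀ k (by rw [Fin.le_def, h₀]; exact Nat.zero_le _))
  have hadm : Adm σ j := ⟨hj, hres⟩
  set P := prodTail d j with hP
  set N := jap d (j i₀) with hN
  have hP1 : 1 ≤ P := one_le_prodTail j
  have hN1 : 1 ≤ N := one_le_jap _
  set y := N ^ (-((d : ℝ) - 1 + δ)) with hy
  have hy0 : 0 ≤ y := by positivity
  have hy1 : y ≤ (N ^ (d - 1))⁻¹ := by
    rw [hy, ← Real.rpow_natCast, ← Real.rpow_neg (by linarith), Nat.cast_sub (by omega),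
      Nat.cast_one]
    exact Real.rpow_le_rpow_of_exponent_le hN1 (by linarith)
  have hy2 : y ≤ 1 := hy1.trans (inv_le_one_of_one_le₀ (one_le_pow₀ hN1))
  have hyP : 0 ≤ y * (P ^ (44 * d * r ^ 4))⁻¹ := by positivity
  have hstep : ∀ γ', min (min γ₁ γ₂) (min (γ₃ / c₃) (γ₄ / c₄)) ≤ γ' →
      γ' * (y * (P ^ (44 * d * r ^ 4))⁻¹) ≤ |ff σ a j| →
      min (min γ₁ γ₂) (min (γ₃ / c₃) (γ₄ / c₄)) * (y * (P ^ (44 * d * r ^ 4))⁻¹) ≤ |ff σ a j| :=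
    fun γ' h h' => (mul_le_mul_of_nonneg_right h hyP).trans h'
  by_cases hbig : ∃ i, j i₀ i ≠ j i₁ i ∧ (2 * r + 4) * P ^ 2 ≤ |(j i₀ i : ℝ)|
  · obtain ⟨i, hne, hi⟩ := hbig
    refine hstep γ₁ (by simp) (le_trans ?_ (b1 j i hadm hne hi))
    gcongr
  push Not at hbig
  rcases b2 j hadm (hmax i₁) hbig with h | ⟨hn0, hNC⟩
  · refine hstep γ₂ (by simp) (le_trans ?_ h)
    rw [← hP]
    refine mul_le_mul_of_nonneg_left (mul_le_of_le_one_left (by positivity) hy2) hγ₂.le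
  rw [← hP] at hNC
  have hJ := abs_sub_le_of_momentum h₀ h₁ hσ hσ01 hj
  have hnl := abs_sqv_sub_sqv_le hP1 hJ hbig
  set n := sqv (j i₀) - sqv (j i₁) with hn
  have hjn : jap d n ≤ K * P ^ 3 := by
    rw [hK, mul_assoc]
    exact jap_le_of_abs_le (one_le_mul_of_one_le_of_one_le (by nlinarith) (one_le_pow₀ hP1)) hnl
  have hjn0 := jap_pos n
  by_cases hspan : rv (sqv (j i₀)) ∈ Submodule.span ℝ (Set.range fun k => rv (gen i₀ i₁ j k))
  · have hgen : ∀ k l, |(gen i₀ i₁ j k l : ℝ)| ≤ K * P ^ 3 := by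
      intro k l
      unfold gen
      split_ifs with _ hk
      · exact (hnl l).trans (by gcongr)
      · refine (abs_sqv_le (jap_le_prodTail j hk) l).trans ?_
        rw [← hP]
        calc P ^ 2 ≤ P ^ 3 := pow_le_pow_right₀ hP1 (by norm_num)
          _ ≤ _ := le_mul_of_one_le_left (by positivity) hK1
      · simp only [Pi.zero_apply, Int.cast_zero, abs_zero]; positivity
    have hprod : ∏ k, (1 + ((sqv (j i₀) ⬝ᵥ gen i₀ i₁ j k : ℤ) : ℝ) ^ 2) ≤
        (4 * d ^ 2 * K ^ 2 * (N ^ 4 * P ^ 6)) ^ r := by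
      calc _ ≤ ∏ _k : Fin r, 4 * d ^ 2 * K ^ 2 * (N ^ 4 * P ^ 6) := by
            refine Finset.prod_le_prod (fun _ _ => by positivity) fun k _ => ?_
            have h := abs_dotProduct_le (x := sqv (j i₀)) (sq_nonneg N) (abs_sqv_le le_rfl) (hgen k)
            have h2 : ((sqv (j i₀) ⬝ᵥ gen i₀ i₁ j k : ℤ) : ℝ) ^ 2 ≤
                (d * (N ^ 2 * (K * P ^ 3))) ^ 2 := by
              rw [← sq_abs]; gcongr
            have h3 : 1 ≤ (d * (N ^ 2 * (K * P ^ 3))) ^ 2 :=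
              one_le_pow₀ (one_le_mul_of_one_le_of_one_le (by linarith)
                (one_le_mul_of_one_le_of_one_le (one_le_pow₀ hN1)
                  (one_le_mul_of_one_le_of_one_le hK1 (one_le_pow₀ hP1))))
            calc _ ≤ 4 * (d * (N ^ 2 * (K * P ^ 3))) ^ 2 := by linarith
              _ = _ := by ring
        _ = _ := by simp
    refine hstep (γ₄ / c₄) (by simp) (mul_inv_le_of_le (m := 0) hN1 hP1 hc₄0 ?_ hγ₄.le
      (by simpa using hy2) ?_ x4 (b4 j hadm hmax hspan))
    · rw [← hn, ← hP]
      have : 0 < ∏ k, (1 + ((sqv (j i₀) ⬝ᵥ gen i₀ i₁ j k : ℤ) : ℝ) ^ 2) :=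
        Finset.prod_pos fun _ _ => by positivity
      positivity
    · rw [← hn, ← hP, ← hN]
      calc _ ≤ ((K * P ^ 3 * P) ^ (d + 1) * (4 * d ^ 2 * K ^ 2 * (N ^ 4 * P ^ 6)) ^ r) ^ (2 * r) *
            N ^ (8 * r) := by
            have : 0 ≤ ∏ k, (1 + ((sqv (j i₀) ⬝ᵥ gen i₀ i₁ j k : ℤ) : ℝ) ^ 2) :=
              Finset.prod_nonneg fun _ _ => by positivity
            gcongr
        _ = (K ^ (d + 1) * (4 * d ^ 2 * K ^ 2) ^ r) ^ (2 * r) *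
            P ^ (2 * r * (4 * (d + 1) + 6 * r)) * N ^ (8 * r ^ 2 + 8 * r) := by
            rw [show K * P ^ 3 * P = K * P ^ 4 by ring]
            simp only [mul_pow, ← pow_mul]
            ring
        _ ≤ (K ^ (d + 1) * (4 * d ^ 2 * K ^ 2) ^ r) ^ (2 * r) *
            P ^ (2 * r * (4 * (d + 1) + 6 * r)) * (C * P ^ (10 * d * r)) ^ (8 * r ^ 2 + 8 * r) := by
            gcongr
        _ = _ := by rw [hc₄, mul_pow C, ← pow_mul, pow_zero, one_mul, pow_add P]; ring
  · refine hstep (γ₃ / c₃) (by simp) (mul_inv_le_of_le (m := d - 1) hN1 hP1 hc₃0 ?_ hγ₃.le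
      hy1 ?_ x3 (b3 j hadm hmax hn0 hspan))
    · positivity
    · rw [← hn, ← hP, ← hN]
      calc _ ≤ (K * P ^ 3 * N * P) ^ (d + 1) * N ^ (4 * r + 12) := by gcongr
        _ = K ^ (d + 1) * P ^ (4 * (d + 1)) * N ^ (d - 1) * N ^ (4 * r + 14) := by
            obtain ⟨q, rfl⟩ := Nat.exists_eq_add_of_le hd
            rw [show 2 + q - 1 = q + 1 by omega]
            ring_nf
        _ ≤ K ^ (d + 1) * P ^ (4 * (d + 1)) * N ^ (d - 1) *
            (C * P ^ (10 * d * r)) ^ (4 * r + 14) := by gcongr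
        _ = _ := by rw [hc₃, mul_pow C, ← pow_mul, pow_add P]; ring

/-- The lower bounds on the small divisors of non-resonant families of length `r`, with
constant `κ` and loss `δ`. -/
def NRBound (d r : ℕ) (δ κ : ℝ) (a : Fin d → ℝ) : Prop :=
  ∀ (σ : Fin r → ℤ) (i₀ i₁ : Fin r) (j : Fin r → Idx d), (∀ i, σ i = 1 ∨ σ i = -1) →
    (i₀ : ℕ) = 0 → (i₁ : ℕ) = 1 → (∑ k, σ k • j k) = 0 →
    (∀ i i' : Fin r, i ≤ i' → enorm d (j i') ≤ enorm d (j i)) → ¬ IsResonant σ j →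
    (σ i₀ * σ i₁ = 1 → κ * (prodTail d j ^ (9 * d * r ^ 2))⁻¹ ≤ |ff σ a j|) ∧
    (σ i₀ * σ i₁ = -1 → κ * (jap d (j i₀) ^ (-((d : ℝ) - 1 + δ)) *
      (prodTail d j ^ (44 * d * r ^ 4))⁻¹) ≤ |ff σ a j|)

theorem NRBound.mono {d r : ℕ} {δ κ κ' : ℝ} {a : Fin d → ℝ} (h : κ' ≤ κ)
    (H : NRBound d r δ κ a) : NRBound d r δ κ' a := by
  intro σ i₀ i₁ j hσ h₀ h₁ hj hs hres
  obtain ⟨H1, H2⟩ := H σ i₀ i₁ j hσ h₀ h₁ hj hs hres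
  have hP := one_le_prodTail j
  have hN := jap_pos (j i₀)
  refine ⟨fun hσ01 => (mul_le_mul_of_nonneg_right h ?_).trans (H1 hσ01),
    fun hσ01 => (mul_le_mul_of_nonneg_right h ?_).trans (H2 hσ01)⟩ <;> positivity

theorem measurableSet_NRBound (d r : ℕ) (δ κ : ℝ) :
    MeasurableSet {a : Fin d → ℝ | NRBound d r δ κ a} := by
  have hc : ∀ (σ : Fin r → ℤ) (j : Fin r → Idx d) (x : ℝ),
      MeasurableSet {a : Fin d → ℝ | x ≤ |ff σ a j|} := fun σ j x =>
    measurableSet_le measurable_const (continuous_ff σ j).abs.measurable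
  unfold NRBound
  simp only [Set.ofPred_forall, Set.ofPred_and]
  exact .iInter fun σ => .iInter fun _ => .iInter fun _ => .iInter fun j => .iInter fun _ =>
    .iInter fun _ => .iInter fun _ => .iInter fun _ => .iInter fun _ => .iInter fun _ =>
    .inter (.iInter fun _ => hc _ _ _) (.iInter fun _ => hc _ _ _)

theorem ae_exists_NRBound {d r : ℕ} (hd : 2 ≤ d) (hr : 3 ≤ r) {δ : ℝ} (hδ : 0 < δ) :
    ∀ᵐ a ∂(volume.restrict (box d)), ∃ κ : ℝ, 0 < κ ∧ NRBound d r δ κ a := by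
  let S := {σ : Fin r → ℤ // ∀ i, σ i = 1 ∨ σ i = -1}
  have hfin : Finite S := (Set.Finite.pi' fun _ : Fin r => Set.toFinite ({1, -1} : Set ℤ)).to_subtype
  have hne : Nonempty S := ⟨⟨1, fun _ => Or.inl rfl⟩⟩
  let i₀ : Fin r := ⟨0, by omega⟩
  let i₁ : Fin r := ⟨1, by omega⟩
  have key : ∀ σ : S, ∀ᵐ a ∂(volume.restrict (box d)), ∃ κ : ℝ, 0 < κ ∧ ∀ j : Fin r → Idx d,
      (∑ k, σ.1 k • j k) = 0 →
      (∀ i i' : Fin r, i ≤ i' → enorm d (j i') ≤ enorm d (j i)) → ¬ IsResonant σ.1 j →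
      (σ.1 i₀ * σ.1 i₁ = 1 → κ * (prodTail d j ^ (9 * d * r ^ 2))⁻¹ ≤ |ff σ.1 a j|) ∧
      (σ.1 i₀ * σ.1 i₁ = -1 → κ * (jap d (j i₀) ^ (-((d : ℝ) - 1 + δ)) *
        (prodTail d j ^ (44 * d * r ^ 4))⁻¹) ≤ |ff σ.1 a j|) := by
    rintro ⟨σ, hσ⟩
    have hcases : σ i₀ * σ i₁ = 1 ∨ σ i₀ * σ i₁ = -1 := by
      rcases hσ i₀ with h | h <;> rcases hσ i₁ with h' | h' <;> simp [h, h']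
    rcases hcases with h | h
    · filter_upwards [ae_bound_of_same_sign hd hr (i₀ := i₀) (i₁ := i₁) rfl rfl hσ h]
        with a ⟨κ, hκ, ha⟩
      refine ⟨κ, hκ, fun j _ hs hres => ⟨fun _ => ha j hs hres, fun h' => ?_⟩⟩
      simp only [h] at h'
      omega
    · filter_upwards [ae_bound_of_opposite_sign hd hr (i₀ := i₀) (i₁ := i₁) rfl rfl hσ h hδ]
        with a ⟨κ, hκ, ha⟩
      refine ⟨κ, hκ, fun j hj hs hres => ⟨fun h' => ?_, fun _ => ha j hs hj hres⟩⟩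
      simp only [h] at h'
      omega
  filter_upwards [ae_all_iff.2 key] with a ha
  choose κ hκ hb using ha
  obtain ⟨σ₀, hσ₀⟩ := Finite.exists_min κ
  refine ⟨κ σ₀, hκ σ₀, fun σ k₀ k₁ j hσ h₀ h₁ hj hs hres => ?_⟩
  obtain rfl : k₀ = i₀ := Fin.ext h₀
  obtain rfl : k₁ = i₁ := Fin.ext h₁
  obtain ⟨H1, H2⟩ := hb ⟨σ, hσ⟩ j hj hs hres
  have hP := one_le_prodTail j
  have hN := jap_pos (j i₀)
  refine ⟨fun h => (mul_le_mul_of_nonneg_right (hσ₀ ⟨σ, hσ⟩) ?_).trans (H1 h),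
    fun h => (mul_le_mul_of_nonneg_right (hσ₀ ⟨σ, hσ⟩) ?_).trans (H2 h)⟩ <;> positivity

/-- Proposition 2.2, `mainNR`: for almost every `a ∈ (1,4)^d` there
is `γ > 0` such that for every `δ > 0`, `r ≥ 3` and every zero-momentum,
norm-decreasing couple `(σ,j)`, either `(σ,j)` is resonant, or the small divisor
`|Σ_k σ_k √(1+|j_k|_a⁴)|` enjoys the stated lower bound, with constants depending
only on `r` (resp. on `r,δ`). -/
theorem main_nonresonance (d : ℕ) (hd : 2 ≤ d) :
    ∃ c : ℕ → ℝ, ∃ C : ℕ → ℝ → ℝ,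
      (∀ r, 0 < c r) ∧ (∀ r δ, 0 < δ → 0 < C r δ) ∧
      ∀ᵐ a ∂(volume : Measure (Fin d → ℝ)), a ∈ box d →
        ∃ γ : ℝ, 0 < γ ∧
          ∀ (r : ℕ) (hr : 3 ≤ r) (δ : ℝ), 0 < δ →
            ∀ (σ : Fin r → ℤ) (j : Fin r → Idx d),
              (∀ i, σ i = 1 ∨ σ i = -1) →
              (∑ i, σ i • j i) = 0 →
              (∀ i i' : Fin r, i ≤ i' → enorm d (j i') ≤ enorm d (j i)) →
              IsResonant σ j ∨
              (σ ⟨0, by omega⟩ * σ ⟨1, by omega⟩ = 1 ∧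
                c r * (γ * prodTail d j ^ (-(9 * (d : ℝ) * (r : ℝ) ^ 2))) ≤
                  |∑ k, (σ k : ℝ) * omg d a (j k)|) ∨
              (σ ⟨0, by omega⟩ * σ ⟨1, by omega⟩ = -1 ∧
                C r δ * (γ * jap d (j ⟨0, by omega⟩) ^ (-((d : ℝ) - 1 + δ)) *
                    prodTail d j ^ (-(44 * (d : ℝ) * (r : ℝ) ^ 4))) ≤
                  |∑ k, (σ k : ℝ) * omg d a (j k)|) := by
  have hmb : MeasurableSet (box d) := MeasurableSet.univ_pi fun _ => measurableSet_Ioo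
  have hfm : IsFiniteMeasure (volume.restrict (box d)) := by
    refine ⟨?_⟩
    rw [Measure.restrict_apply_univ, box, Real.volume_pi_Ioo]
    exact ENNReal.prod_lt_top fun _ _ => ENNReal.ofReal_lt_top
  obtain ⟨κ, hκ, hae⟩ := exists_uniform_thresholds (ι := ℕ × ℕ) (μ := volume.restrict (box d))
    (p := fun i κ a => NRBound d (i.1 + 3) (1 / ((i.2 : ℝ) + 1)) κ a)
    (fun _ _ _ _ _ h H => H.mono h) (fun _ _ => measurableSet_NRBound _ _ _ _)
    (fun i => ae_exists_NRBound hd (by omega) (by positivity))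
  refine ⟨fun r => κ (r - 3, 0), fun r δ => κ (r - 3, ⌈1 / δ⌉₊), fun _ => hκ _, fun _ _ _ => hκ _, ?_⟩
  rw [ae_restrict_iff' hmb] at hae
  filter_upwards [hae] with a ha hab
  obtain ⟨γ, hγ, H⟩ := ha hab
  refine ⟨γ, hγ, fun r hr δ hδ σ j hσ hj hs => ?_⟩
  by_cases hres : IsResonant σ j
  · exact Or.inl hres
  right
  have hP := one_le_prodTail j
  have hN := one_le_jap (j ⟨0, by omega⟩)
  have hff : (∑ k, (σ k : ℝ) * omg d a (j k)) = ff σ a j := by simp only [omg_eq, ff]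
  have hr3 : r - 3 + 3 = r := by omega
  have hcases : σ ⟨0, by omega⟩ * σ ⟨1, by omega⟩ = 1 ∨ σ ⟨0, by omega⟩ * σ ⟨1, by omega⟩ = -1 := by
    rcases hσ ⟨0, by omega⟩ with h | h <;> rcases hσ ⟨1, by omega⟩ with h' | h' <;> simp [h, h']
  rw [hff]
  rcases hcases with h | h
  · have hb := H (r - 3, 0)
    simp only [hr3] at hb
    refine Or.inl ⟨h, le_trans (le_of_eq ?_) ((hb σ _ _ j hσ rfl rfl hj hs hres).1 h)⟩
    have e : 9 * (d : ℝ) * (r : ℝ) ^ 2 = ((9 * d * r ^ 2 : ℕ) : ℝ) := by push_cast; ring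
    rw [e, Real.rpow_neg (by linarith), Real.rpow_natCast]
    ring
  · have hb := H (r - 3, ⌈1 / δ⌉₊)
    simp only [hr3] at hb
    refine Or.inr ⟨h, le_trans ?_ ((hb σ _ _ j hσ rfl rfl hj hs hres).2 h)⟩
    have e : 44 * (d : ℝ) * (r : ℝ) ^ 4 = ((44 * d * r ^ 4 : ℕ) : ℝ) := by push_cast; ring
    have hδ' : 1 / ((⌈1 / δ⌉₊ : ℝ) + 1) ≤ δ := by
      have := Nat.le_ceil (1 / δ)
      rw [div_le_iff₀ hδ] at this
      rw [div_le_iff₀ (by positivity)]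
      linarith
    have hκ0 := hκ (r - 3, ⌈1 / δ⌉₊)
    have hP0 : (0 : ℝ) < (prodTail d j ^ (44 * d * r ^ 4))⁻¹ := by positivity
    rw [e, Real.rpow_neg (x := prodTail d j) (by linarith), Real.rpow_natCast]
    calc _ = κ (r - 3, ⌈1 / δ⌉₊) * γ * (jap d (j ⟨0, by omega⟩) ^ (-((d : ℝ) - 1 + δ)) *
          (prodTail d j ^ (44 * d * r ^ 4))⁻¹) := by ring
      _ ≤ κ (r - 3, ⌈1 / δ⌉₊) * γ * (jap d (j ⟨0, by omega⟩) ^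
          (-((d : ℝ) - 1 + 1 / ((⌈1 / δ⌉₊ : ℝ) + 1))) *
          (prodTail d j ^ (44 * d * r ^ 4))⁻¹) := by
        have := Real.rpow_le_rpow_of_exponent_le hN
          (show -((d : ℝ) - 1 + δ) ≤ -((d : ℝ) - 1 + 1 / ((⌈1 / δ⌉₊ : ℝ) + 1)) by linarith)
        gcongr
      _ ≤ _ := le_of_eq (by ring)

end BeamPaper
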